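/- arXiv:2012.11170 — 5 statements merged into one kernel-verified Lean document; each statement's English description precedes it below -/
import Mathlib

section
/- Let p ∈ (1,2], p' = p/(p−1), b ∈ ℝ∖{0}, h ≥ 0 and d ∈ ℕ. There exists a constant C = C(b,p,h,d) > 0 such that for every incompressible sequence Λ = (μ_n)_{n∈ℤ} of density d lying in the strip Π_h and every g ∈ L^p[0,1], setting G(λ) := ∫₀¹ g(t) e^{ibλt} dt, one has ∑_{n∈ℤ} |G(μ_n)|^{p'} ≤ C · ‖g‖_{L^p[0,1]}^{p'}. -/
open MeasureTheory

/-- A sequence `Λ : ℤ → ℂ` is *incompressible of density `d`* if every vertical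
strip `[t-1, t+1] × ℝ` contains at most `d` entries of the sequence. -/
def Incompressible (d : ℕ) (Λ : ℤ → ℂ) : Prop :=
  ∀ t : ℝ, {n : ℤ | |(Λ n).re - t| ≤ 1}.encard ≤ (d : ℕ∞)

/-- The `L^p`-norm of `g` on `[0,1]`. -/
noncomputable def lpNorm01 (p : ℝ) (g : ℝ → ℂ) : ℝ :=
  (∫ t in (0:ℝ)..1, ‖g t‖ ^ p) ^ (1 / p)

open Set

theorem HasSum.sq_le_mul_of_weights {w x : ℕ → ℝ} {W S Q : ℝ} (hw : ∀ j, 0 ≤ w j) (hW : 0 < W)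
    (h0 : HasSum w W) (h1 : HasSum (fun j => w j * x j) S) (h2 : HasSum (fun j => w j * x j ^ 2) Q) :
    S ^ 2 ≤ W * Q := by
  have h3 := (h2.sub (h1.mul_left (2 * (S / W)))).add (h0.mul_left ((S / W) ^ 2))
  have h4 : 0 ≤ Q - 2 * (S / W) * S + (S / W) ^ 2 * W := by
    refine h3.nonneg fun j => ?_
    have := mul_nonneg (hw j) (sq_nonneg (x j - S / W))
    linarith
  have h5 : Q - 2 * (S / W) * S + (S / W) ^ 2 * W = (W * Q - S ^ 2) / W := by
    field_simp
    ring
  rw [h5, le_div_iff₀ hW] at h4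
  linarith

/-- Bessel's inequality on `[0, T]` for functions supported in `[0, 1]`. -/
theorem sum_sq_norm_integral_mul_exp_le {T : ℝ} (hT : 1 ≤ T) {f : ℝ → ℂ}
    (hf : MemLp f 2 (volume.restrict (Ioc 0 1))) (K : Finset ℤ) :
    ∑ k ∈ K, ‖∫ t in Ioc (0 : ℝ) 1, f t * Complex.exp (2 * Real.pi * Complex.I * k * t / T)‖ ^ 2 ≤
      T * ∫ t in Ioc (0 : ℝ) 1, ‖f t‖ ^ 2 := by
  have hT0 : 0 < T := by linarith
  have hsub : Ioc (0 : ℝ) 1 ⊆ Ioc 0 T := Ioc_subset_Ioc_right hT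
  have hF : MemLp ((Ioc (0 : ℝ) 1).indicator f) 2 (volume.restrict (Ioc 0 T)) := by
    rw [memLp_indicator_iff_restrict measurableSet_Ioc, Measure.restrict_restrict measurableSet_Ioc,
      inter_eq_left.2 hsub]
    exact hf
  have hs := hasSum_sq_fourierCoeffOn hT0 hF
  have hnorm : ∫ t in (0 : ℝ)..T, ‖(Ioc (0 : ℝ) 1).indicator f t‖ ^ 2 =
      ∫ t in Ioc (0 : ℝ) 1, ‖f t‖ ^ 2 := by
    rw [intervalIntegral.integral_of_le hT0.le,
      setIntegral_eq_of_subset_of_forall_sdiff_eq_zero measurableSet_Ioc hsub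
        fun t ht => by simp [ht.2]]
    exact setIntegral_congr_fun measurableSet_Ioc fun t ht => by simp [ht]
  have hcoeff (k : ℤ) : ∫ t in Ioc (0 : ℝ) 1,
      f t * Complex.exp (2 * Real.pi * Complex.I * k * t / T) =
      T * fourierCoeffOn hT0 ((Ioc (0 : ℝ) 1).indicator f) (-k) := by
    have hT' : (T : ℂ) ≠ 0 := by exact_mod_cast hT0.ne'
    rw [fourierCoeffOn_eq_integral, intervalIntegral.integral_of_le hT0.le,
      setIntegral_eq_of_subset_of_forall_sdiff_eq_zero measurableSet_Ioc hsub
        fun t ht => by simp [ht.2]]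
    simp only [sub_zero, neg_neg, Complex.real_smul, Complex.ofReal_div, Complex.ofReal_one]
    rw [← mul_assoc, mul_one_div_cancel hT', one_mul]
    exact setIntegral_congr_fun measurableSet_Ioc fun t ht => by
      rw [fourier_coe_apply, indicator_of_mem ht, smul_eq_mul, sub_zero]
      exact mul_comm _ _
  have hle : ∑ k ∈ K, ‖fourierCoeffOn hT0 ((Ioc (0 : ℝ) 1).indicator f) (-k)‖ ^ 2 ≤
      T⁻¹ * ∫ t in Ioc (0 : ℝ) 1, ‖f t‖ ^ 2 := by
    have h1 := ((Equiv.neg ℤ).hasSum_iff.2 hs)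
    rw [hnorm, sub_zero, smul_eq_mul] at h1
    exact sum_le_hasSum K (fun _ _ => by positivity) h1
  calc _ = T ^ 2 * ∑ k ∈ K, ‖fourierCoeffOn hT0 ((Ioc (0 : ℝ) 1).indicator f) (-k)‖ ^ 2 := by
        simp_rw [hcoeff, norm_mul, mul_pow, Finset.mul_sum]
        simp
    _ ≤ T ^ 2 * (T⁻¹ * ∫ t in Ioc (0 : ℝ) 1, ‖f t‖ ^ 2) := by gcongr
    _ = _ := by field_simp

theorem sq_norm_integral_mul_exp_mul_exp_le {f : ℝ → ℂ} (hf : IntegrableOn f (Ioc 0 1)) {R : ℝ}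
    {e : ℝ → ℂ} (he : Continuous e) (he1 : ∀ t, ‖e t‖ = 1) {δ : ℂ} (hδ : ‖δ‖ ≤ R) :
    Summable (fun j : ℕ => R ^ j / j.factorial * ‖∫ t in Ioc (0 : ℝ) 1, t ^ j * f t * e t‖ ^ 2) ∧
    ‖∫ t in Ioc (0 : ℝ) 1, f t * e t * Complex.exp (δ * t)‖ ^ 2 ≤
      Real.exp R * ∑' j : ℕ, R ^ j / j.factorial *
        ‖∫ t in Ioc (0 : ℝ) 1, t ^ j * f t * e t‖ ^ 2 := by
  have hR : 0 ≤ R := (norm_nonneg _).trans hδ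
  set M := ∫ t in Ioc (0 : ℝ) 1, ‖f t‖
  set x : ℕ → ℝ := fun j => ‖∫ t in Ioc (0 : ℝ) 1, t ^ j * f t * e t‖
  have hexp : HasSum (fun j : ℕ => R ^ j / j.factorial) (Real.exp R) := by
    rw [Real.exp_eq_exp_ℝ]
    exact NormedSpace.expSeries_div_hasSum_exp R
  have hpt (j : ℕ) (t : ℝ) (ht : t ∈ Ioc (0 : ℝ) 1) : ‖(t : ℂ) ^ j * f t * e t‖ ≤ ‖f t‖ := by
    rw [norm_mul, norm_mul, he1, mul_one, norm_pow, Complex.norm_real, Real.norm_eq_abs,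
      abs_of_pos ht.1]
    exact mul_le_of_le_one_left (norm_nonneg _) (pow_le_one₀ ht.1.le ht.2)
  have hx (j : ℕ) : x j ≤ M :=
    norm_integral_le_of_norm_le hf.norm
      ((ae_restrict_iff' measurableSet_Ioc).2 (ae_of_all _ fun t ht => hpt j t ht))
  have hx0 (j : ℕ) : 0 ≤ x j := norm_nonneg _
  have hs1 : Summable (fun j : ℕ => R ^ j / j.factorial * x j) :=
    Summable.of_nonneg_of_le (fun j => by positivity)
      (fun j => mul_le_mul_of_nonneg_left (hx j) (by positivity)) (hexp.summable.mul_right M)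
  have hs2 : Summable (fun j : ℕ => R ^ j / j.factorial * x j ^ 2) :=
    Summable.of_nonneg_of_le (fun j => by positivity)
      (fun j => mul_le_mul_of_nonneg_left (pow_le_pow_left₀ (hx0 j) (hx j) 2) (by positivity))
      (hexp.summable.mul_right (M ^ 2))
  refine ⟨hs2, le_trans (pow_le_pow_left₀ (norm_nonneg _) ?_ 2)
    (HasSum.sq_le_mul_of_weights (fun j => by positivity) (Real.exp_pos R) hexp hs1.hasSum
      hs2.hasSum)⟩
  have hsum : HasSum (fun j : ℕ => ∫ t in Ioc (0 : ℝ) 1,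
      δ ^ j / j.factorial * (t ^ j * f t * e t))
      (∫ t in Ioc (0 : ℝ) 1, f t * e t * Complex.exp (δ * t)) := by
    refine hasSum_integral_of_dominated_convergence
      (fun j t => R ^ j / j.factorial * ‖f t‖) (fun j => ?_) (fun j => ?_) ?_ ?_ ?_
    · exact (((by fun_prop : Continuous fun t : ℝ => (t : ℂ) ^ j).aestronglyMeasurable.mul
        hf.aestronglyMeasurable).mul he.aestronglyMeasurable).const_mul _
    · refine (ae_restrict_iff' measurableSet_Ioc).2 (ae_of_all _ fun t ht => ?_)
      rw [norm_mul, norm_div, norm_pow, Complex.norm_natCast]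
      gcongr
      exact hpt j t ht
    · exact ae_of_all _ fun t => hexp.summable.mul_right _
    · simp_rw [tsum_mul_right]
      exact hf.norm.const_mul _
    · refine ae_of_all _ fun t => ?_
      have h1 : HasSum (fun j : ℕ => (δ * t) ^ j / j.factorial) (Complex.exp (δ * t)) := by
        rw [Complex.exp_eq_exp_ℂ]
        exact NormedSpace.expSeries_div_hasSum_exp (δ * t)
      have h2 : (fun j : ℕ => δ ^ j / j.factorial * ((t : ℂ) ^ j * f t * e t)) =
          fun j : ℕ => f t * e t * ((δ * t) ^ j / j.factorial) := by
        funext j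
        ring
      simpa only [h2] using h1.mul_left (f t * e t)
  rw [← hsum.tsum_eq]
  refine tsum_of_norm_bounded hs1.hasSum fun j => ?_
  rw [integral_const_mul, norm_mul, norm_div, norm_pow, Complex.norm_natCast]
  gcongr

theorem sum_comp_le_mul_of_card_fiber_le {ι κ : Type*} [DecidableEq κ] (F : Finset ι) (k : ι → κ)
    {d : ℕ} (hd : ∀ j, (F.filter fun n => k n = j).card ≤ d) {a : κ → ℝ} (ha : ∀ j, 0 ≤ a j) :
    ∑ n ∈ F, a (k n) ≤ d * ∑ j ∈ F.image k, a j := by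
  rw [← Finset.sum_fiberwise_of_maps_to (g := k) (t := F.image k)
    fun n hn => Finset.mem_image_of_mem k hn, Finset.mul_sum]
  refine Finset.sum_le_sum fun j _ => ?_
  rw [Finset.sum_congr rfl fun n hn => by rw [(Finset.mem_filter.1 hn).2], Finset.sum_const,
    nsmul_eq_mul]
  exact mul_le_mul_of_nonneg_right (by exact_mod_cast hd j) (ha j)

theorem Incompressible.card_filter_le {d : ℕ} {μ : ℤ → ℂ} (hμ : Incompressible d μ)
    (F : Finset ℤ) (P : ℤ → Prop) [DecidablePred P] (t : ℝ) (hP : ∀ n, P n → |(μ n).re - t| ≤ 1) :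
    (F.filter P).card ≤ d := by
  have h : ((F.filter P : Finset ℤ) : Set ℤ).encard ≤ d :=
    (encard_le_encard fun n hn => hP n (Finset.mem_filter.1 hn).2).trans (hμ t)
  rw [encard_coe_eq_coe_finsetCard] at h
  exact_mod_cast h

/-- The case `p = 2`: each frequency `b μ_n` is compared with the nearest point of a lattice
`(2π / T) ℤ`, expanding the remaining bounded factor in its Taylor series. -/
theorem exists_sum_sq_norm_integral_mul_exp_le {b : ℝ} (hb : b ≠ 0) {h : ℝ} (hh : 0 ≤ h) (d : ℕ) :
    ∃ B : ℝ, 0 < B ∧ ∀ μ : ℤ → ℂ, Incompressible d μ → (∀ n : ℤ, |(μ n).im| ≤ h) →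
      ∀ f : ℝ → ℂ, MemLp f 2 (volume.restrict (Ioc 0 1)) → ∀ F : Finset ℤ,
        ∑ n ∈ F, ‖∫ t in Ioc (0 : ℝ) 1, f t * Complex.exp (Complex.I * b * μ n * t)‖ ^ 2 ≤
          B * ∫ t in Ioc (0 : ℝ) 1, ‖f t‖ ^ 2 := by
  set T : ℝ := max 1 (Real.pi / |b|)
  have hT : 1 ≤ T := le_max_left _ _
  have hT0 : 0 < T := by linarith
  have hb0 : 0 < |b| := abs_pos.2 hb
  have hTb : Real.pi / T ≤ |b| := by
    rw [div_le_iff₀ hT0, mul_comm, ← div_le_iff₀ hb0]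
    exact le_max_right _ _
  set R : ℝ := |b| + |b| * h
  refine ⟨Real.exp R * (Real.exp R * (d * T)) + 1, by positivity, fun μ hμ him f hf F => ?_⟩
  set k : ℤ → ℤ := fun n => round (b * (μ n).re * T / (2 * Real.pi))
  set c : ℤ → ℝ → ℂ := fun k t => Complex.exp (2 * Real.pi * Complex.I * k * t / T)
  set I := ∫ t in Ioc (0 : ℝ) 1, ‖f t‖ ^ 2
  have hI : 0 ≤ I := integral_nonneg fun t => by positivity
  have hk (n : ℤ) : |b * (μ n).re - 2 * Real.pi * k n / T| ≤ |b| := by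
    have h1 := abs_sub_round (b * (μ n).re * T / (2 * Real.pi))
    have h2 : b * (μ n).re - 2 * Real.pi * k n / T =
        2 * Real.pi / T * (b * (μ n).re * T / (2 * Real.pi) - k n) := by
      field_simp
    rw [h2, abs_mul, abs_of_pos (by positivity)]
    calc _ ≤ 2 * Real.pi / T * (1 / 2) := by gcongr
      _ = Real.pi / T := by ring
      _ ≤ _ := hTb
  have hfib (j : ℤ) : (F.filter fun n => k n = j).card ≤ d := by
    refine hμ.card_filter_le F _ (2 * Real.pi * j / T / b) fun n hn => ?_
    have h1 := hk n
    rw [hn] at h1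
    have h2 : (μ n).re - 2 * Real.pi * j / T / b = (b * (μ n).re - 2 * Real.pi * j / T) / b := by
      field_simp
    rw [h2, abs_div, div_le_one hb0]
    exact h1
  set δ : ℤ → ℂ := fun n => Complex.I * (b * μ n - 2 * Real.pi * k n / T)
  have hδ (n : ℤ) : ‖δ n‖ ≤ R := by
    have h1 : b * μ n - 2 * Real.pi * k n / T =
        ((b * (μ n).re - 2 * Real.pi * k n / T : ℝ) : ℂ) + ((b * (μ n).im : ℝ) : ℂ) * Complex.I := by
      conv_lhs => rw [← Complex.re_add_im (μ n)]
      push_cast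
      ring
    rw [norm_mul, Complex.norm_I, one_mul, h1]
    refine (norm_add_le _ _).trans ?_
    rw [norm_mul, Complex.norm_I, mul_one, Complex.norm_real, Complex.norm_real, Real.norm_eq_abs,
      Real.norm_eq_abs, abs_mul b]
    exact add_le_add (hk n) (mul_le_mul_of_nonneg_left (him n) hb0.le)
  have hf1 : IntegrableOn f (Ioc 0 1) := hf.integrable one_le_two
  have hc (k : ℤ) : Continuous (c k) := by fun_prop
  have hc1 (k : ℤ) (t : ℝ) : ‖c k t‖ = 1 := by
    have : 2 * Real.pi * Complex.I * k * t / T = ((2 * Real.pi * k * t / T : ℝ) : ℂ) * Complex.I := by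
      push_cast
      ring
    rw [show c k t = Complex.exp (2 * Real.pi * Complex.I * k * t / T) from rfl, this,
      Complex.norm_exp_ofReal_mul_I]
  have hpow (j : ℕ) : MemLp (fun t : ℝ => (t : ℂ) ^ j * f t) 2 (volume.restrict (Ioc 0 1)) ∧
      ∫ t in Ioc (0 : ℝ) 1, ‖(t : ℂ) ^ j * f t‖ ^ 2 ≤ I := by
    have hle : ∀ᵐ t : ℝ ∂volume.restrict (Ioc 0 1), ‖(t : ℂ) ^ j * f t‖ ≤ ‖f t‖ := by
      refine (ae_restrict_iff' measurableSet_Ioc).2 (ae_of_all _ fun t ht => ?_)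
      rw [norm_mul, norm_pow, Complex.norm_real, Real.norm_eq_abs, abs_of_pos ht.1]
      exact mul_le_of_le_one_left (norm_nonneg _) (pow_le_one₀ ht.1.le ht.2)
    have hm : MemLp (fun t : ℝ => (t : ℂ) ^ j * f t) 2 (volume.restrict (Ioc 0 1)) :=
      hf.mono ((by fun_prop : Continuous fun t : ℝ => (t : ℂ) ^ j).aestronglyMeasurable.mul
        hf.aestronglyMeasurable) hle
    exact ⟨hm, integral_mono_ae (hm.integrable_norm_pow two_ne_zero)
      (hf.integrable_norm_pow two_ne_zero) (hle.mono fun t ht => by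
        simpa using pow_le_pow_left₀ (norm_nonneg _) ht 2)⟩
  have hexp : HasSum (fun j : ℕ => R ^ j / j.factorial) (Real.exp R) := by
    rw [Real.exp_eq_exp_ℝ]
    exact NormedSpace.expSeries_div_hasSum_exp R
  have hR : 0 ≤ R := by positivity
  have hterm (j : ℕ) :
      ∑ n ∈ F, ‖∫ t in Ioc (0 : ℝ) 1, t ^ j * f t * c (k n) t‖ ^ 2 ≤ d * T * I := by
    refine (sum_comp_le_mul_of_card_fiber_le F k hfib
      (a := fun k => ‖∫ t in Ioc (0 : ℝ) 1, t ^ j * f t * c k t‖ ^ 2)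
      fun _ => by positivity).trans ?_
    rw [mul_assoc]
    gcongr
    exact (sum_sq_norm_integral_mul_exp_le hT (hpow j).1 _).trans
      (mul_le_mul_of_nonneg_left (hpow j).2 hT0.le)
  have hbound (n : ℤ) := sq_norm_integral_mul_exp_mul_exp_le hf1 (hc (k n)) (hc1 (k n)) (hδ n)
  calc _ = ∑ n ∈ F, ‖∫ t in Ioc (0 : ℝ) 1, f t * c (k n) t * Complex.exp (δ n * t)‖ ^ 2 := by
        simp_rw [mul_assoc (f _), c, δ, ← Complex.exp_add]
        refine Finset.sum_congr rfl fun n _ => ?_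
        congr 3 with t
        congr 2
        ring
    _ ≤ ∑ n ∈ F, Real.exp R * ∑' j : ℕ, R ^ j / j.factorial *
          ‖∫ t in Ioc (0 : ℝ) 1, t ^ j * f t * c (k n) t‖ ^ 2 :=
        Finset.sum_le_sum fun n _ => (hbound n).2
    _ = Real.exp R * ∑' j : ℕ, R ^ j / j.factorial *
          ∑ n ∈ F, ‖∫ t in Ioc (0 : ℝ) 1, t ^ j * f t * c (k n) t‖ ^ 2 := by
        rw [← Finset.mul_sum, ← Summable.tsum_finsetSum fun n _ => (hbound n).1]
        simp_rw [Finset.mul_sum]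
    _ ≤ Real.exp R * (Real.exp R * (d * T * I)) := by
        gcongr
        refine Real.tsum_le_of_sum_le (fun j => by positivity) fun u => ?_
        calc _ ≤ ∑ j ∈ u, R ^ j / j.factorial * (d * T * I) :=
              Finset.sum_le_sum fun j _ => mul_le_mul_of_nonneg_left (hterm j) (by positivity)
          _ ≤ _ := by
              rw [← Finset.sum_mul]
              gcongr
              exact sum_le_hasSum u (fun j _ => by positivity) hexp
    _ ≤ _ := by linarith

theorem lintegral_Ioc_rpow {r S : ℝ} (hr : -1 < r) (hS : 0 ≤ S) :
    ∫⁻ s in Ioc 0 S, ENNReal.ofReal (s ^ r) = ENNReal.ofReal (S ^ (r + 1) / (r + 1)) := by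
  have hint : IntegrableOn (fun s : ℝ => s ^ r) (Ioc 0 S) :=
    (intervalIntegrable_iff_integrableOn_Ioc_of_le hS).1 (intervalIntegral.intervalIntegrable_rpow' hr)
  rw [← ofReal_integral_eq_lintegral_ofReal hint
    ((ae_restrict_iff' measurableSet_Ioc).2 (ae_of_all _ fun s hs => Real.rpow_nonneg hs.1.le r)),
    ← intervalIntegral.integral_of_le hS, integral_rpow (Or.inl hr),
    Real.zero_rpow (by linarith), sub_zero]

theorem integrable_of_integrable_norm_rpow {α : Type*} [MeasurableSpace α] {ν : Measure α}
    [IsFiniteMeasure ν] {p : ℝ} (hp : 1 ≤ p) {g : α → ℂ} (hg : Measurable g)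
    (hgp : Integrable (fun t => ‖g t‖ ^ p) ν) : Integrable g ν := by
  refine ((integrable_const (1 : ℝ)).add hgp).mono' hg.aestronglyMeasurable (ae_of_all _ fun t => ?_)
  rw [Pi.add_apply]
  have h0 : 0 ≤ ‖g t‖ ^ p := by positivity
  rcases le_total ‖g t‖ 1 with h | h
  · linarith
  · linarith [Real.self_le_rpow_of_one_le h hp]

section WeakType

variable {α ι : Type*} [MeasurableSpace α] {ν : Measure α} [IsFiniteMeasure ν] {F : Finset ι}
  {e : ι → α → ℂ} {A B p : ℝ} {g : α → ℂ}

theorem sum_ite_sq_le_setIntegral (hA : 0 < A) (hp1 : 1 < p)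
    (he : ∀ n, AEStronglyMeasurable (e n) ν) (heA : ∀ n, ∀ᵐ t ∂ν, ‖e n t‖ ≤ A)
    (hL2 : ∀ f : α → ℂ, MemLp f 2 ν → ∑ n ∈ F, ‖∫ t, f t * e n t ∂ν‖ ^ 2 ≤ B * ∫ t, ‖f t‖ ^ 2 ∂ν)
    (hg : Measurable g) (hgp : Integrable (fun t => ‖g t‖ ^ p) ν)
    (hI : 0 < ∫ t, ‖g t‖ ^ p ∂ν) {s : ℝ} (hs : 0 < s) :
    IntegrableOn (fun t => ‖g t‖ ^ 2) {t | s * ‖g t‖ ^ (p - 1) ≤ 2 * A * ∫ t, ‖g t‖ ^ p ∂ν} ν ∧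
    ∑ n ∈ F, (if s < ‖∫ t, g t * e n t ∂ν‖ then s ^ 2 else 0) ≤
      4 * B * ∫ t in {t | s * ‖g t‖ ^ (p - 1) ≤ 2 * A * ∫ t, ‖g t‖ ^ p ∂ν}, ‖g t‖ ^ 2 ∂ν := by
  set I := ∫ t, ‖g t‖ ^ p ∂ν
  set E := {t | s * ‖g t‖ ^ (p - 1) ≤ 2 * A * I}
  have hE : MeasurableSet E :=
    measurableSet_le ((hg.norm.pow_const (p - 1)).const_mul s) measurable_const
  have hg1 : Integrable g ν := integrable_of_integrable_norm_rpow hp1.le hg hgp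
  have hsmall : MemLp (E.indicator g) 2 ν := by
    refine MemLp.of_bound (hg.indicator hE).aestronglyMeasurable ((2 * A * I / s) ^ (p - 1)⁻¹)
      (ae_of_all _ fun t => ?_)
    by_cases ht : t ∈ E
    · rw [indicator_of_mem ht, Real.le_rpow_inv_iff_of_pos (norm_nonneg _) (by positivity)
        (by linarith), le_div_iff₀ hs, mul_comm]
      exact ht
    · rw [indicator_of_notMem ht, norm_zero]
      positivity
  have hsq : (fun t => ‖E.indicator g t‖ ^ 2) = E.indicator fun t => ‖g t‖ ^ 2 := by
    ext t
    by_cases ht : t ∈ E <;> simp [ht]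
  have hint : IntegrableOn (fun t => ‖g t‖ ^ 2) E ν := by
    rw [← integrable_indicator_iff hE, ← hsq]
    exact hsmall.integrable_norm_pow two_ne_zero
  have hlarge : A * ∫ t in Eᶜ, ‖g t‖ ∂ν ≤ s / 2 := by
    have h1 : ∫ t in Eᶜ, 2 * A * I * ‖g t‖ ∂ν ≤ ∫ t in Eᶜ, s * ‖g t‖ ^ p ∂ν := by
      refine setIntegral_mono_on (hg1.norm.const_mul _).integrableOn
        (hgp.const_mul _).integrableOn hE.compl fun t ht => ?_
      have h2 : 2 * A * I < s * ‖g t‖ ^ (p - 1) := not_le.1 ht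
      have h3 : ‖g t‖ ^ p = ‖g t‖ ^ (p - 1) * ‖g t‖ := by
        rw [← Real.rpow_add_one' (norm_nonneg _) (by linarith), sub_add_cancel]
      rw [h3, ← mul_assoc]
      gcongr
    have h4 : ∫ t in Eᶜ, ‖g t‖ ^ p ∂ν ≤ I :=
      setIntegral_le_integral hgp (ae_of_all _ fun t => by positivity)
    rw [integral_const_mul, integral_const_mul] at h1
    have h5 : I * (A * ∫ t in Eᶜ, ‖g t‖ ∂ν) ≤ I * (s / 2) := by
      nlinarith [mul_le_mul_of_nonneg_left h4 hs.le]
    exact le_of_mul_le_mul_left h5 hI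
  have hsplit (n : ι) : ‖∫ t, g t * e n t ∂ν‖ ≤ ‖∫ t, E.indicator g t * e n t ∂ν‖ + s / 2 := by
    have hi : Integrable (fun t => g t * e n t) ν := hg1.mul_bdd (he n) (heA n)
    have h1 : ∫ t, E.indicator g t * e n t ∂ν = ∫ t in E, g t * e n t ∂ν := by
      rw [← integral_indicator hE]
      congr 1 with t
      by_cases ht : t ∈ E <;> simp [ht]
    rw [h1, ← integral_add_compl hE hi]
    refine (norm_add_le _ _).trans (add_le_add_right ?_ _)
    refine le_trans ?_ hlarge
    rw [← integral_const_mul]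
    refine norm_integral_le_of_norm_le (hg1.norm.const_mul A).integrableOn
      ((ae_restrict_of_ae (heA n)).mono fun t ht => ?_)
    rw [norm_mul, mul_comm]
    gcongr
  refine ⟨hint, ?_⟩
  calc _ ≤ ∑ n ∈ F, 4 * ‖∫ t, E.indicator g t * e n t ∂ν‖ ^ 2 := by
        refine Finset.sum_le_sum fun n _ => ?_
        split_ifs with h
        · nlinarith [hsplit n]
        · positivity
    _ = 4 * ∑ n ∈ F, ‖∫ t, E.indicator g t * e n t ∂ν‖ ^ 2 := by rw [Finset.mul_sum]
    _ ≤ 4 * (B * ∫ t, ‖E.indicator g t‖ ^ 2 ∂ν) := by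
        gcongr
        exact hL2 _ hsmall
    _ = _ := by rw [hsq, integral_indicator hE, mul_assoc]

/-- Marcinkiewicz interpolation between `L¹ → ℓ^∞` and `L² → ℓ²` for integral operators with
a bounded kernel. -/
theorem sum_rpow_norm_integral_mul_le (hA : 0 < A) (hB : 0 ≤ B) (hp1 : 1 < p) (hp2 : p < 2)
    (he : ∀ n, AEStronglyMeasurable (e n) ν) (heA : ∀ n, ∀ᵐ t ∂ν, ‖e n t‖ ≤ A)
    (hL2 : ∀ f : α → ℂ, MemLp f 2 ν → ∑ n ∈ F, ‖∫ t, f t * e n t ∂ν‖ ^ 2 ≤ B * ∫ t, ‖f t‖ ^ 2 ∂ν)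
    (hg : Measurable g) (hgp : Integrable (fun t => ‖g t‖ ^ p) ν) :
    ∑ n ∈ F, ‖∫ t, g t * e n t ∂ν‖ ^ (p / (p - 1)) ≤
      4 * (p / (p - 1)) * B * (2 * A) ^ (p / (p - 1) - 2) / (p / (p - 1) - 2) *
        (∫ t, ‖g t‖ ^ p ∂ν) ^ (p / (p - 1) - 1) := by
  set q := p / (p - 1) with hq
  set I := ∫ t, ‖g t‖ ^ p ∂ν
  have hp0 : 0 < p - 1 := by linarith
  have hq2 : 0 < q - 2 := by
    rw [hq, sub_pos, lt_div_iff₀ hp0]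
    linarith
  have hqp : (p - 1) * (q - 2) = 2 - p := by
    rw [hq]
    field_simp
    ring
  have hI0 : 0 ≤ I := integral_nonneg fun t => by positivity
  rcases hI0.eq_or_lt with hI | hI
  · have hg0 : g =ᵐ[ν] 0 := by
      refine ((integral_eq_zero_iff_of_nonneg (fun t => by positivity) hgp).1 hI.symm).mono
        fun t ht => ?_
      simpa using (Real.rpow_eq_zero_iff_of_nonneg (norm_nonneg _)).1 ht |>.1
    have ha (n : ι) : ∫ t, g t * e n t ∂ν = 0 := by
      rw [integral_eq_zero_of_ae]
      exact hg0.mono fun t ht => by simp [ht]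
    simp only [ha, norm_zero, Real.zero_rpow (by linarith : q ≠ 0), Finset.sum_const_zero]
    have : 0 < q := by linarith
    positivity
  set a : ι → ℝ := fun n => ‖∫ t, g t * e n t ∂ν‖
  have ha (n : ι) : 0 ≤ a n := norm_nonneg _
  set D : ℝ := 4 * q * B
  have hD : 0 ≤ D := by
    have : 0 < q := by linarith
    positivity
  have hpow (n : ι) : ENNReal.ofReal (a n ^ q) =
      ∫⁻ s in Ioi 0, if s < a n then ENNReal.ofReal (q * s ^ (q - 1)) else 0 := by
    have h1 : (fun s => if s < a n then ENNReal.ofReal (q * s ^ (q - 1)) else 0) =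
        (Iio (a n)).indicator fun s => ENNReal.ofReal (q * s ^ (q - 1)) := by
      ext s
      simp [indicator_apply]
    rw [h1, lintegral_indicator measurableSet_Iio, Measure.restrict_restrict measurableSet_Iio,
      Iio_inter_Ioi, Measure.restrict_congr_set Ioo_ae_eq_Ioc]
    simp_rw [ENNReal.ofReal_mul (by linarith : 0 ≤ q)]
    rw [lintegral_const_mul' _ _ ENNReal.ofReal_ne_top, lintegral_Ioc_rpow (by linarith) (ha n),
      ← ENNReal.ofReal_mul (by linarith), sub_add_cancel, mul_div_cancel₀ _ (by linarith)]
  set E : ℝ → Set α := fun s => {t | s * ‖g t‖ ^ (p - 1) ≤ 2 * A * I}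
  set H : ℝ → α → ENNReal := fun s t => {z : ℝ × α | z.2 ∈ E z.1}.indicator
    (fun z => ENNReal.ofReal (D * z.1 ^ (q - 3)) * ENNReal.ofReal (‖g z.2‖ ^ 2)) (s, t)
  have hH : Measurable (Function.uncurry H) := by
    have hgm : Measurable fun z : ℝ × α => ‖g z.2‖ := hg.norm.comp measurable_snd
    refine Measurable.indicator ?_ (measurableSet_le
      (measurable_fst.mul (hgm.pow_const (p - 1))) measurable_const)
    exact ((measurable_fst.pow_const (q - 3)).const_mul D).ennreal_ofReal.mul
      (hgm.pow_const 2).ennreal_ofReal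
  have hlevel (s : ℝ) (hs : s ∈ Ioi (0 : ℝ)) :
      ∑ n ∈ F, (if s < a n then ENNReal.ofReal (q * s ^ (q - 1)) else 0) ≤ ∫⁻ t, H s t ∂ν := by
    have hs : 0 < s := hs
    obtain ⟨hint, hle⟩ := sum_ite_sq_le_setIntegral hA hp1 he heA hL2 hg hgp hI hs
    have hE : MeasurableSet (E s) :=
      measurableSet_le ((hg.norm.pow_const (p - 1)).const_mul s) measurable_const
    have h1 : ∫⁻ t, H s t ∂ν =
        ENNReal.ofReal (D * s ^ (q - 3)) * ENNReal.ofReal (∫ t in E s, ‖g t‖ ^ 2 ∂ν) := by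
      rw [ofReal_integral_eq_lintegral_ofReal hint (ae_of_all _ fun t => by positivity),
        ← lintegral_const_mul' _ _ ENNReal.ofReal_ne_top, ← lintegral_indicator hE]
      rfl
    have h2 : ∑ n ∈ F, (if s < a n then ENNReal.ofReal (q * s ^ (q - 1)) else 0) =
        ENNReal.ofReal (q * s ^ (q - 3) * ∑ n ∈ F, if s < a n then s ^ 2 else 0) := by
      rw [Finset.mul_sum, ENNReal.ofReal_sum_of_nonneg]
      · refine Finset.sum_congr rfl fun n _ => ?_
        split_ifs
        · rw [mul_assoc, ← Real.rpow_add_natCast hs.ne']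
          congr 3
          push_cast
          ring
        · simp
      · intro n _
        have : 0 < q := by linarith
        positivity
    rw [h1, h2, ← ENNReal.ofReal_mul (by positivity)]
    refine ENNReal.ofReal_le_ofReal ?_
    calc _ ≤ q * s ^ (q - 3) * (4 * B * ∫ t in E s, ‖g t‖ ^ 2 ∂ν) := by
          have : 0 < q := by linarith
          gcongr
      _ = _ := by ring
  have hinner (t : α) : ∫⁻ s in Ioi 0, H s t ≤
      ENNReal.ofReal (D * (2 * A * I) ^ (q - 2) / (q - 2) * ‖g t‖ ^ p) := by
    rcases (norm_nonneg (g t)).eq_or_lt with h0 | h0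
    · have : ∀ s, H s t = 0 := fun s => by simp [H, indicator_apply, norm_eq_zero.1 h0.symm]
      simp [this]
    have h1 (s : ℝ) : H s t = (Iic (2 * A * I / ‖g t‖ ^ (p - 1))).indicator
        (fun s => ENNReal.ofReal (D * ‖g t‖ ^ 2) * ENNReal.ofReal (s ^ (q - 3))) s := by
      simp only [H, E, indicator_apply, mem_ofPred_eq, mem_Iic,
        le_div_iff₀ (Real.rpow_pos_of_pos h0 (p - 1))]
      congr 1
      rw [ENNReal.ofReal_mul hD, ENNReal.ofReal_mul hD]
      ring
    simp_rw [h1]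
    rw [lintegral_indicator measurableSet_Iic, Measure.restrict_restrict measurableSet_Iic,
      inter_comm, Ioi_inter_Iic, lintegral_const_mul' _ _ ENNReal.ofReal_ne_top,
      lintegral_Ioc_rpow (by linarith) (by positivity), ← ENNReal.ofReal_mul (by positivity)]
    refine ENNReal.ofReal_le_ofReal (le_of_eq ?_)
    rw [show q - 3 + 1 = q - 2 by ring, Real.div_rpow (by positivity) (by positivity),
      ← Real.rpow_mul h0.le, hqp]
    have h2 : ‖g t‖ ^ 2 = ‖g t‖ ^ p * ‖g t‖ ^ (2 - p) := by
      rw [← Real.rpow_add h0, add_sub_cancel, Real.rpow_two]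
    rw [h2]
    field_simp
  have hfinal : ENNReal.ofReal (∑ n ∈ F, a n ^ q) ≤
      ENNReal.ofReal (D * (2 * A * I) ^ (q - 2) / (q - 2) * I) := by
    rw [ENNReal.ofReal_sum_of_nonneg fun n _ => Real.rpow_nonneg (ha n) q]
    calc _ = ∫⁻ s in Ioi 0, ∑ n ∈ F, if s < a n then ENNReal.ofReal (q * s ^ (q - 1)) else 0 := by
          rw [lintegral_finsetSum]
          · exact Finset.sum_congr rfl fun n _ => hpow n
          · intro n _
            exact Measurable.ite measurableSet_Iio
              ((measurable_id.pow_const (q - 1)).const_mul q).ennreal_ofReal measurable_const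
      _ ≤ ∫⁻ s in Ioi 0, ∫⁻ t, H s t ∂ν := setLIntegral_mono' measurableSet_Ioi hlevel
      _ = ∫⁻ t, (∫⁻ s in Ioi 0, H s t) ∂ν := lintegral_lintegral_swap hH.aemeasurable
      _ ≤ ∫⁻ t, ENNReal.ofReal (D * (2 * A * I) ^ (q - 2) / (q - 2) * ‖g t‖ ^ p) ∂ν :=
          lintegral_mono hinner
      _ = _ := by
          rw [← ofReal_integral_eq_lintegral_ofReal (hgp.const_mul _)
            (ae_of_all _ fun t => by positivity), integral_const_mul]
  refine ((ENNReal.ofReal_le_ofReal_iff (by positivity)).1 hfinal).trans (le_of_eq ?_)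
  rw [Real.mul_rpow (by positivity) hI0, show q - 1 = q - 2 + 1 by ring, Real.rpow_add_one hI.ne']
  ring

end WeakType

/-- For `p ∈ (1,2]`, `b ≠ 0`, `h ≥ 0`, `d ∈ ℕ` there is `C = C(b,p,h,d) > 0` such that
for every incompressible sequence `μ` of density `d` lying in the strip `Π_h` and every
`g ∈ L^p[0,1]`, with `G(λ) := ∫₀¹ g(t) e^{ibλt} dt`, one has
`∑_{n∈ℤ} |G(μ_n)|^{p'} ≤ C ‖g‖_p^{p'}`. -/
theorem stmt5 (p : ℝ) (hp1 : 1 < p) (hp2 : p ≤ 2) (b : ℝ) (hb : b ≠ 0)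
    (h : ℝ) (hh : 0 ≤ h) (d : ℕ) :
    ∃ C : ℝ, 0 < C ∧ ∀ μ : ℤ → ℂ, Incompressible d μ → (∀ n : ℤ, |(μ n).im| ≤ h) →
      ∀ g : ℝ → ℂ, Measurable g →
      IntervalIntegrable (fun t => ‖g t‖ ^ p) volume 0 1 →
      ∀ F : Finset ℤ, ∑ n ∈ F,
          ‖∫ t in (0:ℝ)..1, g t * Complex.exp (Complex.I * b * μ n * t)‖ ^ (p / (p - 1)) ≤
        C * lpNorm01 p g ^ (p / (p - 1)) := by
  have hq : 0 < p - 1 := by linarith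
  obtain ⟨B, hB, hL2⟩ := exists_sum_sq_norm_integral_mul_exp_le hb hh d
  have hnorm (g : ℝ → ℂ) : lpNorm01 p g ^ (p / (p - 1)) =
      (∫ t in Ioc (0 : ℝ) 1, ‖g t‖ ^ p) ^ (p / (p - 1) - 1) := by
    rw [lpNorm01, intervalIntegral.integral_of_le zero_le_one,
      ← Real.rpow_mul (integral_nonneg fun t => by positivity)]
    congr 1
    field_simp
    ring
  simp_rw [hnorm, intervalIntegral.integral_of_le zero_le_one,
    intervalIntegrable_iff_integrableOn_Ioc_of_le zero_le_one]
  rcases hp2.eq_or_lt with rfl | hp2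
  · refine ⟨B, hB, fun μ hμ him g hg hgp F => ?_⟩
    norm_num at hgp ⊢
    exact hL2 μ hμ him g ((memLp_two_iff_integrable_sq_norm hg.aestronglyMeasurable).2 hgp) F
  · have hq2 : 0 < p / (p - 1) - 2 := by
      rw [sub_pos, lt_div_iff₀ hq]
      linarith
    refine ⟨4 * (p / (p - 1)) * B * (2 * Real.exp (|b| * h)) ^ (p / (p - 1) - 2) /
      (p / (p - 1) - 2), by positivity, fun μ hμ him g hg hgp F => ?_⟩
    refine sum_rpow_norm_integral_mul_le (Real.exp_pos _) hB.le hp1 hp2 (fun n => ?_) (fun n => ?_)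
      (fun f hf => hL2 μ hμ him f hf F) hg hgp
    · exact (by fun_prop : Continuous fun t : ℝ =>
        Complex.exp (Complex.I * b * μ n * t)).aestronglyMeasurable
    · refine (ae_restrict_iff' measurableSet_Ioc).2 (ae_of_all _ fun t ht => ?_)
      have hre : (Complex.I * b * μ n * t).re = -(b * (μ n).im) * t := by simp
      rw [Complex.norm_exp, hre, Real.exp_le_exp]
      calc _ ≤ |b| * |(μ n).im| * t := by
            rw [← abs_mul]
            exact mul_le_mul_of_nonneg_right (neg_le_abs _) ht.1.le
        _ ≤ |b| * h * 1 := by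
            gcongr
            · exact ht.1.le
            · exact him n
            · exact ht.2
        _ = _ := mul_one _
end

section
/- Let p ∈ (1,2], b ∈ ℝ∖{0}, h ≥ 0 and d ∈ ℕ. There exists a constant C = C(b,p,h,d) > 0 such that for every incompressible sequence Λ = (μ_n)_{n∈ℤ} of density d lying in the strip Π_h and every g ∈ L^p[0,1], setting G(λ) := ∫₀¹ g(t) e^{ibλt} dt, one has the weighted inequality ∑_{n∈ℤ} (1+|n|)^{p−2} |G(μ_n)|^{p} ≤ C · ‖g‖_{L^p[0,1]}^{p}. -/
open MeasureTheory

theorem exists_sum_gaussian_le {c : ℝ} (hc : 0 < c) (d : ℕ) :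
    ∃ K : ℝ, 0 < K ∧ ∀ x : ℤ → ℝ, (∀ t : ℝ, {n : ℤ | |x n - t| ≤ 1}.encard ≤ (d : ℕ∞)) →
      ∀ (F : Finset ℤ) (t : ℝ), ∑ n ∈ F, Real.exp (-c * (x n - t) ^ 2) ≤ K := by
  have hsum : Summable fun k : ℤ => 1 / (1 + (k : ℝ) ^ 2) := by
    have h1 : Summable fun k : ℤ => 1 / (k : ℝ) ^ 2 :=
      Real.summable_one_div_int_pow.2 (by norm_num)
    have h2 : Summable fun k : ℤ => if k = 0 then (1 : ℝ) else 0 :=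
      (hasSum_ite_eq (0 : ℤ) (1 : ℝ)).summable
    refine Summable.of_nonneg_of_le (fun k => by positivity) (fun k => ?_) (h1.add h2)
    by_cases hk : k = 0
    · simp [hk]
    · have : (0 : ℝ) < (k : ℝ) ^ 2 := by positivity
      simp only [hk, if_false, add_zero]
      gcongr
      linarith
  set m := min 1 c with hm
  have hm0 : 0 < m := lt_min one_pos hc
  have hT : 0 ≤ ∑' k : ℤ, 1 / (1 + (k : ℝ) ^ 2) := tsum_nonneg fun k => by positivity
  refine ⟨d * (3 / m) * (∑' k : ℤ, 1 / (1 + (k : ℝ) ^ 2)) + 1, by positivity,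
    fun x hx F t => ?_⟩
  have hpt : ∀ n, Real.exp (-c * (x n - t) ^ 2) ≤
      3 / m * (1 / (1 + (⌊x n - t⌋ : ℝ) ^ 2)) := by
    intro n
    set y := x n - t
    have h1 := Int.floor_le y
    have h2 := Int.lt_floor_add_one y
    have h3 : 1 + (⌊y⌋ : ℝ) ^ 2 ≤ 3 * (1 + y ^ 2) := by nlinarith [sq_nonneg (⌊y⌋ - 2 * y)]
    have h4 : m * (1 + y ^ 2) ≤ Real.exp (c * y ^ 2) := by
      have := Real.add_one_le_exp (c * y ^ 2)
      have h5 : m ≤ 1 := min_le_left _ _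
      have h6 : m ≤ c := min_le_right _ _
      nlinarith [sq_nonneg y]
    rw [neg_mul, Real.exp_neg, div_mul_div_comm, mul_one, inv_eq_one_div,
      div_le_div_iff₀ (Real.exp_pos _) (by positivity)]
    nlinarith
  calc ∑ n ∈ F, Real.exp (-c * (x n - t) ^ 2)
      ≤ ∑ n ∈ F, 3 / m * (1 / (1 + (⌊x n - t⌋ : ℝ) ^ 2)) := Finset.sum_le_sum fun n _ => hpt n
    _ = ∑ k ∈ F.image fun n => ⌊x n - t⌋,
          ((F.filter fun n => ⌊x n - t⌋ = k).card : ℝ) * (3 / m * (1 / (1 + (k : ℝ) ^ 2))) := by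
        rw [Finset.sum_comp (fun k : ℤ => 3 / m * (1 / (1 + (k : ℝ) ^ 2)))]
        simp [nsmul_eq_mul]
    _ ≤ ∑ k ∈ F.image fun n => ⌊x n - t⌋, d * (3 / m) * (1 / (1 + (k : ℝ) ^ 2)) := by
        refine Finset.sum_le_sum fun k _ => ?_
        rw [mul_assoc]
        gcongr
        have h1 : ((F.filter fun n => ⌊x n - t⌋ = k : Finset ℤ) : Set ℤ) ⊆
            {n : ℤ | |x n - (t + k)| ≤ 1} := by
          intro n hn
          simp only [Finset.coe_filter, Set.mem_ofPred_eq] at hn ⊢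
          have h2 := Int.floor_le (x n - t)
          have h3 := Int.lt_floor_add_one (x n - t)
          rw [hn.2] at h2 h3
          rw [abs_le]
          constructor <;> linarith
        have h2 := (Set.encard_le_encard h1).trans (hx _)
        rw [Set.encard_coe_eq_coe_finsetCard] at h2
        exact_mod_cast h2
    _ ≤ _ := by
        rw [← Finset.mul_sum]
        have := hsum.sum_le_tsum (F.image fun n => ⌊x n - t⌋) fun k _ => by positivity
        have h5 : 0 ≤ d * (3 / m) := by positivity
        nlinarith [mul_le_mul_of_nonneg_left this h5]

theorem sum_inv_sq_le_of_lt {R : ℝ} (hR : 0 < R) (F : Finset ℤ)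
    (hF : ∀ n ∈ F, R < 1 + |(n : ℝ)|) :
    ∑ n ∈ F, ((1 + |(n : ℝ)|) ^ 2)⁻¹ ≤ 4 / R := by
  set f : ℤ → ℕ := fun n => n.natAbs + 1 with hf
  have hfa : ∀ n : ℤ, (f n : ℝ) = 1 + |(n : ℝ)| := by
    intro n
    simp only [hf, Nat.cast_add, Nat.cast_natAbs, Int.cast_abs, Nat.cast_one]
    ring
  obtain ⟨N, hN⟩ := (F.image f).bddAbove
  have hsub : F.image f ⊆ Finset.Ioo ⌊R⌋₊ (N + 1) := by
    intro k hk
    have h1 := hN (Finset.mem_coe.2 hk)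
    obtain ⟨n, hn, rfl⟩ := Finset.mem_image.1 hk
    rw [Finset.mem_Ioo, Nat.floor_lt hR.le, hfa]
    exact ⟨hF n hn, by omega⟩
  calc ∑ n ∈ F, ((1 + |(n : ℝ)|) ^ 2)⁻¹
      = ∑ k ∈ F.image f, ((F.filter fun n => f n = k).card : ℝ) * ((k : ℝ) ^ 2)⁻¹ := by
        simp_rw [← hfa]
        rw [Finset.sum_comp (fun k : ℕ => ((k : ℝ) ^ 2)⁻¹)]
        simp [nsmul_eq_mul]
    _ ≤ ∑ k ∈ F.image f, 2 * ((k : ℝ) ^ 2)⁻¹ := by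
        refine Finset.sum_le_sum fun k _ => ?_
        gcongr
        have h1 : (F.filter fun n => f n = k) ⊆ {(k : ℤ) - 1, 1 - (k : ℤ)} := by
          intro n hn
          have := (Finset.mem_filter.1 hn).2
          simp only [hf] at this
          simp only [Finset.mem_insert, Finset.mem_singleton]
          omega
        exact_mod_cast (Finset.card_le_card h1).trans Finset.card_le_two
    _ ≤ ∑ k ∈ Finset.Ioo ⌊R⌋₊ (N + 1), 2 * ((k : ℝ) ^ 2)⁻¹ :=
        Finset.sum_le_sum_of_subset_of_nonneg hsub fun k _ _ => by positivity
    _ ≤ 2 * (2 / (⌊R⌋₊ + 1)) := by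
        rw [← Finset.mul_sum]
        gcongr
        exact sum_Ioo_inv_sq_le _ _
    _ ≤ 4 / R := by
        rw [← mul_div_assoc, show (2 : ℝ) * 2 = 4 by norm_num]
        gcongr
        exact (Nat.lt_floor_add_one R).le

theorem sum_sum_mul_le_of_sum_le {ι : Type*} (F : Finset ι) (a : ι → ℝ) (k : ι → ι → ℝ)
    (hk0 : ∀ n m, 0 ≤ k n m) (hks : ∀ n m, k n m = k m n) {K : ℝ}
    (hK : ∀ m, ∑ n ∈ F, k n m ≤ K) :
    ∑ n ∈ F, ∑ m ∈ F, a n * a m * k n m ≤ K * ∑ n ∈ F, a n ^ 2 := by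
  have h1 : ∑ n ∈ F, ∑ m ∈ F, a m ^ 2 * k n m ≤ K * ∑ n ∈ F, a n ^ 2 := by
    rw [Finset.sum_comm, Finset.mul_sum]
    refine Finset.sum_le_sum fun m _ => ?_
    rw [← Finset.mul_sum, mul_comm]
    exact mul_le_mul_of_nonneg_right (hK m) (sq_nonneg _)
  have h2 : ∑ n ∈ F, ∑ m ∈ F, a n ^ 2 * k n m ≤ K * ∑ n ∈ F, a n ^ 2 := by
    rw [Finset.sum_comm]
    simpa only [hks] using h1
  calc ∑ n ∈ F, ∑ m ∈ F, a n * a m * k n m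
      ≤ ∑ n ∈ F, ∑ m ∈ F, (a n ^ 2 * k n m + a m ^ 2 * k n m) / 2 := by
        refine Finset.sum_le_sum fun n _ => Finset.sum_le_sum fun m _ => ?_
        nlinarith [mul_nonneg (sq_nonneg (a n - a m)) (hk0 n m)]
    _ ≤ _ := by
        simp only [← Finset.sum_div, Finset.sum_add_distrib]
        linarith

theorem norm_cexp_neg_sq_div_four_le {b h : ℝ} {z w : ℂ} (hz : |z.im| ≤ h) (hw : |w.im| ≤ h) :
    ‖Complex.exp (-(b * (z - starRingEnd ℂ w)) ^ 2 / (4 * 1))‖ ≤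
      Real.exp (b ^ 2 * h ^ 2) * Real.exp (-(b ^ 2 / 4) * (z.re - w.re) ^ 2) := by
  rw [Complex.norm_exp, ← Real.exp_add, Real.exp_le_exp]
  have h1 : (-(b * (z - starRingEnd ℂ w)) ^ 2 / (4 * 1)).re =
      -(b ^ 2 / 4) * (z.re - w.re) ^ 2 + b ^ 2 / 4 * (z.im + w.im) ^ 2 := by
    rw [mul_one, show (4 : ℂ) = ((4 : ℝ) : ℂ) by norm_num, Complex.div_ofReal_re]
    simp [pow_two]
    ring
  have h2 : (z.im + w.im) ^ 2 ≤ (2 * h) ^ 2 := by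
    rw [sq_le_sq, abs_of_nonneg (by linarith [abs_nonneg z.im] : 0 ≤ 2 * h)]
    linarith [abs_add_le z.im w.im]
  rw [h1]
  nlinarith [mul_le_mul_of_nonneg_left h2 (sq_nonneg b)]

theorem exists_integral_sq_expSum_le {b : ℝ} (hb : b ≠ 0) (h : ℝ) (d : ℕ) :
    ∃ K : ℝ, 0 < K ∧ ∀ μ : ℤ → ℂ, Incompressible d μ → (∀ n : ℤ, |(μ n).im| ≤ h) →
      ∀ (F : Finset ℤ) (c : ℤ → ℂ),
        ∫ t in (0 : ℝ)..1, ‖∑ n ∈ F, c n * Complex.exp (Complex.I * b * μ n * t)‖ ^ 2 ≤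
          K * ∑ n ∈ F, ‖c n‖ ^ 2 := by
  obtain ⟨K₀, hK₀, hrow⟩ := exists_sum_gaussian_le (c := b ^ 2 / 4) (by positivity) d
  set κ : ℝ := ‖((Real.pi : ℂ) / 1) ^ (1 / 2 : ℂ)‖ * Real.exp (b ^ 2 * h ^ 2) with hκ
  have hκ0 : 0 ≤ κ := by positivity
  refine ⟨Real.exp 1 * (κ * K₀) + 1, by positivity, fun μ hμ hh F c => ?_⟩
  set P : ℝ → ℂ := fun t => ∑ n ∈ F, c n * Complex.exp (Complex.I * b * μ n * t) with hP
  have hPc : Continuous P := by fun_prop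
  set J : ℤ → ℤ → ℝ → ℂ := fun n m t => c n * starRingEnd ℂ (c m) *
    (Complex.exp (Complex.I * (b * (μ n - starRingEnd ℂ (μ m))) * t) *
      Complex.exp (-1 * (t : ℂ) ^ 2)) with hJ
  have hJi : ∀ n m, Integrable (J n m) := by
    intro n m
    have := (integrable_cexp_quadratic (b := 1) (by simp)
      (Complex.I * (b * (μ n - starRingEnd ℂ (μ m)))) 0).const_mul (c n * starRingEnd ℂ (c m))
    refine this.congr (Filter.Eventually.of_forall fun t => ?_)
    simp only [hJ, ← Complex.exp_add]
    ring_nf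
  set Q : ℝ → ℝ := fun t => Real.exp (-t ^ 2) * ‖P t‖ ^ 2 with hQ
  have hQJ : ∀ t, (Q t : ℂ) = ∑ n ∈ F, ∑ m ∈ F, J n m t := by
    intro t
    have h1 : ((‖P t‖ ^ 2 : ℝ) : ℂ) = P t * starRingEnd ℂ (P t) := by
      rw [Complex.mul_conj, Complex.normSq_eq_norm_sq]
    simp only [hQ]
    rw [Complex.ofReal_mul, h1]
    simp only [hP, map_sum, Finset.sum_mul_sum]
    rw [Finset.mul_sum]
    refine Finset.sum_congr rfl fun n _ => ?_
    rw [Finset.mul_sum]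
    refine Finset.sum_congr rfl fun m _ => ?_
    simp only [hJ, map_mul, ← Complex.exp_conj, Complex.conj_I, Complex.conj_ofReal]
    rw [show Complex.I * (b * (μ n - starRingEnd ℂ (μ m))) * (t : ℂ) =
      Complex.I * b * μ n * t + -Complex.I * b * starRingEnd ℂ (μ m) * t by ring, Complex.exp_add]
    push_cast
    ring_nf
  have hQi : Integrable Q := by
    have : Integrable fun t => (Q t : ℂ) := by
      simp only [hQJ]
      exact integrable_finsetSum _ fun n _ => integrable_finsetSum _ fun m _ => hJi n m
    exact this.re
  have hQ0 : ∀ t, 0 ≤ Q t := fun t => by positivity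
  have hint : ∀ n m, ‖∫ t, J n m t‖ ≤
      κ * (‖c n‖ * ‖c m‖ * Real.exp (-(b ^ 2 / 4) * ((μ n).re - (μ m).re) ^ 2)) := by
    intro n m
    simp only [hJ]
    rw [integral_const_mul, fourierIntegral_gaussian (by simp), norm_mul, norm_mul, norm_mul,
      RCLike.norm_conj]
    have h1 := norm_cexp_neg_sq_div_four_le (b := b) (hh n) (hh m)
    calc _ ≤ ‖c n‖ * ‖c m‖ * (‖((Real.pi : ℂ) / 1) ^ (1 / 2 : ℂ)‖ * (Real.exp (b ^ 2 * h ^ 2) *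
          Real.exp (-(b ^ 2 / 4) * ((μ n).re - (μ m).re) ^ 2))) := by gcongr
      _ = _ := by rw [hκ]; ring
  have hQint : ∫ t, Q t ≤ κ * K₀ * ∑ n ∈ F, ‖c n‖ ^ 2 := by
    calc ∫ t, Q t ≤ ‖((∫ t, Q t : ℝ) : ℂ)‖ := by
          rw [Complex.norm_real]; exact le_abs_self _
      _ = ‖∑ n ∈ F, ∑ m ∈ F, ∫ t, J n m t‖ := by
          rw [← integral_complex_ofReal]
          simp only [hQJ]
          rw [integral_finsetSum _ fun n _ => integrable_finsetSum _ fun m _ => hJi n m]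
          simp_rw [integral_finsetSum _ fun m _ => hJi _ m]
      _ ≤ ∑ n ∈ F, ∑ m ∈ F, κ * (‖c n‖ * ‖c m‖ *
            Real.exp (-(b ^ 2 / 4) * ((μ n).re - (μ m).re) ^ 2)) :=
          norm_sum_le_of_le _ fun n _ => norm_sum_le_of_le _ fun m _ => hint n m
      _ ≤ κ * (K₀ * ∑ n ∈ F, ‖c n‖ ^ 2) := by
          simp only [← Finset.mul_sum]
          refine mul_le_mul_of_nonneg_left ?_ hκ0
          refine sum_sum_mul_le_of_sum_le F (fun n => ‖c n‖) _ (fun n m => by positivity)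
            (fun n m => ?_) fun m => hrow (fun n => (μ n).re) hμ F _
          rw [sub_sq_comm]
      _ = _ := by ring
  calc ∫ t in (0 : ℝ)..1, ‖P t‖ ^ 2
      ≤ ∫ t in (0 : ℝ)..1, Real.exp 1 * Q t := by
        refine intervalIntegral.integral_mono_on zero_le_one
          (Continuous.intervalIntegrable (by fun_prop) _ _)
          (Continuous.intervalIntegrable (by fun_prop) _ _) fun t ht => ?_
        simp only [hQ]
        rw [← mul_assoc, ← Real.exp_add]
        refine le_mul_of_one_le_left (by positivity) (Real.one_le_exp ?_)
        nlinarith [ht.1, ht.2]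
    _ = Real.exp 1 * ∫ t in Set.Ioc (0 : ℝ) 1, Q t := by
        rw [intervalIntegral.integral_const_mul, intervalIntegral.integral_of_le zero_le_one]
    _ ≤ Real.exp 1 * ∫ t, Q t := by
        exact mul_le_mul_of_nonneg_left
          (setIntegral_le_integral hQi (Filter.Eventually.of_forall hQ0)) (Real.exp_pos 1).le
    _ ≤ Real.exp 1 * (κ * K₀ * ∑ n ∈ F, ‖c n‖ ^ 2) := by gcongr
    _ ≤ _ := by
        have : 0 ≤ ∑ n ∈ F, ‖c n‖ ^ 2 := by positivity
        linarith

/-- A Bessel inequality for exponentials with incompressible frequencies in a strip. -/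
theorem exists_sum_sq_norm_expIntegral_le {b : ℝ} (hb : b ≠ 0) (h : ℝ) (d : ℕ) :
    ∃ K : ℝ, 0 < K ∧ ∀ μ : ℤ → ℂ, Incompressible d μ → (∀ n : ℤ, |(μ n).im| ≤ h) →
      ∀ g : ℝ → ℂ, Measurable g → IntervalIntegrable (fun t => ‖g t‖ ^ 2) volume 0 1 →
      ∀ F : Finset ℤ,
        ∑ n ∈ F, ‖∫ t in (0 : ℝ)..1, g t * Complex.exp (Complex.I * b * μ n * t)‖ ^ 2 ≤
          K * ∫ t in (0 : ℝ)..1, ‖g t‖ ^ 2 := by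
  obtain ⟨K, hK, hexp⟩ := exists_integral_sq_expSum_le hb h d
  refine ⟨K, hK, fun μ hμ hh g hg hg2 F => ?_⟩
  set G : ℤ → ℂ := fun n => ∫ t in (0 : ℝ)..1, g t * Complex.exp (Complex.I * b * μ n * t) with hG
  set P : ℝ → ℂ := fun t =>
    ∑ n ∈ F, starRingEnd ℂ (G n) * Complex.exp (Complex.I * b * μ n * t) with hP
  have hPc : Continuous P := by fun_prop
  have hg1 : IntervalIntegrable g volume 0 1 := by
    refine (hg2.add (intervalIntegrable_const (c := (1 : ℝ)))).mono_fun
      hg.aestronglyMeasurable (Filter.Eventually.of_forall fun t => ?_)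
    change ‖g t‖ ≤ ‖‖g t‖ ^ 2 + 1‖
    rw [Real.norm_of_nonneg (by positivity)]
    nlinarith [sq_nonneg (‖g t‖ - 1)]
  have hS : ∑ n ∈ F, ‖G n‖ ^ 2 ≤ ∫ t in (0 : ℝ)..1, ‖g t‖ * ‖P t‖ := by
    have h1 : ((∑ n ∈ F, ‖G n‖ ^ 2 : ℝ) : ℂ) = ∫ t in (0 : ℝ)..1, g t * P t := by
      simp only [hP, Finset.mul_sum]
      rw [intervalIntegral.integral_finsetSum
        (fun n _ => hg1.mul_continuousOn (Continuous.continuousOn (by fun_prop)))]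
      push_cast
      refine Finset.sum_congr rfl fun n _ => ?_
      simp only [mul_left_comm (g _)]
      rw [intervalIntegral.integral_const_mul, mul_comm]
      rw [← Complex.ofReal_pow, ← Complex.normSq_eq_norm_sq, ← Complex.mul_conj]
    calc _ ≤ ‖((∑ n ∈ F, ‖G n‖ ^ 2 : ℝ) : ℂ)‖ := by
          rw [Complex.norm_real]; exact le_abs_self _
      _ ≤ ∫ t in (0 : ℝ)..1, ‖g t * P t‖ := by
          rw [h1]; exact intervalIntegral.norm_integral_le_integral_norm zero_le_one
      _ = _ := by simp only [norm_mul]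
  have hcs : ∫ t in (0 : ℝ)..1, ‖g t‖ * ‖P t‖ ≤
      ∫ t in (0 : ℝ)..1, (K / 2 * ‖g t‖ ^ 2 + 1 / (2 * K) * ‖P t‖ ^ 2) := by
    have hP2 : IntervalIntegrable (fun t => ‖P t‖ ^ 2) volume 0 1 :=
      Continuous.intervalIntegrable (by fun_prop) _ _
    refine intervalIntegral.integral_mono_on zero_le_one
      (hg1.norm.mul_continuousOn hPc.norm.continuousOn)
      ((hg2.const_mul _).add (hP2.const_mul _)) fun t _ => ?_
    have h2 : K / 2 * ‖g t‖ ^ 2 + 1 / (2 * K) * ‖P t‖ ^ 2 - ‖g t‖ * ‖P t‖ =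
      1 / (2 * K) * (K * ‖g t‖ - ‖P t‖) ^ 2 := by field_simp; ring
    have h3 : 0 ≤ 1 / (2 * K) * (K * ‖g t‖ - ‖P t‖) ^ 2 := by positivity
    linarith
  have hPint := hexp μ hμ hh F fun n => starRingEnd ℂ (G n)
  simp only [RCLike.norm_conj] at hPint
  rw [intervalIntegral.integral_add (hg2.const_mul _)
    ((Continuous.intervalIntegrable (by fun_prop) _ _).const_mul _),
    intervalIntegral.integral_const_mul, intervalIntegral.integral_const_mul] at hcs
  have h4 : 1 / (2 * K) * ∫ t in (0 : ℝ)..1, ‖P t‖ ^ 2 ≤ 1 / 2 * ∑ n ∈ F, ‖G n‖ ^ 2 :=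
    calc _ ≤ 1 / (2 * K) * (K * ∑ n ∈ F, ‖G n‖ ^ 2) := by gcongr
      _ = _ := by field_simp
  linarith

theorem lintegral_Ioo_zero_rpow {r : ℝ} (hr : -1 < r) {a : ℝ} (ha : 0 ≤ a) :
    ∫⁻ s in Set.Ioo 0 a, ENNReal.ofReal (s ^ r) = ENNReal.ofReal (a ^ (r + 1) / (r + 1)) := by
  have h1 := intervalIntegral.intervalIntegrable_rpow' (a := 0) (b := a) hr
  rw [intervalIntegrable_iff_integrableOn_Ioo_of_le ha] at h1
  rw [← ofReal_integral_eq_lintegral_ofReal h1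
    ((ae_restrict_iff' measurableSet_Ioo).2 (Filter.Eventually.of_forall fun s hs =>
      Real.rpow_nonneg hs.1.le _)), ← integral_Ioc_eq_integral_Ioo,
    ← intervalIntegral.integral_of_le ha, integral_rpow (Or.inl hr),
    Real.zero_rpow (by linarith), sub_zero]

theorem lintegral_Ioi_rpow_of_lt {r : ℝ} (hr : r < -1) {a : ℝ} (ha : 0 < a) :
    ∫⁻ s in Set.Ioi a, ENNReal.ofReal (s ^ r) = ENNReal.ofReal (-a ^ (r + 1) / (r + 1)) := by
  rw [← ofReal_integral_eq_lintegral_ofReal (integrableOn_Ioi_rpow_of_lt hr ha)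
    ((ae_restrict_iff' measurableSet_Ioi).2 (Filter.Eventually.of_forall fun s hs =>
      Real.rpow_nonneg (ha.trans hs).le _)), integral_Ioi_rpow_of_lt hr ha]

theorem ofReal_mul_rpow_eq_lintegral {p : ℝ} (hp : 0 < p) (w : ℝ) {v : ℝ} (hv : 0 ≤ v) :
    ENNReal.ofReal (w * v ^ p) = ENNReal.ofReal p * ∫⁻ s in Set.Ioi (0 : ℝ),
      ENNReal.ofReal (s ^ (p - 1)) * if s < v then ENNReal.ofReal w else 0 := by
  have h1 : ∫⁻ s in Set.Ioi (0 : ℝ),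
      ENNReal.ofReal (s ^ (p - 1)) * (if s < v then ENNReal.ofReal w else 0) =
      ENNReal.ofReal w * ∫⁻ s in Set.Ioo 0 v, ENNReal.ofReal (s ^ (p - 1)) := by
    rw [← lintegral_const_mul _ (by fun_prop), ← Set.Ioi_inter_Iio, Set.inter_comm,
      ← Measure.restrict_restrict measurableSet_Iio, ← lintegral_indicator measurableSet_Iio]
    refine lintegral_congr fun s => ?_
    by_cases hs : s < v <;> simp [hs, mul_comm]
  rw [h1, lintegral_Ioo_zero_rpow (by linarith) hv, sub_add_cancel, mul_left_comm,
    ← ENNReal.ofReal_mul hp.le, mul_div_cancel₀ _ hp.ne', mul_comm w,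
    ENNReal.ofReal_mul (by positivity), mul_comm]

theorem lintegral_rpow_mul_lower {p : ℝ} (hp : 1 < p) {A u : ℝ} (hA : 0 ≤ A) (hu : 0 ≤ u) :
    ∫⁻ s in Set.Ioi (0 : ℝ), ENNReal.ofReal (s ^ (p - 1)) *
      (ENNReal.ofReal (A * s⁻¹) * ENNReal.ofReal (if s < u then u else 0)) =
      ENNReal.ofReal (A / (p - 1)) * ENNReal.ofReal (u ^ p) := by
  have h1 : ∫⁻ s in Set.Ioi (0 : ℝ), ENNReal.ofReal (s ^ (p - 1)) *
      (ENNReal.ofReal (A * s⁻¹) * ENNReal.ofReal (if s < u then u else 0)) =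
      ENNReal.ofReal (A * u) * ∫⁻ s in Set.Ioo 0 u, ENNReal.ofReal (s ^ (p - 2)) := by
    rw [← lintegral_const_mul _ (by fun_prop), ← Set.Ioi_inter_Iio, Set.inter_comm,
      ← Measure.restrict_restrict measurableSet_Iio, ← lintegral_indicator measurableSet_Iio]
    refine setLIntegral_congr_fun measurableSet_Ioi fun s (hs : 0 < s) => ?_
    by_cases hsu : s < u
    · simp only [hsu, if_true, Set.indicator_of_mem, Set.mem_Iio]
      rw [← ENNReal.ofReal_mul (by positivity), ← ENNReal.ofReal_mul (by positivity),
        ← ENNReal.ofReal_mul (by positivity), show p - 1 = p - 2 + 1 by ring,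
        Real.rpow_add_one hs.ne']
      congr 1
      field_simp
    · simp [hsu]
  rw [h1, lintegral_Ioo_zero_rpow (by linarith) hu, ← ENNReal.ofReal_mul (by positivity),
    ← ENNReal.ofReal_mul (div_nonneg hA (by linarith))]
  congr 1
  rcases hu.eq_or_lt with rfl | hu
  · simp [Real.zero_rpow (by linarith : p ≠ 0)]
  · rw [show p - 2 + 1 = p - 1 by ring, Real.rpow_sub_one hu.ne']
    field_simp

theorem lintegral_rpow_mul_upper {p : ℝ} (hp0 : 0 < p) (hp : p < 2) {B u : ℝ} (hB : 0 ≤ B)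
    (hu : 0 ≤ u) :
    ∫⁻ s in Set.Ioi (0 : ℝ), ENNReal.ofReal (s ^ (p - 1)) *
      (ENNReal.ofReal (B * (s ^ 2)⁻¹) * ENNReal.ofReal (if s < u then 0 else u ^ 2)) =
      ENNReal.ofReal (B / (2 - p)) * ENNReal.ofReal (u ^ p) := by
  rcases hu.eq_or_lt with rfl | hu
  · simp [Real.zero_rpow hp0.ne']
  have h1 : ∫⁻ s in Set.Ioi (0 : ℝ), ENNReal.ofReal (s ^ (p - 1)) *
      (ENNReal.ofReal (B * (s ^ 2)⁻¹) * ENNReal.ofReal (if s < u then 0 else u ^ 2)) =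
      ENNReal.ofReal (B * u ^ 2) * ∫⁻ s in Set.Ioi u, ENNReal.ofReal (s ^ (p - 3)) := by
    rw [← setLIntegral_congr (Ioi_ae_eq_Ici (a := u)).symm, ← lintegral_const_mul _ (by fun_prop),
      ← Set.inter_eq_left.2 (Set.Ici_subset_Ioi.2 hu),
      ← Measure.restrict_restrict measurableSet_Ici, ← lintegral_indicator measurableSet_Ici]
    refine setLIntegral_congr_fun measurableSet_Ioi fun s (hs : 0 < s) => ?_
    by_cases hsu : s < u
    · simp [hsu]
    · simp only [hsu, if_false, Set.indicator_of_mem, Set.mem_Ici, not_lt.1 hsu]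
      rw [← ENNReal.ofReal_mul (by positivity), ← ENNReal.ofReal_mul (by positivity),
        ← ENNReal.ofReal_mul (by positivity), show p - 1 = p - 3 + (2 : ℕ) by push_cast; ring,
        Real.rpow_add_natCast hs.ne']
      congr 1
      field_simp
  rw [h1, lintegral_Ioi_rpow_of_lt (by linarith) hu, ← ENNReal.ofReal_mul (by positivity),
    ← ENNReal.ofReal_mul (div_nonneg hB (by linarith))]
  congr 1
  rw [show p - 3 + 1 = p - (2 : ℕ) by push_cast; ring, Real.rpow_sub_natCast hu.ne']
  have h2 : 2 - p ≠ 0 := by linarith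
  have h3 : p - 2 ≠ 0 := by linarith
  push_cast
  field_simp
  ring

/-- Marcinkiewicz interpolation between weak type `(1, 1)` and strong type `(2, 2)`, in the form
of a bound on a weighted finite sum whose distribution function is controlled. -/
theorem sum_mul_rpow_le_of_distribution_le {α ι : Type*} [MeasurableSpace α] {ν : Measure α}
    [SFinite ν] {u : α → ℝ} (hu : Measurable u) (hu0 : ∀ t, 0 ≤ u t) (F : Finset ι)
    (w v : ι → ℝ) (hv : ∀ n, 0 ≤ v n) {p : ℝ} (hp1 : 1 < p) (hp2 : p < 2) {A B : ℝ}
    (hA : 0 ≤ A) (hB : 0 ≤ B)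
    (H : ∀ s : ℝ, 0 < s → ∑ n ∈ F, (if s < v n then ENNReal.ofReal (w n) else 0) ≤
      ENNReal.ofReal (A * s⁻¹) * ∫⁻ t, ENNReal.ofReal (if s < u t then u t else 0) ∂ν +
      ENNReal.ofReal (B * (s ^ 2)⁻¹) * ∫⁻ t, ENNReal.ofReal (if s < u t then 0 else u t ^ 2) ∂ν) :
    ∑ n ∈ F, ENNReal.ofReal (w n * v n ^ p) ≤
      ENNReal.ofReal (p * (A / (p - 1) + B / (2 - p))) * ∫⁻ t, ENNReal.ofReal (u t ^ p) ∂ν := by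
  have hlt : MeasurableSet {q : ℝ × α | q.1 < u q.2} :=
    measurableSet_lt measurable_fst (hu.comp measurable_snd)
  have hm1 : Measurable fun q : ℝ × α => ENNReal.ofReal (q.1 ^ (p - 1)) *
      (ENNReal.ofReal (A * q.1⁻¹) * ENNReal.ofReal (if q.1 < u q.2 then u q.2 else 0)) := by
    have h' : Measurable fun q : ℝ × α => if q.1 < u q.2 then u q.2 else 0 :=
      Measurable.ite hlt (hu.comp measurable_snd) measurable_const
    fun_prop
  have hm2 : Measurable fun q : ℝ × α => ENNReal.ofReal (q.1 ^ (p - 1)) *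
      (ENNReal.ofReal (B * (q.1 ^ 2)⁻¹) *
        ENNReal.ofReal (if q.1 < u q.2 then 0 else u q.2 ^ 2)) := by
    have h' : Measurable fun q : ℝ × α => if q.1 < u q.2 then 0 else u q.2 ^ 2 :=
      Measurable.ite hlt (measurable_const (a := (0 : ℝ))) ((hu.comp measurable_snd).pow_const 2)
    fun_prop
  have hu1 : ∀ s, Measurable fun t => ENNReal.ofReal (if s < u t then u t else 0) := fun s =>
    (Measurable.ite (measurableSet_lt measurable_const hu) hu measurable_const).ennreal_ofReal
  have hu2 : ∀ s, Measurable fun t => ENNReal.ofReal (if s < u t then 0 else u t ^ 2) := fun s =>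
    (Measurable.ite (measurableSet_lt measurable_const hu) measurable_const
      (hu.pow_const 2)).ennreal_ofReal
  have hp1' : 0 < p - 1 := by linarith
  have hp2' : 0 < 2 - p := by linarith
  have hp0 : 0 < p := by linarith
  calc ∑ n ∈ F, ENNReal.ofReal (w n * v n ^ p)
      = ENNReal.ofReal p * ∫⁻ s in Set.Ioi (0 : ℝ), ENNReal.ofReal (s ^ (p - 1)) *
          ∑ n ∈ F, if s < v n then ENNReal.ofReal (w n) else 0 := by
        simp_rw [ofReal_mul_rpow_eq_lintegral hp0 _ (hv _), Finset.mul_sum]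
        rw [← Finset.mul_sum, lintegral_finsetSum]
        intro n _
        have : Measurable fun s => if s < v n then ENNReal.ofReal (w n) else 0 :=
          Measurable.ite measurableSet_Iio measurable_const measurable_const
        fun_prop
    _ ≤ ENNReal.ofReal p * ∫⁻ s in Set.Ioi (0 : ℝ),
          ((∫⁻ t, ENNReal.ofReal (s ^ (p - 1)) * (ENNReal.ofReal (A * s⁻¹) *
              ENNReal.ofReal (if s < u t then u t else 0)) ∂ν) +
            ∫⁻ t, ENNReal.ofReal (s ^ (p - 1)) * (ENNReal.ofReal (B * (s ^ 2)⁻¹) *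
              ENNReal.ofReal (if s < u t then 0 else u t ^ 2)) ∂ν) := by
        refine mul_le_mul_right (setLIntegral_mono' measurableSet_Ioi fun s hs => ?_) _
        rw [lintegral_const_mul _ ((hu1 s).const_mul _), lintegral_const_mul _ (hu1 s),
          lintegral_const_mul _ ((hu2 s).const_mul _), lintegral_const_mul _ (hu2 s), ← mul_add]
        exact mul_le_mul_right (H s hs) _
    _ = ENNReal.ofReal p * ((∫⁻ t, ENNReal.ofReal (A / (p - 1)) * ENNReal.ofReal (u t ^ p) ∂ν) +
          ∫⁻ t, ENNReal.ofReal (B / (2 - p)) * ENNReal.ofReal (u t ^ p) ∂ν) := by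
        have hs1 := lintegral_lintegral_swap (μ := volume.restrict (Set.Ioi (0 : ℝ))) (ν := ν)
          (f := fun s t => ENNReal.ofReal (s ^ (p - 1)) * (ENNReal.ofReal (A * s⁻¹) *
            ENNReal.ofReal (if s < u t then u t else 0))) hm1.aemeasurable
        have hs2 := lintegral_lintegral_swap (μ := volume.restrict (Set.Ioi (0 : ℝ))) (ν := ν)
          (f := fun s t => ENNReal.ofReal (s ^ (p - 1)) * (ENNReal.ofReal (B * (s ^ 2)⁻¹) *
            ENNReal.ofReal (if s < u t then 0 else u t ^ 2))) hm2.aemeasurable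
        rw [lintegral_add_left hm1.lintegral_prod_right', hs1, hs2]
        simp_rw [lintegral_rpow_mul_lower hp1 hA (hu0 _),
          lintegral_rpow_mul_upper hp0 hp2 hB (hu0 _)]
    _ = _ := by
        rw [lintegral_const_mul _ (by fun_prop), lintegral_const_mul _ (by fun_prop), ← add_mul,
          ← ENNReal.ofReal_add (by positivity) (by positivity), ← mul_assoc,
          ← ENNReal.ofReal_mul hp0.le]

theorem norm_expIntegral_le {b h : ℝ} (hh : 0 ≤ h) {z : ℂ} (hz : |z.im| ≤ h) {g : ℝ → ℂ}
    (hg : IntervalIntegrable g volume 0 1) :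
    ‖∫ t in (0 : ℝ)..1, g t * Complex.exp (Complex.I * b * z * t)‖ ≤
      Real.exp (|b| * h) * ∫ t in (0 : ℝ)..1, ‖g t‖ := by
  rw [← intervalIntegral.integral_const_mul]
  refine intervalIntegral.norm_integral_le_of_norm_le zero_le_one
    (Filter.Eventually.of_forall fun t ht => ?_) (hg.norm.const_mul _)
  rw [norm_mul, mul_comm, Complex.norm_exp]
  gcongr
  have h1 : (Complex.I * b * z * t).re = -(b * z.im * t) := by simp
  rw [h1]
  calc -(b * z.im * t) ≤ |b * z.im * t| := neg_le_abs _
    _ = |b| * |z.im| * t := by rw [abs_mul, abs_mul, abs_of_pos ht.1]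
    _ ≤ |b| * h * 1 := mul_le_mul (by gcongr) ht.2 ht.1.le (by positivity)
    _ = _ := mul_one _

theorem sum_inv_sq_filter_lt_mul_le {M s : ℝ} (hM : 0 ≤ M) (hs : 0 < s) (G : ℤ → ℝ)
    (hGM : ∀ n, G n ≤ M) (F : Finset ℤ) :
    ∑ n ∈ (F.filter fun n : ℤ => s < (1 + |(n : ℝ)|) * G n), ((1 + |(n : ℝ)|) ^ 2)⁻¹ ≤ 4 * M * s⁻¹ := by
  have hlt : ∀ n ∈ F.filter fun n : ℤ => s < (1 + |(n : ℝ)|) * G n, s < (1 + |(n : ℝ)|) * M :=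
    fun n hn => (Finset.mem_filter.1 hn).2.trans_le
      (mul_le_mul_of_nonneg_left (hGM n) (by positivity))
  rcases hM.eq_or_lt with rfl | hM
  · rw [Finset.sum_eq_zero]
    · simp
    · intro n hn
      have := hlt n hn
      linarith
  · refine (sum_inv_sq_le_of_lt (R := s / M) (by positivity) _ fun n hn => ?_).trans_eq ?_
    · rw [div_lt_iff₀ hM]
      exact hlt n hn
    · field_simp

theorem sum_inv_sq_filter_lt_mul_le_sum_sq {s : ℝ} (hs : 0 < s) (G : ℤ → ℝ) (F : Finset ℤ) :
    ∑ n ∈ (F.filter fun n : ℤ => s < (1 + |(n : ℝ)|) * G n), ((1 + |(n : ℝ)|) ^ 2)⁻¹ ≤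
      (∑ n ∈ F, G n ^ 2) * (s ^ 2)⁻¹ := by
  calc ∑ n ∈ (F.filter fun n : ℤ => s < (1 + |(n : ℝ)|) * G n), ((1 + |(n : ℝ)|) ^ 2)⁻¹
      ≤ ∑ n ∈ (F.filter fun n : ℤ => s < (1 + |(n : ℝ)|) * G n), G n ^ 2 * (s ^ 2)⁻¹ := by
        refine Finset.sum_le_sum fun n hn => ?_
        have h1 := (Finset.mem_filter.1 hn).2
        rw [← div_eq_mul_inv, inv_eq_one_div, div_le_div_iff₀ (by positivity) (by positivity),
          one_mul, ← mul_pow, mul_comm (G n)]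
        gcongr
    _ ≤ ∑ n ∈ F, G n ^ 2 * (s ^ 2)⁻¹ :=
        Finset.sum_le_sum_of_subset_of_nonneg (Finset.filter_subset _ _)
          fun n _ _ => by positivity
    _ = _ := by rw [Finset.sum_mul]

theorem sum_inv_sq_filter_lt_le_add {s : ℝ} (G G₁ G₂ : ℤ → ℝ) (hG : ∀ n, G n ≤ G₁ n + G₂ n)
    (F : Finset ℤ) :
    ∑ n ∈ (F.filter fun n : ℤ => s < (1 + |(n : ℝ)|) * G n), ((1 + |(n : ℝ)|) ^ 2)⁻¹ ≤
      ∑ n ∈ (F.filter fun n : ℤ => s / 2 < (1 + |(n : ℝ)|) * G₁ n), ((1 + |(n : ℝ)|) ^ 2)⁻¹ +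
      ∑ n ∈ (F.filter fun n : ℤ => s / 2 < (1 + |(n : ℝ)|) * G₂ n), ((1 + |(n : ℝ)|) ^ 2)⁻¹ := by
  simp only [Finset.sum_filter, ← Finset.sum_add_distrib]
  refine Finset.sum_le_sum fun n _ => ?_
  have h1 : (1 + |(n : ℝ)|) * G n ≤ (1 + |(n : ℝ)|) * G₁ n + (1 + |(n : ℝ)|) * G₂ n := by
    rw [← mul_add]
    exact mul_le_mul_of_nonneg_left (hG n) (by positivity)
  have h2 : 0 ≤ ((1 + |(n : ℝ)|) ^ 2)⁻¹ := by positivity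
  split_ifs <;> linarith

theorem exists_distribution_expIntegral_le {b : ℝ} (hb : b ≠ 0) {h : ℝ} (hh : 0 ≤ h) (d : ℕ) :
    ∃ A B : ℝ, 0 ≤ A ∧ 0 ≤ B ∧ ∀ μ : ℤ → ℂ, Incompressible d μ → (∀ n : ℤ, |(μ n).im| ≤ h) →
      ∀ g : ℝ → ℂ, Measurable g → IntervalIntegrable g volume 0 1 →
      ∀ (F : Finset ℤ) (s : ℝ), 0 < s →
        ∑ n ∈ (F.filter fun n : ℤ => s < (1 + |(n : ℝ)|) *
            ‖∫ t in (0 : ℝ)..1, g t * Complex.exp (Complex.I * b * μ n * t)‖),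
          ((1 + |(n : ℝ)|) ^ 2)⁻¹ ≤
        A * s⁻¹ * (∫ t in (0 : ℝ)..1, if s < ‖g t‖ then ‖g t‖ else 0) +
        B * (s ^ 2)⁻¹ * ∫ t in (0 : ℝ)..1, if s < ‖g t‖ then 0 else ‖g t‖ ^ 2 := by
  obtain ⟨K, hK, hbessel⟩ := exists_sum_sq_norm_expIntegral_le hb h d
  refine ⟨8 * Real.exp (|b| * h), 4 * K, by positivity, by positivity,
    fun μ hμ hμh g hg hgi F s hs => ?_⟩
  have hset : MeasurableSet {t | s < ‖g t‖} := measurableSet_lt measurable_const hg.norm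
  set g₁ : ℝ → ℂ := fun t => if s < ‖g t‖ then g t else 0 with hg₁
  set g₂ : ℝ → ℂ := fun t => if s < ‖g t‖ then 0 else g t with hg₂
  have hm₁ : Measurable g₁ := Measurable.ite hset hg measurable_const
  have hm₂ : Measurable g₂ := Measurable.ite hset measurable_const hg
  have hi₁ : IntervalIntegrable g₁ volume 0 1 := by
    refine hgi.mono_fun hm₁.aestronglyMeasurable (Filter.Eventually.of_forall fun t => ?_)
    simp only [hg₁]
    split_ifs <;> simp
  have hi₂ : IntervalIntegrable g₂ volume 0 1 := by
    refine hgi.mono_fun hm₂.aestronglyMeasurable (Filter.Eventually.of_forall fun t => ?_)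
    simp only [hg₂]
    split_ifs <;> simp
  have hsq : IntervalIntegrable (fun t => ‖g₂ t‖ ^ 2) volume 0 1 := by
    refine (intervalIntegrable_const (c := s ^ 2)).mono_fun
      (hm₂.norm.pow_const 2).aestronglyMeasurable (Filter.Eventually.of_forall fun t => ?_)
    simp only [hg₂]
    rw [norm_pow, norm_norm, norm_pow, Real.norm_of_nonneg hs.le]
    gcongr
    split_ifs with ht
    · simpa using hs.le
    · exact not_lt.1 ht
  have hcont : ∀ n, ContinuousOn (fun t : ℝ => Complex.exp (Complex.I * b * μ n * t))
      (Set.uIcc 0 1) := fun n => Continuous.continuousOn (by fun_prop)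
  have hG : ∀ n, ‖∫ t in (0 : ℝ)..1, g t * Complex.exp (Complex.I * b * μ n * t)‖ ≤
      ‖∫ t in (0 : ℝ)..1, g₁ t * Complex.exp (Complex.I * b * μ n * t)‖ +
      ‖∫ t in (0 : ℝ)..1, g₂ t * Complex.exp (Complex.I * b * μ n * t)‖ := by
    intro n
    rw [show (fun t : ℝ => g t * Complex.exp (Complex.I * b * μ n * t)) = fun t : ℝ =>
        g₁ t * Complex.exp (Complex.I * b * μ n * t) +
          g₂ t * Complex.exp (Complex.I * b * μ n * t) from funext fun t => by
        simp only [hg₁, hg₂]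
        split_ifs <;> simp,
      intervalIntegral.integral_add (hi₁.mul_continuousOn (hcont n))
        (hi₂.mul_continuousOn (hcont n))]
    exact norm_add_le _ _
  have hn₁ : ∀ t, ‖g₁ t‖ = if s < ‖g t‖ then ‖g t‖ else 0 := fun t => by
    simp only [hg₁]
    split_ifs <;> simp
  have hn₂ : ∀ t, ‖g₂ t‖ ^ 2 = if s < ‖g t‖ then 0 else ‖g t‖ ^ 2 := fun t => by
    simp only [hg₂]
    split_ifs <;> simp
  simp only [← hn₁, ← hn₂]
  have hint₁ : 0 ≤ ∫ t in (0 : ℝ)..1, ‖g₁ t‖ :=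
    intervalIntegral.integral_nonneg zero_le_one fun t _ => norm_nonneg _
  refine (sum_inv_sq_filter_lt_le_add _ _ _ hG F).trans (add_le_add ?_ ?_)
  · refine (sum_inv_sq_filter_lt_mul_le (by positivity) (half_pos hs) _
      (fun n => norm_expIntegral_le hh (hμh n) hi₁) F).trans_eq ?_
    field_simp
    ring
  · refine (sum_inv_sq_filter_lt_mul_le_sum_sq (half_pos hs) _ F).trans ?_
    calc _ ≤ (K * ∫ t in (0 : ℝ)..1, ‖g₂ t‖ ^ 2) * ((s / 2) ^ 2)⁻¹ := by
          gcongr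
          exact hbessel μ hμ hμh g₂ hm₂ hsq F
      _ = _ := by
          field_simp
          ring

theorem ofReal_intervalIntegral_zero_one {f : ℝ → ℝ} (hf : IntervalIntegrable f volume 0 1)
    (hf0 : ∀ t, 0 ≤ f t) :
    ENNReal.ofReal (∫ t in (0 : ℝ)..1, f t) =
      ∫⁻ t, ENNReal.ofReal (f t) ∂(volume.restrict (Set.Ioc 0 1)) := by
  rw [intervalIntegral.integral_of_le zero_le_one]
  exact ofReal_integral_eq_lintegral_ofReal
    ((intervalIntegrable_iff_integrableOn_Ioc_of_le zero_le_one).1 hf)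
    (Filter.Eventually.of_forall hf0)

/-- For `p ∈ (1,2]`, `b ≠ 0`, `h ≥ 0`, `d ∈ ℕ` there is `C = C(b,p,h,d) > 0` such that
for every incompressible sequence `μ` of density `d` lying in the strip `Π_h` and every
`g ∈ L^p[0,1]`, with `G(λ) := ∫₀¹ g(t) e^{ibλt} dt`, one has the weighted inequality
`∑_{n∈ℤ} (1+|n|)^{p-2} |G(μ_n)|^{p} ≤ C ‖g‖_p^{p}`. -/
theorem stmt6 (p : ℝ) (hp1 : 1 < p) (hp2 : p ≤ 2) (b : ℝ) (hb : b ≠ 0)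
    (h : ℝ) (hh : 0 ≤ h) (d : ℕ) :
    ∃ C : ℝ, 0 < C ∧ ∀ μ : ℤ → ℂ, Incompressible d μ → (∀ n : ℤ, |(μ n).im| ≤ h) →
      ∀ g : ℝ → ℂ, Measurable g →
      IntervalIntegrable (fun t => ‖g t‖ ^ p) volume 0 1 →
      ∀ F : Finset ℤ, ∑ n ∈ F, (1 + |(n : ℝ)|) ^ (p - 2) *
          ‖∫ t in (0:ℝ)..1, g t * Complex.exp (Complex.I * b * μ n * t)‖ ^ p ≤
        C * lpNorm01 p g ^ p := by
  have hp0 : 0 < p := by linarith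
  have hnorm : ∀ g : ℝ → ℂ, lpNorm01 p g ^ p = ∫ t in (0 : ℝ)..1, ‖g t‖ ^ p := by
    intro g
    rw [lpNorm01, ← Real.rpow_mul (intervalIntegral.integral_nonneg zero_le_one
      fun t _ => by positivity), one_div_mul_cancel hp0.ne', Real.rpow_one]
  simp only [hnorm]
  rcases hp2.eq_or_lt with rfl | hp2
  · obtain ⟨K, hK, hbessel⟩ := exists_sum_sq_norm_expIntegral_le hb h d
    refine ⟨K, hK, fun μ hμ hμh g hg hgp F => ?_⟩
    simp only [Real.rpow_two, sub_self, Real.rpow_zero, one_mul] at hgp ⊢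
    exact hbessel μ hμ hμh g hg hgp F
  obtain ⟨A, B, hA, hB, hdist⟩ := exists_distribution_expIntegral_le hb hh d
  have hp1' : 0 < p - 1 := by linarith
  have hp2' : 0 < 2 - p := by linarith
  refine ⟨p * (A / (p - 1) + B / (2 - p)) + 1, by positivity, fun μ hμ hμh g hg hgp F => ?_⟩
  have hgi : IntervalIntegrable g volume 0 1 := by
    refine (hgp.add (intervalIntegrable_const (c := (1 : ℝ)))).mono_fun
      hg.aestronglyMeasurable (Filter.Eventually.of_forall fun t => ?_)
    change ‖g t‖ ≤ ‖‖g t‖ ^ p + 1‖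
    rw [Real.norm_of_nonneg (by positivity)]
    rcases le_total ‖g t‖ 1 with h1 | h1
    · have : 0 ≤ ‖g t‖ ^ p := by positivity
      linarith
    · linarith [Real.self_le_rpow_of_one_le h1 hp1.le]
  set G : ℤ → ℝ := fun n =>
    ‖∫ t in (0 : ℝ)..1, g t * Complex.exp (Complex.I * b * μ n * t)‖ with hG
  have hterm : ∀ n : ℤ, (1 + |(n : ℝ)|) ^ (p - 2) * G n ^ p =
      ((1 + |(n : ℝ)|) ^ 2)⁻¹ * ((1 + |(n : ℝ)|) * G n) ^ p := by
    intro n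
    have h1 : 0 < 1 + |(n : ℝ)| := by positivity
    rw [Real.mul_rpow h1.le (norm_nonneg _), Real.rpow_sub h1, Real.rpow_two]
    ring
  have hgp0 : 0 ≤ ∫ t in (0 : ℝ)..1, ‖g t‖ ^ p :=
    intervalIntegral.integral_nonneg zero_le_one fun t _ => by positivity
  have hmain := sum_mul_rpow_le_of_distribution_le (ν := volume.restrict (Set.Ioc (0 : ℝ) 1))
    hg.norm (fun t => norm_nonneg _) F (fun n : ℤ => ((1 + |(n : ℝ)|) ^ 2)⁻¹)
    (fun n => (1 + |(n : ℝ)|) * G n) (fun n => by positivity) hp1 hp2 hA hB fun s hs => by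
      have hset : MeasurableSet {t | s < ‖g t‖} := measurableSet_lt measurable_const hg.norm
      have hi₁ : IntervalIntegrable (fun t => if s < ‖g t‖ then ‖g t‖ else 0) volume 0 1 := by
        refine hgi.mono_fun
          (Measurable.ite hset hg.norm measurable_const).aestronglyMeasurable
          (Filter.Eventually.of_forall fun t => ?_)
        dsimp only
        split_ifs <;> simp
      have hi₂ : IntervalIntegrable (fun t => if s < ‖g t‖ then 0 else ‖g t‖ ^ 2)
          volume 0 1 := by
        refine (intervalIntegrable_const (c := s ^ 2)).mono_fun
          (Measurable.ite hset measurable_const (hg.norm.pow_const 2)).aestronglyMeasurable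
          (Filter.Eventually.of_forall fun t => ?_)
        dsimp only
        rw [norm_pow, Real.norm_of_nonneg hs.le]
        split_ifs with ht
        · simpa using sq_nonneg s
        · rw [norm_pow, norm_norm]
          gcongr
          exact not_lt.1 ht
      have h₁ : ∀ t, 0 ≤ if s < ‖g t‖ then ‖g t‖ else 0 := fun t => by split_ifs <;> positivity
      have h₂ : ∀ t, 0 ≤ if s < ‖g t‖ then 0 else ‖g t‖ ^ 2 := fun t => by
        split_ifs <;> positivity
      have I₁ := intervalIntegral.integral_nonneg (μ := volume) zero_le_one
        fun t (_ : t ∈ Set.Icc (0 : ℝ) 1) => h₁ t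
      have I₂ := intervalIntegral.integral_nonneg (μ := volume) zero_le_one
        fun t (_ : t ∈ Set.Icc (0 : ℝ) 1) => h₂ t
      rw [← ofReal_intervalIntegral_zero_one hi₁ h₁, ← ofReal_intervalIntegral_zero_one hi₂ h₂,
        ← ENNReal.ofReal_mul (by positivity), ← ENNReal.ofReal_mul (by positivity),
        ← ENNReal.ofReal_add (by positivity) (by positivity), ← Finset.sum_filter,
        ← ENNReal.ofReal_sum_of_nonneg fun n _ => by positivity]
      exact ENNReal.ofReal_le_ofReal (hdist μ hμ hμh g hg hgi F s hs)
  rw [← ofReal_intervalIntegral_zero_one hgp fun t => by positivity,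
    ← ENNReal.ofReal_mul (by positivity),
    ← ENNReal.ofReal_sum_of_nonneg fun n _ => by positivity,
    ENNReal.ofReal_le_ofReal_iff (by positivity)] at hmain
  rw [Finset.sum_congr rfl fun n _ => hterm n]
  linarith
end

section
/- Let p ∈ (1,2], p' = p/(p−1), b ∈ ℝ∖{0} and h ≥ 0. There exists a constant C = C(p,h,b) > 0 such that for every r > 0, every g ∈ L^p[0,1] with ‖g‖_{L^p[0,1]} ≤ r, and every δ > 0, there exists a set I ⊆ ℤ with card(ℤ∖I) ≤ C·(r/δ)^{p'} such that |∫₀¹ g(t) e^{ibλt} dt| < δ for all λ ∈ ⋃_{n∈I} [n,n+1] × [−h,h]. -/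
open MeasureTheory

/-- The characters `t ↦ e^{ibnt}`, `n ∈ ℤ`, are orthogonal on `[0, L]` whenever `bL ∈ 2πℤ`. -/
lemma integral_exp_int_eq_zero {b L : ℝ} {j : ℤ} (hb : b ≠ 0) (hL : b * L = 2 * Real.pi * j)
    {k : ℤ} (hk : k ≠ 0) :
    ∫ t in (0:ℝ)..L, Complex.exp (Complex.I * b * k * t) = 0 := by
  rw [integral_exp_mul_complex (by simp [hb, hk])]
  have hLC : (b : ℂ) * L = 2 * Real.pi * j := by exact_mod_cast hL
  have h1 : Complex.I * b * k * L = ((k * j : ℤ) : ℂ) * (2 * Real.pi * Complex.I) := by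
    push_cast
    linear_combination Complex.I * k * hLC
  rw [h1, Complex.exp_int_mul_two_pi_mul_I]
  simp

/-- Parseval's identity for exponential sums with frequencies in `bℤ`. -/
lemma integral_norm_sq_exp_sum {b L : ℝ} {j : ℤ} (hb : b ≠ 0) (hL : b * L = 2 * Real.pi * j)
    (S : Finset ℤ) (c : ℤ → ℂ) :
    ∫ t in (0:ℝ)..L, ‖∑ n ∈ S, c n * Complex.exp (Complex.I * b * n * t)‖ ^ 2 =
      L * ∑ n ∈ S, ‖c n‖ ^ 2 := by
  have key : ∀ t : ℝ, ((‖∑ n ∈ S, c n * Complex.exp (Complex.I * b * n * t)‖ ^ 2 : ℝ) : ℂ) =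
      ∑ n ∈ S, ∑ m ∈ S, c n * (starRingEnd ℂ) (c m) *
        Complex.exp (Complex.I * b * (n - m : ℤ) * t) := by
    intro t
    rw [Complex.ofReal_pow, ← Complex.mul_conj', map_sum, Finset.sum_mul_sum]
    refine Finset.sum_congr rfl fun n _ => Finset.sum_congr rfl fun m _ => ?_
    rw [map_mul, ← Complex.exp_conj, mul_mul_mul_comm, ← Complex.exp_add]
    congr 2
    simp only [map_mul, Complex.conj_I, Complex.conj_ofReal, map_intCast]
    push_cast
    ring
  apply Complex.ofReal_injective
  rw [← intervalIntegral.integral_ofReal]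
  simp_rw [key]
  have hint : ∀ n m : ℤ, IntervalIntegrable (fun t : ℝ => c n * (starRingEnd ℂ) (c m) *
      Complex.exp (Complex.I * b * (n - m : ℤ) * t)) volume 0 L := fun n m =>
    Continuous.intervalIntegrable (by fun_prop) _ _
  rw [intervalIntegral.integral_finsetSum fun n _ =>
    by simpa only [Finset.sum_fn] using IntervalIntegrable.sum S fun m _ => hint n m]
  rw [Finset.mul_sum, Complex.ofReal_sum]
  refine Finset.sum_congr rfl fun n hn => ?_
  rw [intervalIntegral.integral_finsetSum fun m _ => hint n m,
    Finset.sum_eq_single_of_mem n hn]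
  · simp [Complex.mul_conj']
  · intro m _ hm
    rw [intervalIntegral.integral_const_mul,
      integral_exp_int_eq_zero hb hL (sub_ne_zero.mpr hm.symm), mul_zero]

lemma exists_one_le_mul_eq_two_pi_mul_int {b : ℝ} (hb : b ≠ 0) :
    ∃ L : ℝ, 1 ≤ L ∧ ∃ j : ℤ, b * L = 2 * Real.pi * j := by
  obtain ⟨M, hM⟩ := exists_nat_ge (|b| / (2 * Real.pi))
  rw [div_le_iff₀ (by positivity)] at hM
  refine ⟨2 * Real.pi * M / |b|, ?_, ?_⟩
  · rw [le_div_iff₀ (by positivity)]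
    linarith
  · rcases lt_or_gt_of_ne hb with h | h
    · refine ⟨-M, ?_⟩
      rw [abs_of_neg h]
      push_cast
      field_simp
    · refine ⟨M, ?_⟩
      rw [abs_of_pos h]
      push_cast
      field_simp

/-- Exponential sums with frequencies in `bℤ` and coefficients in the unit disc have `L²`-norm on
`[0,1]` at most a constant times the square root of the number of terms. -/
lemma exists_integral_norm_sq_exp_sum_le {b : ℝ} (hb : b ≠ 0) :
    ∃ K : ℝ, 0 < K ∧ ∀ (S : Finset ℤ) (c : ℤ → ℂ), (∀ n, ‖c n‖ ≤ 1) →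
      ∫ t in Set.Ioc (0:ℝ) 1, ‖∑ n ∈ S, c n * Complex.exp (Complex.I * b * n * t)‖ ^ 2 ≤
        K * S.card := by
  obtain ⟨L, hL1, j, hj⟩ := exists_one_le_mul_eq_two_pi_mul_int hb
  refine ⟨L, by linarith, fun S c hc => ?_⟩
  calc _ ≤ ∫ t in Set.Ioc (0:ℝ) L,
        ‖∑ n ∈ S, c n * Complex.exp (Complex.I * b * n * t)‖ ^ 2 := by
        apply setIntegral_mono_set
        · exact (Continuous.integrableOn_Icc (by fun_prop)).mono_set Set.Ioc_subset_Icc_self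
        · exact Filter.Eventually.of_forall fun t => by positivity
        · exact (Set.Ioc_subset_Ioc_right hL1).eventuallyLE
    _ = L * ∑ n ∈ S, ‖c n‖ ^ 2 := by
        rw [← intervalIntegral.integral_of_le (by linarith), integral_norm_sq_exp_sum hb hj]
    _ ≤ L * ∑ n ∈ S, 1 := by
        gcongr with n hn
        exact pow_le_one₀ (norm_nonneg _) (hc n)
    _ = L * S.card := by simp

lemma norm_exp_I_mul_int (b : ℝ) (n : ℤ) (t : ℝ) :
    ‖Complex.exp (Complex.I * b * n * t)‖ = 1 := by
  rw [show Complex.I * b * n * t = ((b * n * t : ℝ) : ℂ) * Complex.I by push_cast; ring]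
  exact Complex.norm_exp_ofReal_mul_I _

/-- The `L^q`-bound, `q ≥ 2`, obtained by interpolating between `L²` and `L^∞`. -/
lemma exists_lpNorm_exp_sum_le {b : ℝ} (hb : b ≠ 0) {p q : ℝ} (hpq : p.HolderConjugate q)
    (hp : p ≤ 2) :
    ∃ K : ℝ, 0 < K ∧ ∀ (S : Finset ℤ) (c : ℤ → ℂ), (∀ n, ‖c n‖ ≤ 1) →
      (∫ t in Set.Ioc (0:ℝ) 1,
        ‖∑ n ∈ S, c n * Complex.exp (Complex.I * b * n * t)‖ ^ q) ^ (1 / q) ≤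
        K * (S.card : ℝ) ^ (1 / p) := by
  obtain ⟨K, hK, h2⟩ := exists_integral_norm_sq_exp_sum_le hb
  have hp0 := hpq.pos
  have hq0 := hpq.symm.pos
  have hq2 : 2 ≤ q := by
    have := hpq.mul_eq_add
    by_contra! hlt
    nlinarith [hpq.lt, hpq.symm.lt]
  refine ⟨K ^ (1 / q), by positivity, fun S c hc => ?_⟩
  have hsup : ∀ t : ℝ, ‖∑ n ∈ S, c n * Complex.exp (Complex.I * b * n * t)‖ ≤ S.card := by
    intro t
    calc _ ≤ ∑ n ∈ S, (1 : ℝ) := norm_sum_le_of_le _ fun n _ => by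
          rw [norm_mul, norm_exp_I_mul_int, mul_one]; exact hc n
      _ = S.card := by simp
  rcases S.eq_empty_or_nonempty with rfl | hS
  · simp [hp0.ne', hq0.ne']
  have hN : (0 : ℝ) < S.card := by exact_mod_cast hS.card_pos
  have hle : ∫ t in Set.Ioc (0:ℝ) 1,
      ‖∑ n ∈ S, c n * Complex.exp (Complex.I * b * n * t)‖ ^ q ≤ K * (S.card : ℝ) ^ (q - 1) := by
    calc _ ≤ ∫ t in Set.Ioc (0:ℝ) 1, (S.card : ℝ) ^ (q - 2) *
            ‖∑ n ∈ S, c n * Complex.exp (Complex.I * b * n * t)‖ ^ 2 := by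
          apply setIntegral_mono
          · refine (Continuous.integrableOn_Icc ?_).mono_set Set.Ioc_subset_Icc_self
            exact Continuous.rpow_const (by fun_prop) fun _ => Or.inr hq0.le
          · exact (Continuous.integrableOn_Icc (by fun_prop)).mono_set Set.Ioc_subset_Icc_self
          · intro t
            dsimp only
            calc _ = ‖∑ n ∈ S, c n * Complex.exp (Complex.I * b * n * t)‖ ^ (q - 2) *
                  ‖∑ n ∈ S, c n * Complex.exp (Complex.I * b * n * t)‖ ^ (2 : ℝ) := by
                  rw [← Real.rpow_add_of_nonneg (norm_nonneg _) (by linarith) (by norm_num),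
                    sub_add_cancel]
              _ ≤ _ := by
                  rw [Real.rpow_two]
                  exact mul_le_mul_of_nonneg_right
                    (Real.rpow_le_rpow (norm_nonneg _) (hsup t) (by linarith)) (by positivity)
      _ = (S.card : ℝ) ^ (q - 2) * ∫ t in Set.Ioc (0:ℝ) 1,
            ‖∑ n ∈ S, c n * Complex.exp (Complex.I * b * n * t)‖ ^ 2 := integral_const_mul _ _
      _ ≤ (S.card : ℝ) ^ (q - 2) * (K * S.card) := by gcongr; exact h2 S c hc
      _ = K * ((S.card : ℝ) ^ (q - 2) * (S.card : ℝ) ^ (1 : ℝ)) := by rw [Real.rpow_one]; ring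
      _ = K * (S.card : ℝ) ^ (q - 1) := by rw [← Real.rpow_add hN]; ring_nf
  calc _ ≤ (K * (S.card : ℝ) ^ (q - 1)) ^ (1 / q) := by
        gcongr
    _ = K ^ (1 / q) * (S.card : ℝ) ^ (1 / p) := by
        rw [Real.mul_rpow hK.le (by positivity), ← Real.rpow_mul hN.le]
        congr 2
        have := hpq.inv_add_inv_eq_one
        rw [mul_one_div, sub_div, div_self hq0.ne']
        rw [one_div, one_div]
        linarith

/-- The dual bound: the `ℓ¹`-norm over a finite set of the Fourier coefficients of an
`L^p`-function. -/
lemma exists_sum_norm_integral_le {b : ℝ} (hb : b ≠ 0) {p q : ℝ} (hpq : p.HolderConjugate q)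
    (hp : p ≤ 2) :
    ∃ K : ℝ, 0 < K ∧ ∀ (S : Finset ℤ) (g : ℝ → ℂ),
      MemLp g (ENNReal.ofReal p) (volume.restrict (Set.Ioc 0 1)) →
      ∑ n ∈ S, ‖∫ t in Set.Ioc (0:ℝ) 1, g t * Complex.exp (Complex.I * b * n * t)‖ ≤
        K * (∫ t in Set.Ioc (0:ℝ) 1, ‖g t‖ ^ p) ^ (1 / p) * (S.card : ℝ) ^ (1 / p) := by
  obtain ⟨K, hK, hF⟩ := exists_lpNorm_exp_sum_le hb hpq hp
  refine ⟨K, hK, fun S g hg => ?_⟩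
  have hg1 : Integrable g (volume.restrict (Set.Ioc (0:ℝ) 1)) :=
    hg.integrable (by simpa using hpq.lt.le)
  set G : ℤ → ℂ := fun n =>
    ∫ t in Set.Ioc (0:ℝ) 1, g t * Complex.exp (Complex.I * b * n * t) with hG
  have hc : ∀ n, ∃ c : ℂ, ‖c‖ ≤ 1 ∧ (‖G n‖ : ℂ) = c * G n := fun n => by
    obtain ⟨c, hc, h⟩ := RCLike.exists_norm_eq_mul_self (G n)
    exact ⟨c, hc.le, h⟩
  choose c hc1 hcG using hc
  have hint : ∀ n : ℤ, Integrable (fun t : ℝ => c n * (g t * Complex.exp (Complex.I * b * n * t)))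
      (volume.restrict (Set.Ioc (0:ℝ) 1)) := fun n => by
    refine (hg1.mul_bdd (c := 1) (Continuous.aestronglyMeasurable (by fun_prop)) ?_).const_mul _
    exact Filter.Eventually.of_forall fun t => (norm_exp_I_mul_int b n t).le
  have hsum : ((∑ n ∈ S, ‖G n‖ : ℝ) : ℂ) = ∫ t in Set.Ioc (0:ℝ) 1,
      g t * ∑ n ∈ S, c n * Complex.exp (Complex.I * b * n * t) := by
    push_cast
    simp_rw [hcG, hG, ← integral_const_mul]
    rw [← integral_finsetSum _ fun n _ => hint n]
    refine integral_congr_ae (Filter.Eventually.of_forall fun t => ?_)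
    simp only [Finset.mul_sum]
    exact Finset.sum_congr rfl fun n _ => by ring
  have hFmem : MemLp (fun t : ℝ => ∑ n ∈ S, c n * Complex.exp (Complex.I * b * n * t))
      (ENNReal.ofReal q) (volume.restrict (Set.Ioc (0:ℝ) 1)) := by
    refine MemLp.of_bound (Continuous.aestronglyMeasurable (by fun_prop)) (∑ n ∈ S, 1)
      (Filter.Eventually.of_forall fun t => norm_sum_le_of_le _ fun n _ => ?_)
    rw [norm_mul, norm_exp_I_mul_int, mul_one]
    exact hc1 n
  calc ∑ n ∈ S, ‖G n‖ = ‖((∑ n ∈ S, ‖G n‖ : ℝ) : ℂ)‖ := by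
        rw [Complex.norm_real, Real.norm_of_nonneg (by positivity)]
    _ ≤ ∫ t in Set.Ioc (0:ℝ) 1,
        ‖g t‖ * ‖∑ n ∈ S, c n * Complex.exp (Complex.I * b * n * t)‖ := by
        rw [hsum]
        simpa only [norm_mul] using norm_integral_le_integral_norm (μ := volume.restrict
          (Set.Ioc (0:ℝ) 1)) fun t : ℝ =>
            g t * ∑ n ∈ S, c n * Complex.exp (Complex.I * b * n * t)
    _ ≤ _ := integral_mul_norm_le_Lp_mul_Lq hpq hg hFmem
    _ ≤ (∫ t in Set.Ioc (0:ℝ) 1, ‖g t‖ ^ p) ^ (1 / p) * (K * (S.card : ℝ) ^ (1 / p)) := by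
        gcongr
        exact hF S c hc1
    _ = _ := by ring

/-- Taylor expansion of the Fourier–Laplace transform around an integer point. -/
lemma norm_fourierLaplace_le_tsum {b R : ℝ} {g : ℝ → ℂ}
    (hg : Integrable g (volume.restrict (Set.Ioc (0:ℝ) 1))) (n : ℤ) {lam : ℂ}
    (hlam : ‖lam - n‖ ≤ R)
    (hs : Summable fun m : ℕ => (|b| * R) ^ m / m.factorial *
      ‖∫ t in Set.Ioc (0:ℝ) 1, (t : ℂ) ^ m * g t * Complex.exp (Complex.I * b * n * t)‖) :
    ‖∫ t in Set.Ioc (0:ℝ) 1, g t * Complex.exp (Complex.I * b * lam * t)‖ ≤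
      ∑' m : ℕ, (|b| * R) ^ m / m.factorial *
        ‖∫ t in Set.Ioc (0:ℝ) 1, (t : ℂ) ^ m * g t * Complex.exp (Complex.I * b * n * t)‖ := by
  have hR : 0 ≤ R := (norm_nonneg _).trans hlam
  set a : ℕ → ℂ := fun m => (Complex.I * b * (lam - n)) ^ m / m.factorial with ha
  have hanorm : ∀ m, ‖a m‖ ≤ (|b| * R) ^ m / m.factorial := fun m => by
    simp only [ha, norm_div, norm_pow, norm_mul, Complex.norm_I, one_mul, Complex.norm_real,
      Real.norm_eq_abs, Complex.norm_natCast]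
    gcongr
  have hsum : HasSum (fun m => ∫ t in Set.Ioc (0:ℝ) 1,
      a m * ((t : ℂ) ^ m * g t * Complex.exp (Complex.I * b * n * t)))
      (∫ t in Set.Ioc (0:ℝ) 1, g t * Complex.exp (Complex.I * b * lam * t)) := by
    refine hasSum_integral_of_dominated_convergence
      (fun m t => (|b| * R) ^ m / m.factorial * ‖g t‖) (fun m => ?_) (fun m => ?_) ?_ ?_ ?_
    · refine AEStronglyMeasurable.const_mul (AEStronglyMeasurable.mul
        (AEStronglyMeasurable.mul ?_ hg.1) ?_) _ <;>
      exact Continuous.aestronglyMeasurable (by fun_prop)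
    · filter_upwards [ae_restrict_mem measurableSet_Ioc] with t ht
      rw [norm_mul, norm_mul, norm_exp_I_mul_int, mul_one, norm_mul, norm_pow, Complex.norm_real,
        Real.norm_of_nonneg ht.1.le]
      exact mul_le_mul (hanorm m)
        (mul_le_of_le_one_left (norm_nonneg _) (pow_le_one₀ ht.1.le ht.2))
        (mul_nonneg (pow_nonneg ht.1.le _) (norm_nonneg _)) (by positivity)
    · exact Filter.Eventually.of_forall fun t =>
        (Real.summable_pow_div_factorial _).mul_right _
    · simp_rw [tsum_mul_right]
      exact hg.norm.const_mul _
    · refine Filter.Eventually.of_forall fun t => ?_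
      have h := (NormedSpace.expSeries_div_hasSum_exp (𝔸 := ℂ)
        (Complex.I * b * (lam - n) * t)).mul_right (g t * Complex.exp (Complex.I * b * n * t))
      rw [← Complex.exp_eq_exp_ℂ] at h
      rw [mul_left_comm, ← Complex.exp_add, ← add_mul, ← mul_add, sub_add_cancel] at h
      refine h.congr_fun fun m => ?_
      rw [mul_pow]
      ring
  rw [← hsum.tsum_eq]
  refine tsum_of_norm_bounded hs.hasSum fun m => ?_
  rw [integral_const_mul, norm_mul]
  gcongr
  exact hanorm m

/-- A Plancherel–Pólya type bound for the Fourier–Laplace transform sampled at points which stay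
within a bounded distance from distinct integers. -/
lemma exists_sum_norm_fourierLaplace_le {b : ℝ} (hb : b ≠ 0) {p q : ℝ}
    (hpq : p.HolderConjugate q) (hp : p ≤ 2) {R : ℝ} (hR : 0 ≤ R) :
    ∃ D : ℝ, 0 < D ∧ ∀ (S : Finset ℤ) (g : ℝ → ℂ) (lam : ℤ → ℂ),
      MemLp g (ENNReal.ofReal p) (volume.restrict (Set.Ioc 0 1)) →
      (∀ n ∈ S, ‖lam n - n‖ ≤ R) →
      ∑ n ∈ S, ‖∫ t in Set.Ioc (0:ℝ) 1, g t * Complex.exp (Complex.I * b * lam n * t)‖ ≤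
        D * (∫ t in Set.Ioc (0:ℝ) 1, ‖g t‖ ^ p) ^ (1 / p) * (S.card : ℝ) ^ (1 / p) := by
  obtain ⟨K, hK, hKS⟩ := exists_sum_norm_integral_le hb hpq hp
  have hp0 := hpq.pos
  refine ⟨Real.exp (|b| * R) * K, by positivity, fun S g lam hg hlam => ?_⟩
  set B := K * (∫ t in Set.Ioc (0:ℝ) 1, ‖g t‖ ^ p) ^ (1 / p) * (S.card : ℝ) ^ (1 / p) with hB
  set w : ℕ → ℝ := fun m => (|b| * R) ^ m / m.factorial with hw
  set G : ℕ → ℤ → ℝ := fun m n =>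
    ‖∫ t in Set.Ioc (0:ℝ) 1, (t : ℂ) ^ m * g t * Complex.exp (Complex.I * b * n * t)‖ with hG
  have hw0 : ∀ m, 0 ≤ w m := fun m => by positivity
  have hws : Summable w := Real.summable_pow_div_factorial _
  have hle : ∀ m : ℕ, ∀ᵐ t : ℝ ∂(volume.restrict (Set.Ioc (0:ℝ) 1)),
      ‖(t : ℂ) ^ m * g t‖ ≤ ‖g t‖ := fun m => by
    filter_upwards [ae_restrict_mem measurableSet_Ioc] with t ht
    rw [norm_mul, norm_pow, Complex.norm_real, Real.norm_of_nonneg ht.1.le]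
    exact mul_le_of_le_one_left (norm_nonneg _) (pow_le_one₀ ht.1.le ht.2)
  have hmem : ∀ m : ℕ, MemLp (fun t : ℝ => (t : ℂ) ^ m * g t) (ENNReal.ofReal p)
      (volume.restrict (Set.Ioc 0 1)) := fun m =>
    hg.mono (AEStronglyMeasurable.mul (Continuous.aestronglyMeasurable (by fun_prop)) hg.1) (hle m)
  have hpow : ∀ {f : ℝ → ℂ}, MemLp f (ENNReal.ofReal p) (volume.restrict (Set.Ioc 0 1)) →
      Integrable (fun t => ‖f t‖ ^ p) (volume.restrict (Set.Ioc 0 1)) := fun hf => by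
    simpa [ENNReal.toReal_ofReal hp0.le] using hf.integrable_norm_rpow (by simpa) (by simp)
  have hGB : ∀ m, ∑ n ∈ S, G m n ≤ B := fun m => by
    refine (hKS S _ (hmem m)).trans ?_
    rw [hB]
    gcongr K * ?_ ^ _ * _
    refine integral_mono_ae (hpow (hmem m)) (hpow hg) ?_
    filter_upwards [hle m] with t ht
    gcongr
  have hGs : ∀ n ∈ S, Summable fun m => w m * G m n := fun n hn => by
    refine Summable.of_nonneg_of_le (fun m => mul_nonneg (hw0 m) (norm_nonneg _)) (fun m => ?_)
      (hws.mul_right B)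
    gcongr
    exact (Finset.single_le_sum (f := G m) (fun i _ => norm_nonneg _) hn).trans (hGB m)
  calc _ ≤ ∑ n ∈ S, ∑' m, w m * G m n := Finset.sum_le_sum fun n hn =>
        norm_fourierLaplace_le_tsum (hg.integrable (by simpa using hpq.lt.le)) n (hlam n hn)
          (hGs n hn)
    _ = ∑' m, ∑ n ∈ S, w m * G m n := (Summable.tsum_finsetSum hGs).symm
    _ ≤ ∑' m, w m * B := by
        refine Summable.tsum_le_tsum (fun m => ?_) (summable_sum hGs) (hws.mul_right B)
        rw [← Finset.mul_sum]
        gcongr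
        exact hGB m
    _ = Real.exp (|b| * R) * B := by
        rw [tsum_mul_right, Real.exp_eq_exp_ℝ, NormedSpace.exp_eq_tsum_div]
    _ = _ := by rw [hB]; ring

lemma Set.finite_and_ncard_le_of_forall_finset {α : Type*} {E : Set α} {x : ℝ}
    (hE : ∀ S : Finset α, (S : Set α) ⊆ E → (S.card : ℝ) ≤ x) :
    E.Finite ∧ (E.ncard : ℝ) ≤ x := by
  have hfin : E.Finite := by
    by_contra hinf
    obtain ⟨k, hk⟩ := exists_nat_gt x
    obtain ⟨S, hSE, hS⟩ := Set.Infinite.exists_subset_card_eq hinf k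
    have := hE S hSE
    rw [hS] at this
    linarith
  refine ⟨hfin, ?_⟩
  rw [Set.ncard_eq_toFinset_card E hfin]
  exact hE _ (by simp)

/-- Uniform Riemann–Lebesgue-type lemma for the ordinary Fourier transform: there is
`C = C(p,h,b) > 0` such that for every `r > 0`, every `g ∈ L^p[0,1]` with `‖g‖_p ≤ r`,
and every `δ > 0`, there is a set `I ⊆ ℤ` with `card(ℤ∖I) ≤ C (r/δ)^{p'}` such that
`|∫₀¹ g(t) e^{ibλt} dt| < δ` for all `λ ∈ ⋃_{n∈I} [n,n+1] × [-h,h]`. -/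
theorem stmt8 (p : ℝ) (hp1 : 1 < p) (hp2 : p ≤ 2) (b : ℝ) (hb : b ≠ 0)
    (h : ℝ) (hh : 0 ≤ h) :
    ∃ C : ℝ, 0 < C ∧ ∀ r : ℝ, 0 < r → ∀ g : ℝ → ℂ, Measurable g →
      IntervalIntegrable (fun t => ‖g t‖ ^ p) volume 0 1 → lpNorm01 p g ≤ r →
      ∀ δ : ℝ, 0 < δ →
      ∃ I : Set ℤ, Iᶜ.Finite ∧ (Iᶜ.ncard : ℝ) ≤ C * (r / δ) ^ (p / (p - 1)) ∧
        ∀ n ∈ I, ∀ lam : ℂ, lam.re ∈ Set.Icc (n : ℝ) (n + 1) → lam.im ∈ Set.Icc (-h) h →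
          ‖∫ t in (0:ℝ)..1, g t * Complex.exp (Complex.I * b * lam * t)‖ < δ := by
  have hpq : p.HolderConjugate (p / (p - 1)) := Real.HolderConjugate.conjExponent hp1
  set q := p / (p - 1) with hq
  have hp0 := hpq.pos
  have hq0 := hpq.symm.pos
  obtain ⟨D, hD, hDS⟩ := exists_sum_norm_fourierLaplace_le hb hpq hp2 (by positivity : 0 ≤ 1 + h)
  refine ⟨D ^ q, by positivity, fun r hr g hgm hgp hgr δ hδ => ?_⟩
  have hgL : MemLp g (ENNReal.ofReal p) (volume.restrict (Set.Ioc 0 1)) := by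
    rw [← integrable_norm_rpow_iff hgm.aestronglyMeasurable (by simpa) (by simp),
      ENNReal.toReal_ofReal hp0.le]
    exact (intervalIntegrable_iff_integrableOn_Ioc_of_le zero_le_one).mp hgp
  simp_rw [lpNorm01, intervalIntegral.integral_of_le zero_le_one] at hgr ⊢
  set I : Set ℤ := {n | ∀ lam : ℂ, lam.re ∈ Set.Icc (n : ℝ) (n + 1) → lam.im ∈ Set.Icc (-h) h →
    ‖∫ t in Set.Ioc (0:ℝ) 1, g t * Complex.exp (Complex.I * b * lam * t)‖ < δ} with hI
  refine ⟨I, and_assoc.mp ⟨Set.finite_and_ncard_le_of_forall_finset fun S hS => ?_,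
    fun n hn => hn⟩⟩
  have hex : ∀ n : ℤ, ∃ lam : ℂ, n ∈ S → ‖lam - n‖ ≤ 1 + h ∧
      δ ≤ ‖∫ t in Set.Ioc (0:ℝ) 1, g t * Complex.exp (Complex.I * b * lam * t)‖ := by
    intro n
    by_cases hn : n ∈ S
    · have := hS hn
      simp only [hI, Set.mem_compl_iff, Set.mem_ofPred_eq, not_forall, not_lt] at this
      obtain ⟨lam, hre, him, hle⟩ := this
      refine ⟨lam, fun _ => ⟨(Complex.norm_le_abs_re_add_abs_im _).trans ?_, hle⟩⟩
      simp only [Complex.sub_re, Complex.sub_im, Complex.intCast_re, Complex.intCast_im, sub_zero]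
      gcongr
      · rw [abs_le]
        constructor <;> linarith [hre.1, hre.2]
      · exact abs_le.mpr him
    · exact ⟨0, fun h' => absurd h' hn⟩
  choose lam hlam using hex
  rcases S.eq_empty_or_nonempty with rfl | hSne
  · simp only [Finset.card_empty, Nat.cast_zero]
    positivity
  have hN : (0 : ℝ) < S.card := by exact_mod_cast hSne.card_pos
  have hmain : S.card * δ ≤ D * r * (S.card : ℝ) ^ (1 / p) := by
    calc S.card * δ = ∑ n ∈ S, δ := by rw [Finset.sum_const, nsmul_eq_mul]
      _ ≤ _ := Finset.sum_le_sum fun n hn => (hlam n hn).2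
      _ ≤ _ := hDS S g lam hgL fun n hn => (hlam n hn).1
      _ ≤ _ := by gcongr
  have hroot : (S.card : ℝ) ^ (1 / q) ≤ D * (r / δ) := by
    have hsplit : (S.card : ℝ) = (S.card : ℝ) ^ (1 / q) * (S.card : ℝ) ^ (1 / p) := by
      rw [← Real.rpow_add hN, one_div, one_div, hpq.symm.inv_add_inv_eq_one, Real.rpow_one]
    have hpos : 0 < (S.card : ℝ) ^ (1 / p) := Real.rpow_pos_of_pos hN _
    rw [← mul_div_assoc, le_div_iff₀ hδ]
    refine le_of_mul_le_mul_right ?_ hpos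
    calc _ = (S.card : ℝ) ^ (1 / q) * (S.card : ℝ) ^ (1 / p) * δ := by ring
      _ ≤ _ := by rwa [← hsplit]
  calc (S.card : ℝ) = ((S.card : ℝ) ^ (1 / q)) ^ q := by
        rw [← Real.rpow_mul hN.le, one_div_mul_cancel hq0.ne', Real.rpow_one]
    _ ≤ (D * (r / δ)) ^ q := by gcongr
    _ = _ := Real.mul_rpow hD.le (by positivity)
end

section
/- Let p ∈ [2,∞) and let N, S be measurable complex-valued functions on the triangle Ω = {(x,t) : 0 ≤ t ≤ x ≤ 1}, both with finite X_{1,p}-norm, satisfying the resolvent-kernel equation N(x,t) + S(x,t) + ∫_t^x N(x,ξ) S(ξ,t) dξ = 0 for almost all (x,t) ∈ Ω. Then ‖S‖_{X_{1,p}} ≤ 2^{1−1/p} · ‖N‖_{X_{1,p}} · exp( p⁻¹ 2^{p−1} ‖N‖_{X_{1,p}}^p ). -/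
open MeasureTheory
open scoped ENNReal

/-- The `X_{1,p}`-norm of a kernel on the triangle `Ω = {0 ≤ t ≤ x ≤ 1}`:
`‖f‖_{X_{1,p}} = ( esssup_{t∈[0,1]} ∫_t^1 |f(x,t)|^p dx )^{1/p}`. -/
noncomputable def X1pNorm (p : ℝ) (f : ℝ → ℝ → ℂ) : ℝ≥0∞ :=
  (essSup (fun t => ∫⁻ x in Set.Icc t 1, ENNReal.ofReal (‖f x t‖ ^ p))
      (volume.restrict (Set.Icc (0:ℝ) 1))) ^ (1 / p)

section KernelOperator

variable {α : Type*} [MeasurableSpace α] {μ : Measure α}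

/-- The integral operator with kernel `A`. -/
noncomputable def kernelOp (μ : Measure α) (A : α → α → ℂ) (f : α → ℂ) (x : α) : ℂ :=
  ∫ ξ, A x ξ * f ξ ∂μ

lemma enorm_kernelOp_le (A : α → α → ℂ) (f : α → ℂ) (x : α) :
    ‖kernelOp μ A f x‖ₑ ≤ ∫⁻ ξ, ‖A x ξ‖ₑ * ‖f ξ‖ₑ ∂μ := by
  simpa only [enorm_mul, kernelOp] using
    enorm_integral_le_lintegral_enorm (μ := μ) fun ξ => A x ξ * f ξ

lemma kernelOp_add {A : α → α → ℂ} {f g : α → ℂ} {x : α}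
    (hf : Integrable (fun ξ => A x ξ * f ξ) μ) (hg : Integrable (fun ξ => A x ξ * g ξ) μ) :
    kernelOp μ A (f + g) x = kernelOp μ A f x + kernelOp μ A g x := by
  simp only [kernelOp, Pi.add_apply, mul_add]
  exact integral_add hf hg

variable [SFinite μ]

lemma lintegral_weight_kernel_le {w : α → ℝ≥0∞} (hw : Measurable w) {A : α → α → ℂ}
    (hA : Measurable (Function.uncurry A)) {C : ℝ≥0∞}
    (hC : ∀ᵐ ξ ∂μ, ∫⁻ x, w x * ‖A x ξ‖ₑ ∂μ ≤ C * w ξ) {g : α → ℝ≥0∞} (hg : AEMeasurable g μ) :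
    ∫⁻ x, w x * ∫⁻ ξ, ‖A x ξ‖ₑ * g ξ ∂μ ∂μ ≤ C * ∫⁻ ξ, w ξ * g ξ ∂μ := by
  have hA' : Measurable fun z : α × α => ‖A z.1 z.2‖ₑ := hA.enorm
  calc ∫⁻ x, w x * ∫⁻ ξ, ‖A x ξ‖ₑ * g ξ ∂μ ∂μ
      = ∫⁻ x, ∫⁻ ξ, w x * (‖A x ξ‖ₑ * g ξ) ∂μ ∂μ := by
        refine lintegral_congr fun x => ?_
        rw [lintegral_const_mul'']
        exact (hA.of_uncurry_left (x := x)).enorm.aemeasurable.mul hg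
    _ = ∫⁻ ξ, ∫⁻ x, w x * (‖A x ξ‖ₑ * g ξ) ∂μ ∂μ := by
        refine lintegral_lintegral_swap ?_
        exact (hw.comp measurable_fst).aemeasurable.mul (hA'.aemeasurable.mul hg.comp_snd)
    _ = ∫⁻ ξ, (∫⁻ x, w x * ‖A x ξ‖ₑ ∂μ) * g ξ ∂μ := by
        refine lintegral_congr fun ξ => ?_
        simp only [← mul_assoc]
        exact lintegral_mul_const _ (hw.mul (hA.of_uncurry_right (y := ξ)).enorm)
    _ ≤ ∫⁻ ξ, C * (w ξ * g ξ) ∂μ := by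
        refine lintegral_mono_ae ?_
        filter_upwards [hC] with ξ h
        rw [← mul_assoc]
        gcongr
    _ = C * ∫⁻ ξ, w ξ * g ξ ∂μ := lintegral_const_mul'' _ (hw.aemeasurable.mul hg)

lemma lintegral_kernel_le {A : α → α → ℂ} (hA : Measurable (Function.uncurry A)) {C : ℝ≥0∞}
    (hC : ∀ᵐ ξ ∂μ, ∫⁻ x, ‖A x ξ‖ₑ ∂μ ≤ C) {g : α → ℝ≥0∞} (hg : AEMeasurable g μ) :
    ∫⁻ x, ∫⁻ ξ, ‖A x ξ‖ₑ * g ξ ∂μ ∂μ ≤ C * ∫⁻ ξ, g ξ ∂μ := by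
  simpa using lintegral_weight_kernel_le (w := fun _ => 1) measurable_const hA (by simpa using hC) hg

lemma ae_lintegral_kernel_lt_top {A : α → α → ℂ} (hA : Measurable (Function.uncurry A))
    {C : ℝ≥0∞} (hCt : C ≠ ⊤) (hC : ∀ᵐ ξ ∂μ, ∫⁻ x, ‖A x ξ‖ₑ ∂μ ≤ C) {g : α → ℝ≥0∞}
    (hg : Measurable g) (hgt : ∫⁻ ξ, g ξ ∂μ ≠ ⊤) :
    ∀ᵐ x ∂μ, ∫⁻ ξ, ‖A x ξ‖ₑ * g ξ ∂μ < ⊤ := by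
  refine ae_lt_top ?_
    (ne_top_of_le_ne_top (ENNReal.mul_ne_top hCt hgt) (lintegral_kernel_le hA hC hg.aemeasurable))
  exact Measurable.lintegral_prod_right' (f := fun z : α × α => ‖A z.1 z.2‖ₑ * g z.2)
    (hA.enorm.mul (hg.comp measurable_snd))

lemma ae_integrable_kernel_mul {A : α → α → ℂ} (hA : Measurable (Function.uncurry A))
    {C : ℝ≥0∞} (hCt : C ≠ ⊤) (hC : ∀ᵐ ξ ∂μ, ∫⁻ x, ‖A x ξ‖ₑ ∂μ ≤ C) {f : α → ℂ}
    (hf : Measurable f) (hft : ∫⁻ ξ, ‖f ξ‖ₑ ∂μ ≠ ⊤) :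
    ∀ᵐ x ∂μ, Integrable (fun ξ => A x ξ * f ξ) μ := by
  filter_upwards [ae_lintegral_kernel_lt_top hA hCt hC hf.enorm hft] with x hx
  refine ⟨((hA.of_uncurry_left (x := x)).mul hf).aestronglyMeasurable, ?_⟩
  rw [hasFiniteIntegral_iff_enorm]
  simpa only [enorm_mul] using hx

lemma measurable_kernelOp {A : α → α → ℂ} (hA : Measurable (Function.uncurry A)) {f : α → ℂ}
    (hf : Measurable f) : Measurable (kernelOp μ A f) :=
  (StronglyMeasurable.integral_prod_right (f := fun x ξ => A x ξ * f ξ)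
    (hA.mul (hf.comp measurable_snd)).stronglyMeasurable).measurable

lemma lintegral_kernelOp_ne_top {A : α → α → ℂ} (hA : Measurable (Function.uncurry A))
    {C : ℝ≥0∞} (hCt : C ≠ ⊤) (hC : ∀ᵐ ξ ∂μ, ∫⁻ x, ‖A x ξ‖ₑ ∂μ ≤ C) {f : α → ℂ}
    (hf : Measurable f) (hft : ∫⁻ ξ, ‖f ξ‖ₑ ∂μ ≠ ⊤) :
    ∫⁻ x, ‖kernelOp μ A f x‖ₑ ∂μ ≠ ⊤ :=
  ne_top_of_le_ne_top (ENNReal.mul_ne_top hCt hft)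
    ((lintegral_mono fun x => enorm_kernelOp_le A f x).trans
      (lintegral_kernel_le hA hC hf.enorm.aemeasurable))

/-- The composition of two kernel operators has the composed kernel, whose column `η` is
`kernelOp μ A` applied to the column `η` of `B`. -/
lemma kernelOp_kernelOp {A B : α → α → ℂ} (hA : Measurable (Function.uncurry A))
    (hB : Measurable (Function.uncurry B)) {C D : ℝ≥0∞} (hCt : C ≠ ⊤) (hDt : D ≠ ⊤)
    (hC : ∀ᵐ ξ ∂μ, ∫⁻ x, ‖A x ξ‖ₑ ∂μ ≤ C) (hD : ∀ᵐ ξ ∂μ, ∫⁻ x, ‖B x ξ‖ₑ ∂μ ≤ D) {f : α → ℂ}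
    (hf : Measurable f) (hft : ∫⁻ ξ, ‖f ξ‖ₑ ∂μ ≠ ⊤) :
    ∀ᵐ x ∂μ, Integrable (fun η => kernelOp μ A (fun ξ => B ξ η) x * f η) μ ∧
      kernelOp μ A (kernelOp μ B f) x =
        ∫ η, kernelOp μ A (fun ξ => B ξ η) x * f η ∂μ := by
  have hm : Measurable fun ξ => ∫⁻ η, ‖B ξ η‖ₑ * ‖f η‖ₑ ∂μ :=
    Measurable.lintegral_prod_right' (f := fun z : α × α => ‖B z.1 z.2‖ₑ * ‖f z.2‖ₑ)
      (hB.enorm.mul (hf.enorm.comp measurable_snd))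
  have hfin := ae_lintegral_kernel_lt_top hA hCt hC hm (ne_top_of_le_ne_top
    (ENNReal.mul_ne_top hDt hft) (lintegral_kernel_le hB hD hf.enorm.aemeasurable))
  filter_upwards [hfin] with x hx
  have hmeas : Measurable (Function.uncurry fun ξ η => A x ξ * B ξ η * f η) :=
    (((hA.of_uncurry_left (x := x)).comp measurable_fst).mul hB).mul (hf.comp measurable_snd)
  have hint : Integrable (Function.uncurry fun ξ η => A x ξ * B ξ η * f η) (μ.prod μ) := by
    refine ⟨hmeas.aestronglyMeasurable, ?_⟩
    rw [hasFiniteIntegral_iff_enorm, lintegral_prod _ hmeas.enorm.aemeasurable]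
    refine lt_of_le_of_lt (le_of_eq ?_) hx
    refine lintegral_congr fun ξ => ?_
    rw [← lintegral_const_mul' _ _ enorm_ne_top]
    simp only [Function.uncurry_apply_pair, enorm_mul, mul_assoc]
  have hval : ∀ η, kernelOp μ A (fun ξ => B ξ η) x * f η = ∫ ξ, A x ξ * B ξ η * f η ∂μ :=
    fun η => (integral_mul_const _ _).symm
  simp only [hval]
  refine ⟨hint.integral_prod_right, ?_⟩
  rw [← integral_integral_swap hint]
  refine integral_congr_ae (Filter.Eventually.of_forall fun ξ => ?_)
  simp only [kernelOp, mul_assoc, integral_const_mul]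

/-- If `kernelOp μ A` is a strict contraction for a weighted `L¹` norm then `1 + kernelOp μ A`
is injective. -/
lemma ae_eq_zero_of_add_kernelOp_eq_zero {w : α → ℝ≥0∞} (hw : Measurable w)
    (hw0 : ∀ x, w x ≠ 0) (hw1 : ∀ᵐ x ∂μ, w x ≤ 1) {A : α → α → ℂ}
    (hA : Measurable (Function.uncurry A))
    (hC : ∀ᵐ ξ ∂μ, ∫⁻ x, w x * ‖A x ξ‖ₑ ∂μ ≤ 2⁻¹ * w ξ) {r : α → ℂ} (hr : Measurable r)
    (hrt : ∫⁻ ξ, ‖r ξ‖ₑ ∂μ ≠ ⊤) (h : ∀ᵐ x ∂μ, r x + kernelOp μ A r x = 0) :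
    ∀ᵐ x ∂μ, r x = 0 := by
  have hle : ∫⁻ x, w x * ‖r x‖ₑ ∂μ ≤ 2⁻¹ * ∫⁻ x, w x * ‖r x‖ₑ ∂μ := by
    refine le_trans (lintegral_mono_ae ?_)
      (lintegral_weight_kernel_le hw hA hC hr.enorm.aemeasurable)
    filter_upwards [h] with x hx
    rw [eq_neg_of_add_eq_zero_left hx, enorm_neg]
    gcongr
    exact enorm_kernelOp_le A r x
  have hfin : ∫⁻ x, w x * ‖r x‖ₑ ∂μ ≠ ⊤ := by
    refine ne_top_of_le_ne_top hrt (lintegral_mono_ae ?_)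
    filter_upwards [hw1] with x hx
    exact mul_le_of_le_one_left' hx
  have hzero : ∫⁻ x, w x * ‖r x‖ₑ ∂μ = 0 := by
    by_contra h0
    exact (ENNReal.half_lt_self h0 hfin).not_ge (by rwa [ENNReal.div_eq_inv_mul])
  filter_upwards [(lintegral_eq_zero_iff (hw.mul hr.enorm)).1 hzero] with x hx
  simpa [hw0 x] using hx

/-- A right resolvent kernel is also a left resolvent kernel, as soon as `1 + kernelOp μ N` is
injective on `L¹`. -/
lemma resolvent_comm {N S : α → α → ℂ} (hN : Measurable (Function.uncurry N))
    (hS : Measurable (Function.uncurry S)) {C D : ℝ≥0∞} (hCt : C ≠ ⊤) (hDt : D ≠ ⊤)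
    (hC : ∀ᵐ ξ ∂μ, ∫⁻ x, ‖N x ξ‖ₑ ∂μ ≤ C) (hD : ∀ᵐ ξ ∂μ, ∫⁻ x, ‖S x ξ‖ₑ ∂μ ≤ D)
    (hinj : ∀ r : α → ℂ, Measurable r → ∫⁻ ξ, ‖r ξ‖ₑ ∂μ ≠ ⊤ →
      (∀ᵐ x ∂μ, r x + kernelOp μ N r x = 0) → ∀ᵐ x ∂μ, r x = 0)
    (h : ∀ᵐ x ∂μ, ∀ᵐ t ∂μ, N x t + S x t + kernelOp μ N (fun ξ => S ξ t) x = 0) :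
    ∀ᵐ t ∂μ, ∀ᵐ x ∂μ, N x t + S x t + kernelOp μ S (fun ξ => N ξ t) x = 0 := by
  have hmeas : Measurable fun z : α × α =>
      N z.1 z.2 + S z.1 z.2 + kernelOp μ N (fun ξ => S ξ z.2) z.1 := by
    refine (hN.add hS).add (StronglyMeasurable.integral_prod_right
      (f := fun (z : α × α) ξ => N z.1 ξ * S ξ z.2) ?_).measurable
    refine Measurable.stronglyMeasurable (Measurable.mul ?_ ?_)
    · exact hN.comp ((measurable_fst.comp measurable_fst).prodMk measurable_snd)
    · exact hS.comp (measurable_snd.prodMk (measurable_snd.comp measurable_fst))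
  have h' := (Measure.ae_ae_comm
    (p := fun x t => N x t + S x t + kernelOp μ N (fun ξ => S ξ t) x = 0)
    (measurableSet_eq_fun hmeas measurable_const)).1 h
  filter_upwards [h', hC, hD] with t ht hCt' hDt'
  have hn : Measurable fun ξ => N ξ t := hN.of_uncurry_right
  have hs : Measurable fun ξ => S ξ t := hS.of_uncurry_right
  have hnt : ∫⁻ ξ, ‖N ξ t‖ₑ ∂μ ≠ ⊤ := ne_top_of_le_ne_top hCt hCt'
  have hst : ∫⁻ ξ, ‖S ξ t‖ₑ ∂μ ≠ ⊤ := ne_top_of_le_ne_top hDt hDt'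
  have hSn := measurable_kernelOp (μ := μ) hS hn
  have hSnt := lintegral_kernelOp_ne_top hS hDt hD hn hnt
  refine hinj (fun x => N x t + S x t + kernelOp μ S (fun ξ => N ξ t) x)
    ((hn.add hs).add hSn) ?_ ?_
  · refine ne_top_of_le_ne_top (ENNReal.add_ne_top.2 ⟨ENNReal.add_ne_top.2 ⟨hnt, hst⟩, hSnt⟩) ?_
    rw [← lintegral_add_left hn.enorm, ← lintegral_add_right _ hSn.enorm]
    exact lintegral_mono fun x => (enorm_add_le _ _).trans (by gcongr; exact enorm_add_le _ _)
  · filter_upwards [h, ht, ae_integrable_kernel_mul hN hCt hC hn hnt,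
      ae_integrable_kernel_mul hN hCt hC hs hst, ae_integrable_kernel_mul hN hCt hC hSn hSnt,
      ae_integrable_kernel_mul hS hDt hD hn hnt,
      kernelOp_kernelOp hN hS hCt hDt hC hD hn hnt] with x hx hxt hNn hNs hNSn hSn' hass
    have h1 : kernelOp μ N (fun x => N x t + S x t + kernelOp μ S (fun ξ => N ξ t) x) x =
        kernelOp μ N (fun ξ => N ξ t) x + kernelOp μ N (fun ξ => S ξ t) x +
          kernelOp μ N (kernelOp μ S fun ξ => N ξ t) x := by
      rw [← kernelOp_add hNn hNs, ← kernelOp_add _ hNSn]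
      · rfl
      · simp only [Pi.add_apply, mul_add]
        exact hNn.add hNs
    have h2 : kernelOp μ N (fun ξ => N ξ t) x + kernelOp μ S (fun ξ => N ξ t) x +
        ∫ η, kernelOp μ N (fun ξ => S ξ η) x * N η t ∂μ = 0 := by
      have hadd : kernelOp μ N (fun ξ => N ξ t) x + kernelOp μ S (fun ξ => N ξ t) x =
          ∫ η, (N x η * N η t + S x η * N η t) ∂μ := (integral_add hNn hSn').symm
      rw [hadd]
      refine (integral_add (hNn.add hSn') hass.1).symm.trans ?_
      refine integral_eq_zero_of_ae ?_
      filter_upwards [hx] with η hη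
      simp only [Pi.add_apply, Pi.zero_apply, ← add_mul, hη, zero_mul]
    rw [h1, hass.2]
    linear_combination hxt + h2

end KernelOperator

/-- For large `l`, a Volterra kernel with uniformly `L^p`-bounded columns, `p > 1`, is a strict
contraction for the `L¹` norm with weight `exp (-l x)`. -/
lemma exists_exp_weight_kernel_le {μ : Measure ℝ} (hμ : μ ≤ volume) {p q : ℝ}
    (hpq : p.HolderConjugate q) {N : ℝ → ℝ → ℂ} (hN : Measurable (Function.uncurry N))
    (hN0 : ∀ x ξ, x < ξ → N x ξ = 0) {B : ℝ≥0∞} (hBt : B ≠ ⊤)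
    (hB : ∀ᵐ ξ ∂μ, ∫⁻ x, ‖N x ξ‖ₑ ^ p ∂μ ≤ B) :
    ∃ l : ℝ, 0 < l ∧ ∀ᵐ ξ ∂μ, ∫⁻ x, ENNReal.ofReal (Real.exp (-l * x)) * ‖N x ξ‖ₑ ∂μ ≤
      2⁻¹ * ENNReal.ofReal (Real.exp (-l * ξ)) := by
  have hp := hpq.pos
  have hq := hpq.symm.pos
  have hlim : Filter.Tendsto (fun l : ℝ => ENNReal.ofReal (1 / (l * q)) ^ (1 / q) * B ^ (1 / p))
      Filter.atTop (nhds 0) := by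
    have h1 : Filter.Tendsto (fun l : ℝ => 1 / (l * q)) Filter.atTop (nhds 0) :=
      tendsto_const_nhds.div_atTop (Filter.tendsto_id.atTop_mul_const hq)
    have h2 := (ENNReal.tendsto_ofReal h1).ennrpow_const (1 / q)
    rw [ENNReal.ofReal_zero, ENNReal.zero_rpow_of_pos (by positivity)] at h2
    simpa using ENNReal.Tendsto.mul_const h2
      (Or.inr (ENNReal.rpow_ne_top_of_nonneg (one_div_nonneg.2 hp.le) hBt))
  obtain ⟨l, hl, hl0⟩ := ((hlim.eventually_lt_const (show (0 : ℝ≥0∞) < 2⁻¹ by simp)).and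
    (Filter.eventually_gt_atTop 0)).exists
  refine ⟨l, hl0, ?_⟩
  filter_upwards [hB] with ξ hξ
  have hw : Measurable fun x : ℝ => ENNReal.ofReal (Real.exp (-l * x)) := by fun_prop
  have hexp : (∫⁻ x, (Set.Ici ξ).indicator (fun x => ENNReal.ofReal (Real.exp (-l * x))) x ^ q ∂μ)
      ≤ ENNReal.ofReal (Real.exp (-l * ξ)) ^ q * ENNReal.ofReal (1 / (l * q)) := by
    have hneg : -(l * q) < 0 := by nlinarith [mul_pos hl0 hq]
    have hpow : ∀ x, ENNReal.ofReal (Real.exp (-l * x)) ^ q =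
        ENNReal.ofReal (Real.exp (-(l * q) * x)) := fun x => by
      rw [ENNReal.ofReal_rpow_of_pos (Real.exp_pos _), ← Real.exp_mul]
      ring_nf
    calc _ = ∫⁻ x, (Set.Ici ξ).indicator
          (fun x => ENNReal.ofReal (Real.exp (-(l * q) * x))) x ∂μ := by
          refine lintegral_congr fun x => ?_
          by_cases hx : x ∈ Set.Ici ξ
          · simp only [Set.indicator_of_mem hx, hpow]
          · simp only [Set.indicator_of_notMem hx, ENNReal.zero_rpow_of_pos hq]
      _ ≤ ∫⁻ x, (Set.Ici ξ).indicator
          (fun x => ENNReal.ofReal (Real.exp (-(l * q) * x))) x := lintegral_mono' hμ le_rfl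
      _ = ENNReal.ofReal (Real.exp (-l * ξ)) ^ q * ENNReal.ofReal (1 / (l * q)) := by
          rw [lintegral_indicator measurableSet_Ici, setLIntegral_congr Ioi_ae_eq_Ici.symm,
            ← ofReal_integral_eq_lintegral_ofReal (integrableOn_exp_mul_Ioi hneg ξ)
              (Filter.Eventually.of_forall fun x => (Real.exp_pos _).le),
            integral_exp_mul_Ioi hneg, hpow, ← ENNReal.ofReal_mul (Real.exp_pos _).le]
          congr 1
          field_simp
  calc ∫⁻ x, ENNReal.ofReal (Real.exp (-l * x)) * ‖N x ξ‖ₑ ∂μ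
      = ∫⁻ x, ((Set.Ici ξ).indicator (fun x => ENNReal.ofReal (Real.exp (-l * x))) *
          fun x => ‖N x ξ‖ₑ) x ∂μ := by
        refine lintegral_congr fun x => ?_
        by_cases hx : x ∈ Set.Ici ξ
        · simp only [Pi.mul_apply, Set.indicator_of_mem hx]
        · simp [hN0 x ξ (by simpa using hx)]
    _ ≤ _ := ENNReal.lintegral_mul_le_Lp_mul_Lq μ hpq.symm
        (hw.indicator measurableSet_Ici).aemeasurable (hN.of_uncurry_right).enorm.aemeasurable
    _ ≤ (ENNReal.ofReal (Real.exp (-l * ξ)) ^ q * ENNReal.ofReal (1 / (l * q))) ^ (1 / q) *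
          B ^ (1 / p) := by
        gcongr
    _ = ENNReal.ofReal (1 / (l * q)) ^ (1 / q) * B ^ (1 / p) *
          ENNReal.ofReal (Real.exp (-l * ξ)) := by
        rw [ENNReal.mul_rpow_of_nonneg _ _ (by positivity), ← ENNReal.rpow_mul,
          mul_one_div_cancel hq.ne', ENNReal.rpow_one]
        ring
    _ ≤ 2⁻¹ * ENNReal.ofReal (Real.exp (-l * ξ)) := by gcongr

/-- Hölder's inequality on a probability space, with both exponents equal to `p ≥ 2`. -/
lemma lintegral_mul_rpow_le {α : Type*} [MeasurableSpace α] {μ : Measure α}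
    [IsProbabilityMeasure μ] {p : ℝ} (hp : 2 ≤ p) {u v : α → ℝ≥0∞} (hu : AEMeasurable u μ)
    (hv : AEMeasurable v μ) :
    (∫⁻ x, u x * v x ∂μ) ^ p ≤ (∫⁻ x, u x ^ p ∂μ) * ∫⁻ x, v x ^ p ∂μ := by
  have hp0 : 0 < p := by linarith
  have hpq : p.HolderConjugate p.conjExponent := .conjExponent (by linarith)
  have hqp : p.conjExponent ≤ p := by
    rw [Real.conjExponent, div_le_iff₀ (by linarith)]
    nlinarith
  have hmono : (∫⁻ x, u x ^ p.conjExponent ∂μ) ^ (1 / p.conjExponent) ≤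
      (∫⁻ x, u x ^ p ∂μ) ^ (1 / p) := by
    simpa [eLpNorm'] using
      eLpNorm'_le_eLpNorm'_of_exponent_le hpq.symm.pos hqp μ hu.aestronglyMeasurable
  calc (∫⁻ x, u x * v x ∂μ) ^ p
      ≤ ((∫⁻ x, u x ^ p ∂μ) ^ (1 / p) * (∫⁻ x, v x ^ p ∂μ) ^ (1 / p)) ^ p := by
        gcongr
        refine (ENNReal.lintegral_mul_le_Lp_mul_Lq μ hpq.symm hu hv).trans ?_
        gcongr
    _ = _ := by
        rw [ENNReal.mul_rpow_of_nonneg _ _ hp0.le, ← ENNReal.rpow_mul, ← ENNReal.rpow_mul,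
          one_div_mul_cancel hp0.ne', ENNReal.rpow_one, ENNReal.rpow_one]

/-- The constant of an exponential bound improves by a fixed factor towards `a`. -/
lemma gronwall_improve {f : ℝ → ℝ≥0∞} {a K : ℝ} (ha : 0 ≤ a) (hK : a ≤ K)
    (hf : ∀ᵐ t ∂volume.restrict (Set.Icc (0 : ℝ) 1),
      f t ≤ ENNReal.ofReal a * (1 + ∫⁻ ξ in Set.Icc t 1, f ξ))
    (hfK : ∀ᵐ t ∂volume.restrict (Set.Icc (0 : ℝ) 1),
      f t ≤ ENNReal.ofReal (K * Real.exp (a * (1 - t)))) :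
    ∀ᵐ t ∂volume.restrict (Set.Icc (0 : ℝ) 1),
      f t ≤ ENNReal.ofReal ((a + (K - a) * (1 - Real.exp (-a))) * Real.exp (a * (1 - t))) := by
  filter_upwards [hf, ae_restrict_mem measurableSet_Icc] with t ht ht01
  have hcont : Continuous fun s => K * Real.exp (a * (1 - s)) := by fun_prop
  have hint : ∫⁻ ξ in Set.Icc t 1, f ξ ≤
      ENNReal.ofReal (∫ s in t..1, K * Real.exp (a * (1 - s))) := by
    rw [intervalIntegral.integral_of_le ht01.2, ← integral_Icc_eq_integral_Ioc,
      ofReal_integral_eq_lintegral_ofReal (hcont.integrableOn_Icc)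
        (Filter.Eventually.of_forall fun s => mul_nonneg (ha.trans hK) (Real.exp_pos _).le)]
    exact lintegral_mono_ae (ae_restrict_of_ae_restrict_of_subset
      (Set.Icc_subset_Icc_left ht01.1) hfK)
  have hval : a * ∫ s in t..1, K * Real.exp (a * (1 - s)) =
      K * (Real.exp (a * (1 - t)) - 1) := by
    rw [← intervalIntegral.integral_const_mul,
      intervalIntegral.integral_eq_sub_of_hasDerivAt (f := fun s => -K * Real.exp (a * (1 - s)))
        (fun s _ => ?_) (Continuous.intervalIntegrable (by fun_prop) _ _)]
    · simp only [sub_self, mul_zero, Real.exp_zero]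
      ring
    · exact ((((hasDerivAt_id s).const_sub 1).const_mul a).exp.const_mul (-K)).congr_deriv
        (by simp only [id]; ring)
  have hnn : 0 ≤ ∫ s in t..1, K * Real.exp (a * (1 - s)) :=
    intervalIntegral.integral_nonneg ht01.2 fun s _ =>
      mul_nonneg (ha.trans hK) (Real.exp_pos _).le
  refine ht.trans ((mul_le_mul_right (add_le_add_right hint 1) _).trans ?_)
  rw [← ENNReal.ofReal_one, ← ENNReal.ofReal_add zero_le_one hnn, ← ENNReal.ofReal_mul ha]
  refine ENNReal.ofReal_le_ofReal ?_
  have hexp : Real.exp (-a) * Real.exp (a * (1 - t)) ≤ 1 := by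
    rw [← Real.exp_add, Real.exp_le_one_iff]
    nlinarith [mul_nonneg ha ht01.1]
  nlinarith [mul_le_mul_of_nonneg_left hexp (sub_nonneg.2 hK)]

/-- Backward Grönwall inequality for essentially bounded functions on `[0, 1]`. -/
lemma gronwall_ae {f : ℝ → ℝ≥0∞} {a : ℝ} {M : ℝ≥0∞} (ha : 0 ≤ a) (hM : M ≠ ⊤)
    (hf : ∀ᵐ t ∂volume.restrict (Set.Icc (0 : ℝ) 1),
      f t ≤ ENNReal.ofReal a * (1 + ∫⁻ ξ in Set.Icc t 1, f ξ))
    (hfM : ∀ᵐ t ∂volume.restrict (Set.Icc (0 : ℝ) 1), f t ≤ M) :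
    ∀ᵐ t ∂volume.restrict (Set.Icc (0 : ℝ) 1), f t ≤ ENNReal.ofReal (a * Real.exp a) := by
  have hq0 : 0 ≤ 1 - Real.exp (-a) := by simpa using ha
  have hq1 : 1 - Real.exp (-a) < 1 := by simp [Real.exp_pos]
  have hiter : ∀ n : ℕ, ∀ᵐ t ∂volume.restrict (Set.Icc (0 : ℝ) 1), f t ≤
      ENNReal.ofReal ((a + M.toReal * (1 - Real.exp (-a)) ^ n) * Real.exp (a * (1 - t))) := by
    intro n
    induction n with
    | zero =>
      filter_upwards [hfM, ae_restrict_mem measurableSet_Icc] with t ht ht01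
      refine ht.trans ((ENNReal.ofReal_toReal hM).symm.le.trans (ENNReal.ofReal_le_ofReal ?_))
      have h1 : 1 ≤ Real.exp (a * (1 - t)) :=
        Real.one_le_exp (mul_nonneg ha (sub_nonneg.2 ht01.2))
      nlinarith [mul_nonneg ha (Real.exp_pos (a * (1 - t))).le,
        mul_le_mul_of_nonneg_left h1 (ENNReal.toReal_nonneg (a := M))]
    | succ n ih =>
      refine (gronwall_improve ha ?_ hf ih).mono fun t ht => ht.trans (le_of_eq ?_)
      · exact le_add_of_nonneg_right (mul_nonneg ENNReal.toReal_nonneg (pow_nonneg hq0 n))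
      · ring_nf
  filter_upwards [ae_all_iff.2 hiter, ae_restrict_mem measurableSet_Icc] with t ht ht01
  have hlim : Filter.Tendsto (fun n : ℕ => ENNReal.ofReal
      ((a + M.toReal * (1 - Real.exp (-a)) ^ n) * Real.exp (a * (1 - t)))) Filter.atTop
      (nhds (ENNReal.ofReal ((a + M.toReal * 0) * Real.exp (a * (1 - t))))) :=
    ENNReal.tendsto_ofReal ((((tendsto_pow_atTop_nhds_zero_of_lt_one hq0 hq1).const_mul _).const_add
      _).mul_const _)
  refine (ge_of_tendsto' hlim ht).trans (ENNReal.ofReal_le_ofReal ?_)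
  rw [mul_zero, add_zero]
  gcongr
  nlinarith [mul_nonneg ha ht01.1]

lemma Icc_eq_Ici_inter_Icc_zero_one {t : ℝ} (ht : 0 ≤ t) :
    Set.Icc t 1 = Set.Ici t ∩ Set.Icc 0 1 := by
  rw [← Set.Ici_inter_Iic, ← Set.Ici_inter_Iic, ← Set.inter_assoc, Set.Ici_inter_Ici,
    sup_eq_left.2 ht]

/-- The resolvent bound for Volterra kernels on `[0, 1]` whose columns are bounded in `L^p`. -/
lemma ae_lintegral_resolvent_le {p : ℝ} (hp : 2 ≤ p) {N S : ℝ → ℝ → ℂ}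
    (hN : Measurable (Function.uncurry N)) (hS : Measurable (Function.uncurry S))
    (hN0 : ∀ x t, x < t → N x t = 0) {B M : ℝ≥0∞} (hBt : B ≠ ⊤) (hMt : M ≠ ⊤)
    (hB : ∀ᵐ t ∂volume.restrict (Set.Icc (0 : ℝ) 1),
      ∫⁻ x in Set.Icc 0 1, ‖N x t‖ₑ ^ p ≤ B)
    (hM : ∀ᵐ t ∂volume.restrict (Set.Icc (0 : ℝ) 1),
      ∫⁻ x in Set.Icc 0 1, ‖S x t‖ₑ ^ p ≤ M)
    (h : ∀ᵐ x ∂volume.restrict (Set.Icc (0 : ℝ) 1), ∀ᵐ t ∂volume.restrict (Set.Icc (0 : ℝ) 1),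
      N x t + S x t + ∫ ξ in Set.Icc 0 1, N x ξ * S ξ t = 0) :
    ∀ᵐ t ∂volume.restrict (Set.Icc (0 : ℝ) 1), ∫⁻ x in Set.Icc 0 1, ‖S x t‖ₑ ^ p ≤
      ENNReal.ofReal (2 ^ (p - 1) * B.toReal * Real.exp (2 ^ (p - 1) * B.toReal)) := by
  set μ : Measure ℝ := volume.restrict (Set.Icc (0 : ℝ) 1) with hμ
  have : IsProbabilityMeasure μ := ⟨by simp [hμ]⟩
  have hp0 : 0 < p := by linarith
  have hL1 : ∀ {A : ℝ → ℝ → ℂ} {C : ℝ≥0∞}, Measurable (Function.uncurry A) →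
      (∀ᵐ t ∂μ, ∫⁻ x, ‖A x t‖ₑ ^ p ∂μ ≤ C) → ∀ᵐ t ∂μ, ∫⁻ x, ‖A x t‖ₑ ∂μ ≤ C ^ (1 / p) := by
    intro A C hA hC
    filter_upwards [hC] with t ht
    have := lintegral_mul_rpow_le hp (μ := μ) (hA.of_uncurry_right (y := t)).enorm.aemeasurable
      (aemeasurable_const (b := (1 : ℝ≥0∞)))
    simp only [mul_one, ENNReal.one_rpow, lintegral_const, measure_univ] at this
    rw [one_div, ENNReal.le_rpow_inv_iff hp0]
    exact this.trans ht
  have hroot : ∀ {C : ℝ≥0∞}, C ≠ ⊤ → C ^ (1 / p) ≠ ⊤ := fun hC =>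
    ENNReal.rpow_ne_top_of_nonneg (one_div_nonneg.2 hp0.le) hC
  obtain ⟨l, hl0, hl⟩ := exists_exp_weight_kernel_le (μ := μ) Measure.restrict_le_self
    (.conjExponent (by linarith)) hN hN0 hBt hB
  have hcomm := resolvent_comm hN hS (hroot hBt) (hroot hMt) (hL1 hN hB) (hL1 hS hM)
    (fun r hr hrt hrN => ae_eq_zero_of_add_kernelOp_eq_zero (by fun_prop)
      (fun x => by simp [Real.exp_pos]) (by
        filter_upwards [ae_restrict_mem measurableSet_Icc] with x hx
        rw [← ENNReal.ofReal_one]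
        refine ENNReal.ofReal_le_ofReal (Real.exp_le_one_iff.2 ?_)
        nlinarith [hx.1]) hN hl hr hrt hrN) h
  have ha : 0 ≤ 2 ^ (p - 1) * B.toReal := by positivity
  refine gronwall_ae ha hMt ?_ hM
  have haB : ENNReal.ofReal (2 ^ (p - 1) * B.toReal) = 2 ^ (p - 1) * B := by
    rw [ENNReal.ofReal_mul (by positivity), ENNReal.ofReal_toReal hBt,
      ← ENNReal.ofReal_rpow_of_pos two_pos, ENNReal.ofReal_ofNat]
  filter_upwards [hcomm, hB, ae_restrict_mem measurableSet_Icc] with t ht hBt' ht01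
  have hsub := Icc_eq_Ici_inter_Icc_zero_one ht01.1
  have hNt : Measurable fun ξ => ‖N ξ t‖ₑ := hN.of_uncurry_right.enorm
  have hSm : Measurable fun z : ℝ × ℝ => ‖S z.1 z.2‖ₑ ^ p := hS.enorm.pow_const p
  have hprod : ∀ x, (∫⁻ ξ, ‖S x ξ‖ₑ * ‖N ξ t‖ₑ ∂μ) ^ p ≤
      B * ∫⁻ ξ in Set.Icc t 1, ‖S x ξ‖ₑ ^ p := by
    intro x
    have hSx : Measurable fun ξ => ‖S x ξ‖ₑ := hS.of_uncurry_left.enorm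
    calc (∫⁻ ξ, ‖S x ξ‖ₑ * ‖N ξ t‖ₑ ∂μ) ^ p
        = (∫⁻ ξ, (Set.Ici t).indicator (fun ξ => ‖S x ξ‖ₑ) ξ * ‖N ξ t‖ₑ ∂μ) ^ p := by
          congr 1
          refine lintegral_congr fun ξ => ?_
          by_cases hξ : ξ ∈ Set.Ici t
          · rw [Set.indicator_of_mem hξ]
          · simp [hN0 ξ t (by simpa using hξ)]
      _ ≤ (∫⁻ ξ, (Set.Ici t).indicator (fun ξ => ‖S x ξ‖ₑ) ξ ^ p ∂μ) *
            ∫⁻ ξ, ‖N ξ t‖ₑ ^ p ∂μ :=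
          lintegral_mul_rpow_le hp (hSx.indicator measurableSet_Ici).aemeasurable
            hNt.aemeasurable
      _ ≤ (∫⁻ ξ, (Set.Ici t).indicator (fun ξ => ‖S x ξ‖ₑ ^ p) ξ ∂μ) * B := by
          gcongr with ξ
          by_cases hξ : ξ ∈ Set.Ici t
          · simp only [Set.indicator_of_mem hξ, le_refl]
          · simp only [Set.indicator_of_notMem hξ, ENNReal.zero_rpow_of_pos hp0, le_refl]
      _ = B * ∫⁻ ξ in Set.Icc t 1, ‖S x ξ‖ₑ ^ p := by
          rw [lintegral_indicator measurableSet_Ici, hμ,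
            Measure.restrict_restrict measurableSet_Ici, ← hsub, mul_comm]
  have hpt : ∀ᵐ x ∂μ, ‖S x t‖ₑ ^ p ≤
      2 ^ (p - 1) * (‖N x t‖ₑ ^ p + B * ∫⁻ ξ in Set.Icc t 1, ‖S x ξ‖ₑ ^ p) := by
    filter_upwards [ht] with x hx
    have hSx : S x t = -(N x t + kernelOp μ S (fun ξ => N ξ t) x) := by
      linear_combination hx
    calc ‖S x t‖ₑ ^ p
        ≤ (‖N x t‖ₑ + ∫⁻ ξ, ‖S x ξ‖ₑ * ‖N ξ t‖ₑ ∂μ) ^ p := by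
          rw [hSx, enorm_neg]
          gcongr
          exact (enorm_add_le _ _).trans (by gcongr; exact enorm_kernelOp_le _ _ _)
      _ ≤ _ := ENNReal.rpow_add_le_mul_rpow_add_rpow _ _ (by linarith)
      _ ≤ _ := by
          gcongr
          exact hprod x
  have h2 : (2 : ℝ≥0∞) ^ (p - 1) ≠ ⊤ :=
    ENNReal.rpow_ne_top_of_nonneg (by linarith) ENNReal.ofNat_ne_top
  calc ∫⁻ x, ‖S x t‖ₑ ^ p ∂μ
      ≤ ∫⁻ x, 2 ^ (p - 1) * (‖N x t‖ₑ ^ p + B * ∫⁻ ξ in Set.Icc t 1, ‖S x ξ‖ₑ ^ p) ∂μ :=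
        lintegral_mono_ae hpt
    _ = 2 ^ (p - 1) * (∫⁻ x, ‖N x t‖ₑ ^ p ∂μ +
          B * ∫⁻ x, (∫⁻ ξ in Set.Icc t 1, ‖S x ξ‖ₑ ^ p) ∂μ) := by
        rw [lintegral_const_mul' _ _ h2, lintegral_add_left (hNt.pow_const p),
          lintegral_const_mul' _ _ hBt]
    _ = 2 ^ (p - 1) * (∫⁻ x, ‖N x t‖ₑ ^ p ∂μ +
          B * ∫⁻ ξ in Set.Icc t 1, ∫⁻ x, ‖S x ξ‖ₑ ^ p ∂μ) := by
        rw [lintegral_lintegral_swap hSm.aemeasurable]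
    _ ≤ 2 ^ (p - 1) * (B + B * ∫⁻ ξ in Set.Icc t 1, ∫⁻ x, ‖S x ξ‖ₑ ^ p ∂μ) := by gcongr
    _ = _ := by
        rw [haB]
        ring

/-- Extension by zero of a kernel from the triangle `t ≤ x`. -/
noncomputable def lowerTriangle (f : ℝ → ℝ → ℂ) (x t : ℝ) : ℂ :=
  if t ≤ x then f x t else 0

lemma measurable_lowerTriangle {f : ℝ → ℝ → ℂ} (hf : Measurable (Function.uncurry f)) :
    Measurable (Function.uncurry (lowerTriangle f)) :=
  Measurable.ite (measurableSet_le measurable_snd measurable_fst) hf measurable_const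

lemma X1pNorm_eq {p : ℝ} (hp : 0 < p) (f : ℝ → ℝ → ℂ) :
    X1pNorm p f = (essSup (fun t => ∫⁻ x in Set.Icc 0 1, ‖lowerTriangle f x t‖ₑ ^ p)
      (volume.restrict (Set.Icc (0 : ℝ) 1))) ^ (1 / p) := by
  rw [X1pNorm]
  congr 1
  refine essSup_congr_ae ?_
  filter_upwards [ae_restrict_mem measurableSet_Icc] with t ht
  rw [Icc_eq_Ici_inter_Icc_zero_one ht.1, ← Measure.restrict_restrict measurableSet_Ici,
    ← lintegral_indicator measurableSet_Ici]
  refine lintegral_congr fun x => ?_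
  by_cases hx : t ≤ x
  · rw [Set.indicator_of_mem (Set.mem_Ici.2 hx), lowerTriangle, if_pos hx,
      ← ENNReal.ofReal_rpow_of_nonneg (norm_nonneg _) hp.le, ofReal_norm]
  · rw [Set.indicator_of_notMem (by simpa using hx), lowerTriangle, if_neg hx, enorm_zero,
      ENNReal.zero_rpow_of_pos hp]

lemma setIntegral_lowerTriangle {N S : ℝ → ℝ → ℂ} {x t : ℝ} (hx : x ≤ 1) (ht : 0 ≤ t)
    (htx : t ≤ x) :
    ∫ ξ in Set.Icc 0 1, lowerTriangle N x ξ * lowerTriangle S ξ t =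
      ∫ ξ in t..x, N x ξ * S ξ t := by
  have hind : (fun ξ => lowerTriangle N x ξ * lowerTriangle S ξ t) =
      (Set.Icc t x).indicator fun ξ => N x ξ * S ξ t := by
    funext ξ
    by_cases h1 : t ≤ ξ <;> by_cases h2 : ξ ≤ x <;>
      simp [lowerTriangle, Set.indicator, h1, h2]
  rw [hind, setIntegral_indicator measurableSet_Icc,
    Set.inter_eq_right.2 (Set.Icc_subset_Icc ht hx), integral_Icc_eq_integral_Ioc,
    intervalIntegral.integral_of_le htx]

lemma ae_lowerTriangle_resolvent {N S : ℝ → ℝ → ℂ}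
    (heq : ∀ᵐ q : ℝ × ℝ ∂volume, (0 ≤ q.2 ∧ q.2 ≤ q.1 ∧ q.1 ≤ 1) →
      N q.1 q.2 + S q.1 q.2 + ∫ ξ in q.2..q.1, N q.1 ξ * S ξ q.2 = 0) :
    ∀ᵐ x ∂volume.restrict (Set.Icc (0 : ℝ) 1), ∀ᵐ t ∂volume.restrict (Set.Icc (0 : ℝ) 1),
      lowerTriangle N x t + lowerTriangle S x t +
        ∫ ξ in Set.Icc 0 1, lowerTriangle N x ξ * lowerTriangle S ξ t = 0 := by
  rw [Measure.volume_eq_prod] at heq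
  filter_upwards [ae_restrict_of_ae (Measure.ae_ae_of_ae_prod heq),
    ae_restrict_mem measurableSet_Icc] with x hx hx01
  filter_upwards [ae_restrict_of_ae hx, ae_restrict_mem measurableSet_Icc] with t ht ht01
  by_cases htx : t ≤ x
  · rw [setIntegral_lowerTriangle hx01.2 ht01.1 htx, lowerTriangle, lowerTriangle, if_pos htx,
      if_pos htx]
    exact ht ⟨ht01.1, htx, hx01.2⟩
  · have hzero : ∀ ξ, lowerTriangle N x ξ * lowerTriangle S ξ t = 0 := fun ξ => by
      by_cases h1 : t ≤ ξ
      · have h2 : ¬ξ ≤ x := fun h2 => htx (h1.trans h2)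
        simp [lowerTriangle, h2]
      · simp [lowerTriangle, h1]
    simp only [hzero, integral_zero]
    simp [lowerTriangle, htx]

/-- If `N, S` have finite `X_{1,p}`-norms, `p ∈ [2,∞)`, and satisfy the resolvent-kernel
equation `N + S + N*S = 0` a.e. on the triangle, then
`‖S‖ ≤ 2^{1-1/p} ‖N‖ exp(p⁻¹ 2^{p-1} ‖N‖^p)`. -/
theorem stmt11 (p : ℝ) (hp : 2 ≤ p) (N S : ℝ → ℝ → ℂ)
    (hmN : Measurable (Function.uncurry N)) (hmS : Measurable (Function.uncurry S))
    (hNfin : X1pNorm p N ≠ ⊤) (hSfin : X1pNorm p S ≠ ⊤)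
    (heq : ∀ᵐ q : ℝ × ℝ ∂volume, (0 ≤ q.2 ∧ q.2 ≤ q.1 ∧ q.1 ≤ 1) →
      N q.1 q.2 + S q.1 q.2 + ∫ ξ in q.2..q.1, N q.1 ξ * S ξ q.2 = 0) :
    (X1pNorm p S).toReal ≤
      2 ^ (1 - 1 / p) * (X1pNorm p N).toReal *
        Real.exp (p⁻¹ * 2 ^ (p - 1) * (X1pNorm p N).toReal ^ p) := by

  have hp0 : 0 < p := by linarith
  rw [X1pNorm_eq hp0] at hNfin hSfin
  rw [X1pNorm_eq hp0 N, X1pNorm_eq hp0 S]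
  set B := essSup (fun t => ∫⁻ x in Set.Icc 0 1, ‖lowerTriangle N x t‖ₑ ^ p)
    (volume.restrict (Set.Icc (0 : ℝ) 1))
  set M := essSup (fun t => ∫⁻ x in Set.Icc 0 1, ‖lowerTriangle S x t‖ₑ ^ p)
    (volume.restrict (Set.Icc (0 : ℝ) 1))
  have hroot : ∀ {C : ℝ≥0∞}, C ^ (1 / p) ≠ ⊤ → C ≠ ⊤ := by
    rintro C hC rfl
    exact hC (ENNReal.top_rpow_of_pos (by positivity))
  have hMle : M ≤ ENNReal.ofReal
      (2 ^ (p - 1) * B.toReal * Real.exp (2 ^ (p - 1) * B.toReal)) :=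
    essSup_le_of_ae_le _ <| ae_lintegral_resolvent_le hp (measurable_lowerTriangle hmN)
      (measurable_lowerTriangle hmS) (fun x t hxt => if_neg hxt.not_ge) (hroot hNfin)
      (hroot hSfin) (ENNReal.ae_le_essSup _) (ENNReal.ae_le_essSup _)
      (ae_lowerTriangle_resolvent heq)
  have hMle' := ENNReal.toReal_le_of_le_ofReal (by positivity) hMle
  have hBp : (B ^ (1 / p)).toReal ^ p = B.toReal := by
    rw [← ENNReal.toReal_rpow, ← Real.rpow_mul ENNReal.toReal_nonneg,
      one_div_mul_cancel hp0.ne', Real.rpow_one]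
  rw [hBp, ← ENNReal.toReal_rpow, ← ENNReal.toReal_rpow]
  calc M.toReal ^ (1 / p)
      ≤ (2 ^ (p - 1) * B.toReal * Real.exp (2 ^ (p - 1) * B.toReal)) ^ (1 / p) := by gcongr
    _ = _ := by
        have h1 : (p - 1) * (1 / p) = 1 - 1 / p := by field_simp
        have h2 : 2 ^ (p - 1) * B.toReal * (1 / p) = p⁻¹ * 2 ^ (p - 1) * B.toReal := by ring
        rw [Real.mul_rpow (by positivity) (Real.exp_pos _).le,
          Real.mul_rpow (by positivity) ENNReal.toReal_nonneg, ← Real.rpow_mul two_pos.le,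
          ← Real.exp_mul, h1, h2]
end

section
/- Let p ∈ [2,∞), r > 0, and let N, S and Ñ, S̃ be measurable complex-valued functions on the triangle Ω = {(x,t) : 0 ≤ t ≤ x ≤ 1}, all with finite X_{1,p}-norm, satisfying the resolvent-kernel equations N(x,t) + S(x,t) + ∫_t^x N(x,ξ) S(ξ,t) dξ = 0 and Ñ(x,t) + S̃(x,t) + ∫_t^x Ñ(x,ξ) S̃(ξ,t) dξ = 0 for almost all (x,t) ∈ Ω, with ‖N‖_{X_{1,p}} ≤ r and ‖Ñ‖_{X_{1,p}} ≤ r. Then ‖S − S̃‖_{X_{1,p}} ≤ 3^{1−1/p} exp( p⁻¹ 3^p r^p ) · ‖N − Ñ‖_{X_{1,p}}. -/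
open MeasureTheory
open scoped ENNReal

theorem le_mul_exp_of_sub_le_mul_sub {ψ A : ℝ → ℝ} {a b : ℝ} (hab : a ≤ b)
    (hψ : ContinuousOn ψ (Set.Icc a b)) (hA : ContinuousOn A (Set.Icc a b))
    (hψm : MonotoneOn ψ (Set.Icc a b)) (hAm : MonotoneOn A (Set.Icc a b)) (hpos : 0 < ψ a)
    (h : ∀ s ∈ Set.Icc a b, ∀ x ∈ Set.Icc a b, s ≤ x → ψ x - ψ s ≤ ψ x * (A x - A s)) :
    ψ b ≤ ψ a * Real.exp (A b - A a) := by
  have ha : a ∈ Set.Icc a b := Set.left_mem_Icc.2 hab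
  have hb : b ∈ Set.Icc a b := Set.right_mem_Icc.2 hab
  have hp : ∀ x ∈ Set.Icc a b, 0 < ψ x := fun x hx => hpos.trans_le (hψm ha hx hx.1)
  have key : ∀ ε > 0, Real.log (ψ b) - Real.log (ψ a) ≤ (1 + ε) * (A b - A a) := by
    intro ε hε
    have hsub : Set.Icc a b ⊆
        {x | Real.log (ψ x) - Real.log (ψ a) ≤ (1 + ε) * (A x - A a)} := by
      apply IsClosed.Icc_subset_of_forall_mem_nhdsWithin
      · rw [Set.inter_comm]
        exact isClosed_Icc.isClosed_le
          ((hψ.log fun x hx => (hp x hx).ne').sub continuousOn_const)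
          (continuousOn_const.mul (hA.sub continuousOn_const))
      · simp
      · rintro s ⟨hs, hsab⟩
        have hsI : s ∈ Set.Icc a b := Set.Ico_subset_Icc_self hsab
        have hev : ∀ᶠ x in nhdsWithin s (Set.Ioi s), x ∈ Set.Icc a b := by
          filter_upwards [Ioc_mem_nhdsGT hsab.2] with x hx
          exact ⟨hsab.1.trans hx.1.le, hx.2⟩
        have hcont : Filter.Tendsto ψ (nhdsWithin s (Set.Ioi s)) (nhds (ψ s)) := by
          refine (hψ s hsI).mono_left ?_
          exact nhdsWithin_le_iff.2 hev
        have hlt : ψ s < (1 + ε) * ψ s := by nlinarith [hp s hsI]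
        filter_upwards [hev, hcont.eventually_lt_const hlt, self_mem_nhdsWithin] with x hx hxs hsx
        have h1 := h s hsI x hx (le_of_lt hsx)
        have h2 := hAm hsI hx (le_of_lt hsx)
        have hps := hp s hsI
        have h3 : Real.log (ψ x) - Real.log (ψ s) ≤ (1 + ε) * (A x - A s) := by
          rw [← Real.log_div (hp x hx).ne' hps.ne']
          refine (Real.log_le_sub_one_of_pos (div_pos (hp x hx) hps)).trans ?_
          rw [div_sub_one hps.ne', div_le_iff₀ hps]
          nlinarith
        simp only [Set.mem_ofPred_eq] at hs ⊢
        linarith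
    exact hsub hb
  have key' : Real.log (ψ b) - Real.log (ψ a) ≤ A b - A a := by
    have ht : Filter.Tendsto (fun ε : ℝ => (1 + ε) * (A b - A a)) (nhdsWithin 0 (Set.Ioi 0))
        (nhds ((1 + 0) * (A b - A a))) := by
      apply Filter.Tendsto.mono_left _ nhdsWithin_le_nhds
      exact Continuous.tendsto (by fun_prop) 0
    rw [add_zero, one_mul] at ht
    refine ge_of_tendsto ht ?_
    filter_upwards [self_mem_nhdsWithin] with ε hε using key ε hε
  rw [← Real.log_div (hp b hb).ne' hpos.ne', Real.log_le_iff_le_exp (div_pos (hp b hb) hpos),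
    div_le_iff₀ hpos] at key'
  linarith

theorem setLIntegral_Icc_add_Ioc (h : ℝ → ℝ≥0∞) {t s x : ℝ} (hts : t ≤ s) (hsx : s ≤ x) :
    ∫⁻ y in Set.Icc t x, h y = (∫⁻ y in Set.Icc t s, h y) + ∫⁻ y in Set.Ioc s x, h y := by
  rw [← lintegral_union measurableSet_Ioc, Set.Icc_union_Ioc_eq_Icc hts hsx]
  exact Set.disjoint_left.2 fun y hy hy' => absurd hy.2 (not_le.2 hy'.1)

theorem continuousOn_toReal_setLIntegral_Icc {h : ℝ → ℝ≥0∞} (hm : Measurable h) {t b : ℝ}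
    (hfin : ∫⁻ y in Set.Icc t b, h y ≠ ⊤) :
    ContinuousOn (fun x => (∫⁻ y in Set.Icc t x, h y).toReal) (Set.Icc t b) := by
  have h1 : IntegrableOn (fun y => (h y).toReal) (Set.Icc t b) :=
    integrable_toReal_of_lintegral_ne_top hm.aemeasurable hfin
  refine (intervalIntegral.continuousOn_primitive_Icc h1).congr fun x hx => ?_
  refine (integral_toReal hm.aemeasurable ?_).symm
  refine ae_lt_top hm (ne_top_of_le_ne_top hfin ?_)
  exact lintegral_mono_set (Set.Icc_subset_Icc_right hx.2)

theorem setLIntegral_le_mul_exp_of_le_add_mul {u F a : ℝ → ℝ≥0∞}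
    (ha : Measurable a) {t b : ℝ} (htb : t ≤ b) {K : ℝ≥0∞} {R : ℝ} (hR : 0 ≤ R)
    (hufin : ∫⁻ x in Set.Icc t b, u x ≠ ⊤) (hF : Measurable F)
    (hFK : ∫⁻ x in Set.Icc t b, F x ≤ K)
    (haR : ∫⁻ x in Set.Icc t b, a x ≤ ENNReal.ofReal R)
    (h : ∀ᵐ x ∂volume.restrict (Set.Icc t b),
      u x ≤ F x + a x * ∫⁻ y in Set.Icc t x, u y) :
    ∫⁻ x in Set.Icc t b, u x ≤ K * ENNReal.ofReal (Real.exp R) := by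
  rcases eq_or_ne K ⊤ with rfl | hK
  · rw [ENNReal.top_mul (by simpa using Real.exp_pos R)]
    exact le_top
  set Φ : ℝ → ℝ≥0∞ := fun x => ∫⁻ y in Set.Icc t x, u y with hΦ
  have hΦmono : Monotone Φ := fun x y hxy => lintegral_mono_set (Set.Icc_subset_Icc_right hxy)
  have hm : Measurable fun x => a x * Φ x := ha.mul hΦmono.measurable
  have hafin : ∫⁻ x in Set.Icc t b, a x ≠ ⊤ := ne_top_of_le_ne_top ENNReal.ofReal_ne_top haR
  have hIoc : ∀ s x, ∫⁻ y in Set.Ioc s x, a y * Φ y ≤ Φ x * ∫⁻ y in Set.Ioc s x, a y := by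
    intro s x
    rw [← lintegral_const_mul _ ha]
    refine setLIntegral_mono' measurableSet_Ioc fun y hy => ?_
    rw [mul_comm]
    gcongr
    exact hΦmono hy.2
  have hnull : ∀ f : ℝ → ℝ≥0∞, ∫⁻ y in Set.Icc t t, f y = 0 := fun f => by simp
  have hIfin : ∫⁻ y in Set.Icc t b, a y * Φ y ≠ ⊤ := by
    rw [setLIntegral_Icc_add_Ioc _ le_rfl htb, hnull, zero_add]
    refine ne_top_of_le_ne_top (ENNReal.mul_ne_top hufin hafin) ((hIoc t b).trans ?_)
    gcongr
    exact Set.Ioc_subset_Icc_self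
  have hfin : ∀ f : ℝ → ℝ≥0∞, ∫⁻ y in Set.Icc t b, f y ≠ ⊤ → ∀ x ∈ Set.Icc t b,
      ∫⁻ y in Set.Icc t x, f y ≠ ⊤ := fun f hf x hx =>
    ne_top_of_le_ne_top hf (lintegral_mono_set (Set.Icc_subset_Icc_right hx.2))
  have hfin' : ∀ f : ℝ → ℝ≥0∞, ∫⁻ y in Set.Icc t b, f y ≠ ⊤ → ∀ s ∈ Set.Icc t b,
      ∀ x ∈ Set.Icc t b, ∫⁻ y in Set.Ioc s x, f y ≠ ⊤ := fun f hf s hs x hx =>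
    ne_top_of_le_ne_top hf (lintegral_mono_set
      (Set.Ioc_subset_Icc_self.trans (Set.Icc_subset_Icc hs.1 hx.2)))
  have hsplit : ∀ f : ℝ → ℝ≥0∞, ∫⁻ y in Set.Icc t b, f y ≠ ⊤ → ∀ s ∈ Set.Icc t b,
      ∀ x ∈ Set.Icc t b, s ≤ x → (∫⁻ y in Set.Icc t x, f y).toReal =
        (∫⁻ y in Set.Icc t s, f y).toReal + (∫⁻ y in Set.Ioc s x, f y).toReal := by
    intro f hf s hs x hx hsx
    rw [setLIntegral_Icc_add_Ioc f hs.1 hsx,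
      ENNReal.toReal_add (hfin f hf s hs) (hfin' f hf s hs x hx)]
  have hmono : ∀ f : ℝ → ℝ≥0∞, ∫⁻ y in Set.Icc t b, f y ≠ ⊤ →
      MonotoneOn (fun x => (∫⁻ y in Set.Icc t x, f y).toReal) (Set.Icc t b) := by
    intro f hf s hs x hx hsx
    simp only [hsplit f hf s hs x hx hsx]
    linarith [ENNReal.toReal_nonneg (a := ∫⁻ y in Set.Ioc s x, f y)]
  have hΦle : ∀ x ∈ Set.Icc t b, Φ x ≤ K + ∫⁻ y in Set.Icc t x, a y * Φ y := by
    intro x hx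
    have hsub : Set.Icc t x ⊆ Set.Icc t b := Set.Icc_subset_Icc_right hx.2
    calc Φ x ≤ ∫⁻ y in Set.Icc t x, (F y + a y * Φ y) :=
          lintegral_mono_ae (ae_restrict_of_ae_restrict_of_subset hsub h)
      _ = (∫⁻ y in Set.Icc t x, F y) + ∫⁻ y in Set.Icc t x, a y * Φ y := lintegral_add_left hF _
      _ ≤ _ := by
          gcongr
          exact (lintegral_mono_set hsub).trans hFK
  have hbmem := Set.right_mem_Icc.2 htb
  have key : ∀ k > K.toReal, (Φ b).toReal ≤ k * Real.exp R := by
    intro k hk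
    have hΦψ : ∀ x ∈ Set.Icc t b,
        (Φ x).toReal ≤ k + (∫⁻ y in Set.Icc t x, a y * Φ y).toReal := by
      intro x hx
      have h1 := ENNReal.toReal_mono (ENNReal.add_ne_top.2 ⟨hK, hfin _ hIfin x hx⟩) (hΦle x hx)
      rw [ENNReal.toReal_add hK (hfin _ hIfin x hx)] at h1
      linarith
    have hmain := le_mul_exp_of_sub_le_mul_sub
      (ψ := fun x => k + (∫⁻ y in Set.Icc t x, a y * Φ y).toReal)
      (A := fun x => (∫⁻ y in Set.Icc t x, a y).toReal) htb
      (continuousOn_const.add (continuousOn_toReal_setLIntegral_Icc hm hIfin))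
      (continuousOn_toReal_setLIntegral_Icc ha hafin)
      (fun s hs x hx hsx => by simpa using hmono _ hIfin hs hx hsx)
      (hmono _ hafin)
      (by
        simp only [hnull]
        simpa using ENNReal.toReal_nonneg.trans_lt hk)
      (by
        intro s hs x hx hsx
        simp only [hsplit _ hIfin s hs x hx hsx, hsplit _ hafin s hs x hx hsx]
        have h1 := ENNReal.toReal_mono
          (ENNReal.mul_ne_top (hfin _ hufin x hx) (hfin' _ hafin s hs x hx)) (hIoc s x)
        rw [ENNReal.toReal_mul] at h1
        have h2 := hΦψ x hx
        rw [hsplit _ hIfin s hs x hx hsx] at h2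
        have h3 := mul_le_mul_of_nonneg_right h2
          (ENNReal.toReal_nonneg (a := ∫⁻ y in Set.Ioc s x, a y))
        linarith)
    simp only [hnull, ENNReal.toReal_zero, add_zero, sub_zero] at hmain
    refine (hΦψ b hbmem).trans (hmain.trans ?_)
    have hk0 : 0 ≤ k := ENNReal.toReal_nonneg.trans hk.le
    gcongr
    exact ENNReal.toReal_le_of_le_ofReal hR haR
  have hreal : (Φ b).toReal ≤ K.toReal * Real.exp R := by
    rw [← div_le_iff₀ (Real.exp_pos R)]
    refine le_of_forall_gt_imp_ge_of_dense fun k hk => ?_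
    rw [div_le_iff₀ (Real.exp_pos R)]
    exact key k hk
  calc Φ b = ENNReal.ofReal (Φ b).toReal := (ENNReal.ofReal_toReal hufin).symm
    _ ≤ ENNReal.ofReal (K.toReal * Real.exp R) := ENNReal.ofReal_le_ofReal hreal
    _ = K * ENNReal.ofReal (Real.exp R) := by
      rw [ENNReal.ofReal_mul ENNReal.toReal_nonneg, ENNReal.ofReal_toReal hK]

theorem setLIntegral_triangle_swap {F : ℝ → ℝ → ℝ≥0∞} (hF : Measurable (Function.uncurry F))
    (t b : ℝ) :
    ∫⁻ x in Set.Icc t b, ∫⁻ ξ in Set.Icc t x, F x ξ =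
      ∫⁻ ξ in Set.Icc t b, ∫⁻ x in Set.Icc ξ b, F x ξ := by
  have hT : MeasurableSet {q : ℝ × ℝ | t ≤ q.2 ∧ q.2 ≤ q.1 ∧ q.1 ≤ b} :=
    (measurableSet_le measurable_const measurable_snd).inter
      ((measurableSet_le measurable_snd measurable_fst).inter
        (measurableSet_le measurable_fst measurable_const))
  set G : ℝ → ℝ → ℝ≥0∞ := fun x ξ =>
    Set.indicator {q : ℝ × ℝ | t ≤ q.2 ∧ q.2 ≤ q.1 ∧ q.1 ≤ b} (Function.uncurry F) (x, ξ) with hG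
  have hGm : Measurable (Function.uncurry G) := hF.indicator hT
  have h1 : ∫⁻ x in Set.Icc t b, ∫⁻ ξ in Set.Icc t x, F x ξ = ∫⁻ x, ∫⁻ ξ, G x ξ := by
    rw [← lintegral_indicator measurableSet_Icc]
    refine lintegral_congr fun x => ?_
    by_cases hx : x ∈ Set.Icc t b
    · rw [Set.indicator_of_mem hx, ← lintegral_indicator measurableSet_Icc]
      refine lintegral_congr fun ξ => ?_
      simp only [hG, Set.indicator_apply, Set.mem_Icc, Set.mem_ofPred_eq, hx.2, and_true]
      rfl
    · rw [Set.indicator_of_notMem hx]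
      symm
      convert lintegral_zero with ξ
      simp only [hG]
      refine Set.indicator_of_notMem ?_ _
      rintro ⟨h1, h2, h3⟩
      exact hx ⟨h1.trans h2, h3⟩
  have h2 : ∫⁻ ξ in Set.Icc t b, ∫⁻ x in Set.Icc ξ b, F x ξ = ∫⁻ ξ, ∫⁻ x, G x ξ := by
    rw [← lintegral_indicator measurableSet_Icc]
    refine lintegral_congr fun ξ => ?_
    by_cases hξ : ξ ∈ Set.Icc t b
    · rw [Set.indicator_of_mem hξ, ← lintegral_indicator measurableSet_Icc]
      refine lintegral_congr fun x => ?_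
      simp only [hG, Set.indicator_apply, Set.mem_Icc, Set.mem_ofPred_eq, hξ.1, true_and]
      rfl
    · rw [Set.indicator_of_notMem hξ]
      symm
      convert lintegral_zero with x
      simp only [hG]
      refine Set.indicator_of_notMem ?_ _
      rintro ⟨h1, h2, h3⟩
      exact hξ ⟨h1, h2.trans h3⟩
  rw [h1, h2, lintegral_lintegral_swap hGm.aemeasurable]

theorem rpow_lintegral_le_lintegral_rpow {α : Type*} [MeasurableSpace α] {μ : Measure α}
    (hμ : μ Set.univ ≤ 1) {p : ℝ} (hp : 1 ≤ p) {h : α → ℝ≥0∞} (hm : AEMeasurable h μ) :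
    (∫⁻ x, h x ∂μ) ^ p ≤ ∫⁻ x, h x ^ p ∂μ := by
  rcases hp.eq_or_lt with rfl | hp1
  · simp
  have hp0 : 0 < p := by linarith
  have hH := ENNReal.lintegral_mul_le_Lp_mul_Lq μ (Real.HolderConjugate.conjExponent hp1) hm
    (aemeasurable_const (b := (1 : ℝ≥0∞)))
  have h1 : (∫⁻ _ : α, (1 : ℝ≥0∞) ^ p.conjExponent ∂μ) ^ (1 / p.conjExponent) ≤ 1 := by
    refine ENNReal.rpow_le_one (by simpa using hμ) ?_
    exact one_div_nonneg.2 (Real.HolderConjugate.conjExponent hp1).symm.nonneg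
  have h2 : ∫⁻ x, h x ∂μ ≤ (∫⁻ x, h x ^ p ∂μ) ^ p⁻¹ := by
    rw [← one_div]
    refine le_trans ?_ (hH.trans (mul_le_of_le_one_right' h1))
    simp
  exact (ENNReal.le_rpow_inv_iff hp0).1 h2

theorem rpow_lintegral_mul_le {α : Type*} [MeasurableSpace α] {μ : Measure α}
    (hμ : μ Set.univ ≤ 1) {p : ℝ} (hp : 2 ≤ p) {f g : α → ℝ≥0∞} (hf : AEMeasurable f μ)
    (hg : AEMeasurable g μ) :
    (∫⁻ x, f x * g x ∂μ) ^ p ≤ (∫⁻ x, f x ^ p ∂μ) * ∫⁻ x, g x ^ p ∂μ := by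
  have hp0 : 0 < p := by linarith
  have hc := Real.HolderConjugate.conjExponent (show 1 < p by linarith)
  set q := p.conjExponent with hq
  have hq0 : 0 < q := hc.symm.pos
  have hqp : q ≤ p := by
    rw [hq, Real.conjExponent, div_le_iff₀ (by linarith)]
    nlinarith
  have h1 : (∫⁻ x, g x ^ q ∂μ) ^ (p / q) ≤ ∫⁻ x, g x ^ p ∂μ := by
    refine (rpow_lintegral_le_lintegral_rpow hμ ((one_le_div hq0).2 hqp) (hg.pow_const q)).trans ?_
    refine lintegral_mono fun x => ?_
    rw [← ENNReal.rpow_mul, mul_div_cancel₀ _ hq0.ne']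
  calc (∫⁻ x, f x * g x ∂μ) ^ p
      ≤ ((∫⁻ x, f x ^ p ∂μ) ^ (1 / p) * (∫⁻ x, g x ^ q ∂μ) ^ (1 / q)) ^ p :=
        ENNReal.rpow_le_rpow (ENNReal.lintegral_mul_le_Lp_mul_Lq μ hc hf hg) hp0.le
    _ = (∫⁻ x, f x ^ p ∂μ) * (∫⁻ x, g x ^ q ∂μ) ^ (p / q) := by
        rw [ENNReal.mul_rpow_of_nonneg _ _ hp0.le, ← ENNReal.rpow_mul, ← ENNReal.rpow_mul,
          one_div_mul_cancel hp0.ne', ENNReal.rpow_one, one_div_mul_eq_div]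
    _ ≤ _ := by gcongr

theorem volume_restrict_Icc_univ_le_one {t x : ℝ} (ht : 0 ≤ t) (hx : x ≤ 1) :
    (volume.restrict (Set.Icc t x)) Set.univ ≤ 1 := by
  rw [Measure.restrict_apply_univ, Real.volume_Icc]
  exact ENNReal.ofReal_le_one.2 (by linarith)

theorem Measurable.setLIntegral_Icc_right {G : ℝ → ℝ → ℝ≥0∞}
    (hG : Measurable (Function.uncurry G)) (t : ℝ) :
    Measurable fun x => ∫⁻ ξ in Set.Icc t x, G x ξ := by
  have hT : MeasurableSet {q : ℝ × ℝ | t ≤ q.2 ∧ q.2 ≤ q.1} :=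
    (measurableSet_le measurable_const measurable_snd).inter
      (measurableSet_le measurable_snd measurable_fst)
  convert (hG.indicator hT).lintegral_prod_right' (ν := volume) using 1
  ext x
  rw [← lintegral_indicator measurableSet_Icc]
  refine lintegral_congr fun ξ => ?_
  simp only [Set.indicator_apply, Set.mem_Icc, Set.mem_ofPred_eq]
  rfl

theorem setLIntegral_rpow_setLIntegral_mul_le {f : ℝ → ℝ → ℝ≥0∞} {g : ℝ → ℝ≥0∞}
    (hf : Measurable (Function.uncurry f)) (hg : Measurable g) {p : ℝ} (hp : 1 ≤ p) {t : ℝ}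
    (ht : 0 ≤ t) {D : ℝ≥0∞}
    (hD : ∀ᵐ ξ ∂volume.restrict (Set.Icc (0 : ℝ) 1), ∫⁻ x in Set.Icc ξ 1, f x ξ ^ p ≤ D) :
    ∫⁻ x in Set.Icc t 1, (∫⁻ ξ in Set.Icc t x, f x ξ * g ξ) ^ p ≤
      D * ∫⁻ ξ in Set.Icc t 1, g ξ ^ p := by
  have hfx : ∀ x, Measurable (f x) := fun x => hf.comp measurable_prodMk_left
  have hfξ : ∀ ξ, Measurable fun x => f x ξ := fun ξ => hf.comp measurable_prodMk_right
  have hfg : Measurable (Function.uncurry fun x ξ => (f x ξ * g ξ) ^ p) :=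
    (hf.mul (hg.comp measurable_snd)).pow_const p
  calc ∫⁻ x in Set.Icc t 1, (∫⁻ ξ in Set.Icc t x, f x ξ * g ξ) ^ p
      ≤ ∫⁻ x in Set.Icc t 1, ∫⁻ ξ in Set.Icc t x, (f x ξ * g ξ) ^ p :=
        setLIntegral_mono' measurableSet_Icc fun x hx =>
          rpow_lintegral_le_lintegral_rpow (volume_restrict_Icc_univ_le_one ht hx.2) hp
            ((hfx x).mul hg).aemeasurable
    _ = ∫⁻ ξ in Set.Icc t 1, ∫⁻ x in Set.Icc ξ 1, (f x ξ * g ξ) ^ p :=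
        setLIntegral_triangle_swap hfg t 1
    _ = ∫⁻ ξ in Set.Icc t 1, (∫⁻ x in Set.Icc ξ 1, f x ξ ^ p) * g ξ ^ p := by
        refine lintegral_congr fun ξ => ?_
        rw [← lintegral_mul_const _ ((hfξ ξ).pow_const p)]
        refine lintegral_congr fun x => ?_
        rw [ENNReal.mul_rpow_of_nonneg _ _ (by linarith)]
    _ ≤ ∫⁻ ξ in Set.Icc t 1, D * g ξ ^ p := by
        refine lintegral_mono_ae ?_
        filter_upwards [ae_restrict_of_ae_restrict_of_subset (Set.Icc_subset_Icc_left ht) hD]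
          with ξ hξ
        gcongr
    _ = D * ∫⁻ ξ in Set.Icc t 1, g ξ ^ p := lintegral_const_mul _ (hg.pow_const p)

theorem setLIntegral_rpow_le_of_volterra {n : ℝ → ℝ → ℝ≥0∞} {g F : ℝ → ℝ≥0∞}
    (hn : Measurable (Function.uncurry n)) (hg : Measurable g) (hF : Measurable F)
    {p : ℝ} (hp : 2 ≤ p) {t : ℝ} (ht : t ∈ Set.Icc (0 : ℝ) 1) {K : ℝ≥0∞} {c R : ℝ}
    (hc : 0 ≤ c) (hR : 0 ≤ R)
    (hnR : ∀ᵐ ξ ∂volume.restrict (Set.Icc (0 : ℝ) 1),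
      ∫⁻ x in Set.Icc ξ 1, n x ξ ^ p ≤ ENNReal.ofReal R)
    (hgfin : ∫⁻ x in Set.Icc t 1, g x ^ p ≠ ⊤)
    (hFK : ∫⁻ x in Set.Icc t 1, F x ≤ K)
    (h : ∀ᵐ x ∂volume.restrict (Set.Icc t 1),
      g x ^ p ≤ ENNReal.ofReal c * (F x + (∫⁻ ξ in Set.Icc t x, n x ξ * g ξ) ^ p)) :
    ∫⁻ x in Set.Icc t 1, g x ^ p ≤
      ENNReal.ofReal c * K * ENNReal.ofReal (Real.exp (c * R)) := by
  have hnp : Measurable (Function.uncurry fun x ξ => n x ξ ^ p) := hn.pow_const p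
  have ham : Measurable fun x => ∫⁻ ξ in Set.Icc t x, n x ξ ^ p := hnp.setLIntegral_Icc_right t
  refine setLIntegral_le_mul_exp_of_le_add_mul (F := fun x => ENNReal.ofReal c * F x)
    (a := fun x => ENNReal.ofReal c * ∫⁻ ξ in Set.Icc t x, n x ξ ^ p)
    (ham.const_mul _) ht.2 (mul_nonneg hc hR) hgfin (hF.const_mul _) ?_ ?_ ?_
  · rw [lintegral_const_mul _ hF]
    gcongr
  · rw [lintegral_const_mul _ ham, ENNReal.ofReal_mul hc, setLIntegral_triangle_swap hnp]
    gcongr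
    calc ∫⁻ ξ in Set.Icc t 1, ∫⁻ x in Set.Icc ξ 1, n x ξ ^ p
        ≤ ∫⁻ _ in Set.Icc t 1, ENNReal.ofReal R := lintegral_mono_ae
          (ae_restrict_of_ae_restrict_of_subset (Set.Icc_subset_Icc_left ht.1) hnR)
      _ ≤ ENNReal.ofReal R := by
          rw [lintegral_const]
          exact mul_le_of_le_one_right' (volume_restrict_Icc_univ_le_one ht.1 le_rfl)
  · filter_upwards [h, ae_restrict_mem measurableSet_Icc] with x hx hxI
    refine hx.trans ?_
    rw [mul_add, mul_assoc]
    gcongr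
    exact rpow_lintegral_mul_le (volume_restrict_Icc_univ_le_one ht.1 hxI.2) hp
      (hn.comp measurable_prodMk_left).aemeasurable hg.aemeasurable

theorem X1pNorm_le_iff {p : ℝ} (hp : 0 < p) {f : ℝ → ℝ → ℂ} {C : ℝ≥0∞} :
    X1pNorm p f ≤ C ↔ ∀ᵐ t ∂volume.restrict (Set.Icc (0 : ℝ) 1),
      ∫⁻ x in Set.Icc t 1, ‖f x t‖ₑ ^ p ≤ C ^ p := by
  have h : ∀ z : ℂ, ENNReal.ofReal (‖z‖ ^ p) = ‖z‖ₑ ^ p := fun z => by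
    rw [← ENNReal.ofReal_rpow_of_nonneg (norm_nonneg z) hp.le, ofReal_norm]
  simp only [X1pNorm, h]
  rw [one_div, ENNReal.rpow_inv_le_iff hp]
  exact ⟨fun hle => Filter.Eventually.mono ae_le_essSup fun t ht => ht.trans hle, fun hle => essSup_le_of_ae_le _ hle⟩

theorem ae_ae_triangle {P : ℝ → ℝ → Prop}
    (h : ∀ᵐ q : ℝ × ℝ ∂volume, (0 ≤ q.2 ∧ q.2 ≤ q.1 ∧ q.1 ≤ 1) → P q.1 q.2) :
    ∀ᵐ t ∂volume.restrict (Set.Icc (0 : ℝ) 1), ∀ᵐ x ∂volume.restrict (Set.Icc t 1), P x t := by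
  have h1 : ∀ᵐ q : ℝ × ℝ ∂volume, (0 ≤ q.1 ∧ q.1 ≤ q.2 ∧ q.2 ≤ 1) → P q.2 q.1 :=
    (Measure.measurePreserving_swap (μ := (volume : Measure ℝ))
      (ν := (volume : Measure ℝ))).quasiMeasurePreserving.ae h
  filter_upwards [ae_restrict_of_ae (Measure.ae_ae_of_ae_prod h1),
    ae_restrict_mem measurableSet_Icc] with t ht htI
  filter_upwards [ae_restrict_of_ae ht, ae_restrict_mem measurableSet_Icc] with x hx hxI
  exact hx ⟨htI.1, hxI.1, hxI.2⟩

theorem enorm_intervalIntegral_le_setLIntegral_Icc (f : ℝ → ℂ) {t x : ℝ} (htx : t ≤ x) :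
    ‖∫ ξ in t..x, f ξ‖ₑ ≤ ∫⁻ ξ in Set.Icc t x, ‖f ξ‖ₑ := by
  rw [intervalIntegral.integral_of_le htx, ← integral_Icc_eq_integral_Ioc]
  exact enorm_integral_le_lintegral_enorm f

theorem add_add_rpow_le {p : ℝ} (hp : 1 ≤ p) (a b c : ℝ≥0∞) :
    (a + b + c) ^ p ≤ ENNReal.ofReal (3 ^ (p - 1)) * (a ^ p + b ^ p + c ^ p) := by
  have h := ENNReal.rpow_sum_le_const_mul_sum_rpow (Finset.univ : Finset (Fin 3)) ![a, b, c] hp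
  rw [← ENNReal.ofReal_rpow_of_pos (by norm_num)]
  simpa [Fin.sum_univ_three] using h

theorem one_add_mul_exp_mul_exp_le {p r : ℝ} (hp : 2 ≤ p) (hr : 0 < r) :
    (1 + 2 ^ (p - 1) * r ^ p * Real.exp (2 ^ (p - 1) * r ^ p)) *
      Real.exp (3 ^ (p - 1) * r ^ p) ≤ Real.exp (3 ^ p * r ^ p) := by
  have h23 : (2 : ℝ) ^ (p - 1) ≤ 3 ^ (p - 1) :=
    Real.rpow_le_rpow (by norm_num) (by norm_num) (by linarith)
  have h3 : (3 : ℝ) ^ p = 3 ^ (p - 1) * 3 := by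
    rw [← Real.rpow_add_one (by norm_num), sub_add_cancel]
  have hrp : 0 < r ^ p := Real.rpow_pos_of_pos hr p
  set u := (2 : ℝ) ^ (p - 1) * r ^ p with hu
  have hu0 : 0 ≤ u := by positivity
  have h1 : 1 + u * Real.exp u ≤ Real.exp (u + u) := by
    rw [Real.exp_add]
    nlinarith [Real.add_one_le_exp u, Real.one_le_exp hu0, Real.exp_pos u]
  calc (1 + u * Real.exp u) * Real.exp (3 ^ (p - 1) * r ^ p)
      ≤ Real.exp (u + u) * Real.exp (3 ^ (p - 1) * r ^ p) := by gcongr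
    _ = Real.exp (u + u + 3 ^ (p - 1) * r ^ p) := (Real.exp_add _ _).symm
    _ ≤ Real.exp (3 ^ p * r ^ p) := by
        gcongr
        rw [h3, hu]
        nlinarith

theorem enorm_sub_le_of_resolvent {n s ns ss : ℂ} {f g ft gt : ℝ → ℂ} {t x : ℝ} (htx : t ≤ x)
    (hfg : IntervalIntegrable (fun ξ => f ξ * g ξ) volume t x)
    (hftgt : IntervalIntegrable (fun ξ => ft ξ * gt ξ) volume t x)
    (hmf : Measurable f) (hmg : Measurable g) (hmft : Measurable ft)
    (h : n + s + ∫ ξ in t..x, f ξ * g ξ = 0) (h' : ns + ss + ∫ ξ in t..x, ft ξ * gt ξ = 0) :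
    ‖s - ss‖ₑ ≤ ‖n - ns‖ₑ + (∫⁻ ξ in Set.Icc t x, ‖f ξ - ft ξ‖ₑ * ‖g ξ‖ₑ) +
      ∫⁻ ξ in Set.Icc t x, ‖ft ξ‖ₑ * ‖g ξ - gt ξ‖ₑ := by
  have hs : s - ss = -((n - ns) + ∫ ξ in t..x, (f ξ * g ξ - ft ξ * gt ξ)) := by
    rw [intervalIntegral.integral_sub hfg hftgt]
    linear_combination h - h'
  rw [hs, enorm_neg, add_assoc]
  refine (enorm_add_le _ _).trans ?_
  gcongr
  refine (enorm_intervalIntegral_le_setLIntegral_Icc _ htx).trans ?_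
  rw [← lintegral_add_left (f := fun ξ => ‖f ξ - ft ξ‖ₑ * ‖g ξ‖ₑ)
    ((hmf.sub hmft).enorm.mul hmg.enorm)]
  refine lintegral_mono fun ξ => ?_
  rw [← enorm_mul, ← enorm_mul, show f ξ * g ξ - ft ξ * gt ξ =
    (f ξ - ft ξ) * g ξ + ft ξ * (g ξ - gt ξ) by ring]
  exact enorm_add_le _ _

theorem ae_intervalIntegrable_mul {f : ℝ → ℝ → ℂ} {g : ℝ → ℂ}
    (hf : Measurable (Function.uncurry f)) (hg : Measurable g) {p : ℝ} (hp : 1 ≤ p) {t : ℝ}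
    (ht : 0 ≤ t) (hfin : X1pNorm p f ≠ ⊤) (hgfin : ∫⁻ x in Set.Icc t 1, ‖g x‖ₑ ^ p ≠ ⊤) :
    ∀ᵐ x ∂volume.restrict (Set.Icc t 1),
      IntervalIntegrable (fun ξ => f x ξ * g ξ) volume t x := by
  have hp0 : 0 < p := by linarith
  have hle := setLIntegral_rpow_setLIntegral_mul_le (f := fun x ξ => ‖f x ξ‖ₑ) hf.enorm hg.enorm
    hp ht ((X1pNorm_le_iff hp0).1 le_rfl)
  have hm : Measurable fun x => (∫⁻ ξ in Set.Icc t x, ‖f x ξ‖ₑ * ‖g ξ‖ₑ) ^ p :=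
    (Measurable.setLIntegral_Icc_right (G := fun x ξ => ‖f x ξ‖ₑ * ‖g ξ‖ₑ)
      (hf.enorm.mul (hg.enorm.comp measurable_snd)) t).pow_const p
  have hne := ne_top_of_le_ne_top
    (ENNReal.mul_ne_top (ENNReal.rpow_ne_top_of_nonneg hp0.le hfin) hgfin) hle
  filter_upwards [ae_lt_top hm hne, ae_restrict_mem measurableSet_Icc] with x hx hxI
  rw [intervalIntegrable_iff_integrableOn_Icc_of_le hxI.1]
  refine ⟨((hf.comp measurable_prodMk_left).mul hg).aestronglyMeasurable, ?_⟩
  rw [hasFiniteIntegral_iff_enorm]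
  simp only [enorm_mul]
  exact (ENNReal.rpow_lt_top_iff_of_pos hp0).1 hx

theorem setLIntegral_resolvent_rpow_le {N S : ℝ → ℝ → ℂ} (hmN : Measurable (Function.uncurry N))
    (hmS : Measurable (Function.uncurry S)) {p r : ℝ} (hp : 2 ≤ p) (hr : 0 < r)
    (hNr : X1pNorm p N ≤ ENNReal.ofReal r) {t : ℝ} (ht : t ∈ Set.Icc (0 : ℝ) 1)
    (hNt : ∫⁻ x in Set.Icc t 1, ‖N x t‖ₑ ^ p ≤ ENNReal.ofReal (r ^ p))
    (hSt : ∫⁻ x in Set.Icc t 1, ‖S x t‖ₑ ^ p ≠ ⊤)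
    (heq : ∀ᵐ x ∂volume.restrict (Set.Icc t 1),
      N x t + S x t + ∫ ξ in t..x, N x ξ * S ξ t = 0) :
    ∫⁻ x in Set.Icc t 1, ‖S x t‖ₑ ^ p ≤
      ENNReal.ofReal (2 ^ (p - 1) * r ^ p * Real.exp (2 ^ (p - 1) * r ^ p)) := by
  have hp0 : 0 < p := by linarith
  have hrp : 0 ≤ r ^ p := Real.rpow_nonneg hr.le p
  have hcol := (X1pNorm_le_iff hp0).1 hNr
  rw [ENNReal.ofReal_rpow_of_pos hr] at hcol
  have hc : (0 : ℝ) ≤ 2 ^ (p - 1) := by positivity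
  rw [ENNReal.ofReal_mul (mul_nonneg hc hrp), ENNReal.ofReal_mul hc]
  refine setLIntegral_rpow_le_of_volterra (n := fun x ξ => ‖N x ξ‖ₑ)
    (F := fun x => ‖N x t‖ₑ ^ p) hmN.enorm
    (hmS.comp measurable_prodMk_right).enorm
    ((hmN.comp measurable_prodMk_right).enorm.pow_const p) hp ht hc hrp hcol hSt hNt ?_
  filter_upwards [heq, ae_restrict_mem measurableSet_Icc] with x hx hxI
  have hS : S x t = -(N x t + ∫ ξ in t..x, N x ξ * S ξ t) := by linear_combination hx
  have hle : ‖S x t‖ₑ ≤ ‖N x t‖ₑ + ∫⁻ ξ in Set.Icc t x, ‖N x ξ‖ₑ * ‖S ξ t‖ₑ := by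
    rw [hS, enorm_neg]
    refine (enorm_add_le _ _).trans ?_
    gcongr
    simpa only [enorm_mul] using
      enorm_intervalIntegral_le_setLIntegral_Icc (fun ξ => N x ξ * S ξ t) hxI.1
  refine (ENNReal.rpow_le_rpow hle hp0.le).trans ?_
  refine (ENNReal.rpow_add_le_mul_rpow_add_rpow _ _ (by linarith)).trans ?_
  rw [← ENNReal.ofReal_rpow_of_pos (by norm_num), ENNReal.ofReal_ofNat]
  rfl


/-- Lipschitz dependence of the resolvent kernel on the kernel, uniformly on balls:
if `N + S + N*S = 0` and `Ñ + S̃ + Ñ*S̃ = 0` a.e. on the triangle and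
`‖N‖, ‖Ñ‖ ≤ r`, then `‖S - S̃‖ ≤ 3^{1-1/p} exp(p⁻¹ 3^p r^p) ‖N - Ñ‖`. -/
theorem stmt12 (p : ℝ) (hp : 2 ≤ p) (r : ℝ) (hr : 0 < r)
    (N S Nt St : ℝ → ℝ → ℂ)
    (hmN : Measurable (Function.uncurry N)) (hmS : Measurable (Function.uncurry S))
    (hmNt : Measurable (Function.uncurry Nt)) (hmSt : Measurable (Function.uncurry St))
    (hNfin : X1pNorm p N ≠ ⊤) (hSfin : X1pNorm p S ≠ ⊤)
    (hNtfin : X1pNorm p Nt ≠ ⊤) (hStfin : X1pNorm p St ≠ ⊤)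
    (heq : ∀ᵐ q : ℝ × ℝ ∂volume, (0 ≤ q.2 ∧ q.2 ≤ q.1 ∧ q.1 ≤ 1) →
      N q.1 q.2 + S q.1 q.2 + ∫ ξ in q.2..q.1, N q.1 ξ * S ξ q.2 = 0)
    (heqt : ∀ᵐ q : ℝ × ℝ ∂volume, (0 ≤ q.2 ∧ q.2 ≤ q.1 ∧ q.1 ≤ 1) →
      Nt q.1 q.2 + St q.1 q.2 + ∫ ξ in q.2..q.1, Nt q.1 ξ * St ξ q.2 = 0)
    (hNr : X1pNorm p N ≤ ENNReal.ofReal r) (hNtr : X1pNorm p Nt ≤ ENNReal.ofReal r) :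
    X1pNorm p (fun x t => S x t - St x t) ≤
      ENNReal.ofReal (3 ^ (1 - 1 / p) * Real.exp (p⁻¹ * 3 ^ p * r ^ p)) *
        X1pNorm p (fun x t => N x t - Nt x t) := by
  have hp0 : 0 < p := by linarith
  have hrp : 0 ≤ r ^ p := Real.rpow_nonneg hr.le p
  have hcolt := (X1pNorm_le_iff hp0).1 hNtr
  have hcol := (X1pNorm_le_iff hp0).1 hNr
  rw [ENNReal.ofReal_rpow_of_pos hr] at hcol hcolt
  have hmD : Measurable (Function.uncurry fun x t => N x t - Nt x t) := hmN.sub hmNt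
  set D := X1pNorm p (fun x t => N x t - Nt x t) with hD
  have hcolD := (X1pNorm_le_iff hp0).1 hD.ge
  have hc : (0 : ℝ) ≤ 3 ^ (p - 1) := by positivity
  rw [X1pNorm_le_iff hp0]
  filter_upwards [hcol, hcolD, (X1pNorm_le_iff hp0).1 (le_refl (X1pNorm p S)),
    (X1pNorm_le_iff hp0).1 (le_refl (X1pNorm p St)),
    ae_ae_triangle (P := fun x t => N x t + S x t + ∫ ξ in t..x, N x ξ * S ξ t = 0) heq,
    ae_ae_triangle (P := fun x t => Nt x t + St x t + ∫ ξ in t..x, Nt x ξ * St ξ t = 0) heqt,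
    ae_restrict_mem measurableSet_Icc] with t hNt hDt hSt hStt het hett ht
  have hmSt' : Measurable fun x => S x t := hmS.comp measurable_prodMk_right
  have hmStt : Measurable fun x => St x t := hmSt.comp measurable_prodMk_right
  have hSfin' := ne_top_of_le_ne_top (ENNReal.rpow_ne_top_of_nonneg hp0.le hSfin) hSt
  have hStfin' := ne_top_of_le_ne_top (ENNReal.rpow_ne_top_of_nonneg hp0.le hStfin) hStt
  have hσ := setLIntegral_resolvent_rpow_le hmN hmS hp hr hNr ht hNt hSfin' het
  set σ : ℝ := 2 ^ (p - 1) * r ^ p * Real.exp (2 ^ (p - 1) * r ^ p)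
  have hσ0 : 0 ≤ σ := by positivity
  have hconv := setLIntegral_rpow_setLIntegral_mul_le (f := fun x ξ => ‖N x ξ - Nt x ξ‖ₑ)
    hmD.enorm hmSt'.enorm (by linarith) ht.1 hcolD
  have hmDt : Measurable fun x => ‖N x t - Nt x t‖ₑ ^ p :=
    (hmD.comp measurable_prodMk_right).enorm.pow_const p
  have hmconv : Measurable fun x =>
      (∫⁻ ξ in Set.Icc t x, ‖N x ξ - Nt x ξ‖ₑ * ‖S ξ t‖ₑ) ^ p :=
    (Measurable.setLIntegral_Icc_right (G := fun x ξ => ‖N x ξ - Nt x ξ‖ₑ * ‖S ξ t‖ₑ)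
      (hmD.enorm.mul (hmSt'.enorm.comp measurable_snd)) t).pow_const p
  have hDSfin : ∫⁻ x in Set.Icc t 1, ‖S x t - St x t‖ₑ ^ p ≠ ⊤ := by
    have hle : ∀ x, ‖S x t - St x t‖ₑ ^ p ≤ 2 ^ (p - 1) * (‖S x t‖ₑ ^ p + ‖St x t‖ₑ ^ p) :=
      fun x => (ENNReal.rpow_le_rpow enorm_sub_le hp0.le).trans
        (ENNReal.rpow_add_le_mul_rpow_add_rpow _ _ (by linarith))
    refine ne_top_of_le_ne_top ?_ (lintegral_mono hle)
    rw [lintegral_const_mul' _ _ (ENNReal.rpow_ne_top_of_nonneg (by linarith) (by norm_num)),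
      lintegral_add_left (hmSt'.enorm.pow_const p)]
    exact ENNReal.mul_ne_top (ENNReal.rpow_ne_top_of_nonneg (by linarith) (by norm_num))
      (ENNReal.add_ne_top.2 ⟨hSfin', hStfin'⟩)
  have hmain := setLIntegral_rpow_le_of_volterra (n := fun x ξ => ‖Nt x ξ‖ₑ)
    (g := fun x => ‖S x t - St x t‖ₑ)
    (F := fun x => ‖N x t - Nt x t‖ₑ ^ p +
      (∫⁻ ξ in Set.Icc t x, ‖N x ξ - Nt x ξ‖ₑ * ‖S ξ t‖ₑ) ^ p)
    (K := D ^ p * ENNReal.ofReal (1 + σ))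
    hmNt.enorm (hmSt'.sub hmStt).enorm (hmDt.add hmconv) hp ht hc hrp hcolt hDSfin
    (by
      rw [lintegral_add_left hmDt, ENNReal.ofReal_add zero_le_one hσ0, mul_add,
        ENNReal.ofReal_one, mul_one]
      gcongr
      exact hconv.trans (by gcongr))
    (by
      filter_upwards [het, hett,
        ae_intervalIntegrable_mul hmN hmSt' (by linarith) ht.1 hNfin hSfin',
        ae_intervalIntegrable_mul hmNt hmStt (by linarith) ht.1 hNtfin hStfin',
        ae_restrict_mem measurableSet_Icc] with x h1 h2 hi1 hi2 hxI
      refine (ENNReal.rpow_le_rpow (enorm_sub_le_of_resolvent hxI.1 hi1 hi2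
        (hmN.comp measurable_prodMk_left) hmSt' (hmNt.comp measurable_prodMk_left) h1 h2)
        hp0.le).trans ?_
      exact add_add_rpow_le (by linarith) _ _ _)
  refine hmain.trans ?_
  have hconst : 3 ^ (p - 1) * ((1 + σ) * Real.exp (3 ^ (p - 1) * r ^ p)) ≤
      (3 ^ (1 - 1 / p) * Real.exp (p⁻¹ * 3 ^ p * r ^ p)) ^ p := by
    rw [Real.mul_rpow (by positivity) (by positivity), ← Real.rpow_mul (by norm_num),
      ← Real.exp_mul, show (1 - 1 / p) * p = p - 1 by field_simp,
      show p⁻¹ * 3 ^ p * r ^ p * p = 3 ^ p * r ^ p by field_simp]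
    gcongr
    exact one_add_mul_exp_mul_exp_le hp hr
  rw [ENNReal.mul_rpow_of_nonneg _ _ hp0.le, ENNReal.ofReal_rpow_of_nonneg (by positivity) hp0.le]
  calc ENNReal.ofReal (3 ^ (p - 1)) * (D ^ p * ENNReal.ofReal (1 + σ)) *
        ENNReal.ofReal (Real.exp (3 ^ (p - 1) * r ^ p))
      = ENNReal.ofReal (3 ^ (p - 1) * ((1 + σ) * Real.exp (3 ^ (p - 1) * r ^ p))) * D ^ p := by
        rw [ENNReal.ofReal_mul hc, ENNReal.ofReal_mul (by positivity)]
        ring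
    _ ≤ _ := by gcongr
end
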